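/- Let f be an orientation-preserving C^∞ circle diffeomorphism with rotation number p/q mod 1 (p, q coprime integers, q ≥ 1) and vanishing asymptotic variation (Var_{[0,1]}(log DFⁿ)/n → 0 for a lift F). Then: (1) if f^q has no ITI fixed point, f is conjugated in the group of orientation-preserving C^∞ circle diffeomorphisms to a diffeomorphism of the form g∘R_{p/q}, where g is a C^∞ circle diffeomorphism fixing the point 0, without ITI fixed point, commuting with R_{p/q}, and with vanishing asymptotic variation; (2) if f^q has an ITI fixed point, f is conjugated in the same group to a diffeomorphism of the form h∘R_{p/q}, where h is a C^∞ circle diffeomorphism equal to the identity outside the arc R_{−p/q}([0,1/q]) and with vanishing asymptotic variation. -/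

import Mathlib

open Filter Set

noncomputable section

/-- A lift of an orientation-preserving `C^∞` diffeomorphism of the circle `ℝ/ℤ`. -/
structure CircleLift where
  toFun : ℝ → ℝ
  invFun : ℝ → ℝ
  smooth : ContDiff ℝ (⊤ : ℕ∞) toFun
  smooth_inv : ContDiff ℝ (⊤ : ℕ∞) invFun
  left_inv : Function.LeftInverse invFun toFun
  right_inv : Function.RightInverse invFun toFun
  mono : StrictMono toFun
  lift : ∀ x : ℝ, toFun (x + 1) = toFun x + 1

/-- The asymptotic variation of the circle diffeomorphism with lift `F` vanishes. -/
def AsympVarVanishesC (F : CircleLift) : Prop :=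
  Tendsto (fun n : ℕ =>
      (eVariationOn (fun x => Real.log (deriv (F.toFun^[n]) x)) (Set.Icc 0 1)).toReal / n)
    atTop (nhds 0)

/-- The point `x` is a fixed point of the circle map with lift `G` at which it is
infinitely tangent to the identity (ITI). -/
def ITIFixedPoint (G : ℝ → ℝ) (x : ℝ) : Prop :=
  (∃ m : ℤ, G x = x + m) ∧ deriv G x = 1 ∧ ∀ k : ℕ, 2 ≤ k → iteratedDeriv k G x = 0

/-! ### The group of lifts -/

namespace CircleLift

instance : CoeFun CircleLift fun _ => ℝ → ℝ := ⟨toFun⟩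

@[ext]
theorem ext {F G : CircleLift} (h : ∀ x, F x = G x) : F = G := by
  have h1 : F.toFun = G.toFun := funext h
  have h2 : F.invFun = G.invFun := by
    funext y
    apply G.left_inv.injective
    rw [G.right_inv, ← h, F.right_inv]
  cases F; cases G; simp_all

theorem lift_inv (F : CircleLift) (x : ℝ) : F.invFun (x + 1) = F.invFun x + 1 := by
  apply F.left_inv.injective
  rw [F.right_inv, F.lift, F.right_inv]

theorem strictMono_inv (F : CircleLift) : StrictMono F.invFun := by
  intro x y h
  by_contra! h'
  have := F.mono.monotone h'
  rw [F.right_inv, F.right_inv] at this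
  linarith

instance : Mul CircleLift :=
  ⟨fun F G =>
    { toFun := F ∘ G
      invFun := G.invFun ∘ F.invFun
      smooth := F.smooth.comp G.smooth
      smooth_inv := G.smooth_inv.comp F.smooth_inv
      left_inv := fun x => by simp [F.left_inv _, G.left_inv _]
      right_inv := fun x => by simp [F.right_inv _, G.right_inv _]
      mono := F.mono.comp G.mono
      lift := fun x => by simp [G.lift, F.lift] }⟩

instance : One CircleLift :=
  ⟨{ toFun := id
     invFun := id
     smooth := contDiff_id
     smooth_inv := contDiff_id
     left_inv := fun _ => rfl
     right_inv := fun _ => rfl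
     mono := strictMono_id
     lift := fun _ => rfl }⟩

instance : Inv CircleLift :=
  ⟨fun F =>
    { toFun := F.invFun
      invFun := F.toFun
      smooth := F.smooth_inv
      smooth_inv := F.smooth
      left_inv := F.right_inv
      right_inv := F.left_inv
      mono := F.strictMono_inv
      lift := F.lift_inv }⟩

instance : Group CircleLift :=
  Group.ofLeftAxioms (fun _ _ _ => rfl) (fun _ => rfl) fun F => ext fun x => F.left_inv x

@[simp] theorem mul_apply (F G : CircleLift) (x : ℝ) : (F * G) x = F (G x) := rfl

@[simp] theorem one_apply (x : ℝ) : (1 : CircleLift) x = x := rfl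

@[simp] theorem inv_apply_self (F : CircleLift) (x : ℝ) : F⁻¹ (F x) = x := F.left_inv x

@[simp] theorem apply_inv_self (F : CircleLift) (x : ℝ) : F (F⁻¹ x) = x := F.right_inv x

theorem coe_pow (F : CircleLift) (n : ℕ) : (F ^ n).toFun = F.toFun^[n] := by
  induction n with
  | zero => rfl
  | succ n ih =>
    rw [pow_succ, Function.iterate_succ, ← ih]
    rfl

/-- The lift of a rotation. -/
def translation (c : ℝ) : CircleLift where
  toFun x := x + c
  invFun x := x - c
  smooth := contDiff_id.add contDiff_const
  smooth_inv := contDiff_id.sub contDiff_const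
  left_inv x := by ring
  right_inv x := by ring
  mono _ _ h := by simpa using h
  lift x := by ring

@[simp] theorem translation_apply (c x : ℝ) : translation c x = x + c := rfl

theorem inv_translation (c : ℝ) : (translation c)⁻¹ = translation (-c) :=
  ext fun x => by change x - c = x + -c; ring

theorem translation_mul (c d : ℝ) : translation c * translation d = translation (c + d) :=
  ext fun x => by simp; ring

theorem translation_pow (c : ℝ) (n : ℕ) : translation c ^ n = translation (n * c) := by
  induction n with
  | zero => ext; simp
  | succ n ih => rw [pow_succ, ih, translation_mul]; congr 1; push_cast; ring

theorem translation_zpow (c : ℝ) (n : ℤ) : translation c ^ n = translation (n * c) := by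
  cases n with
  | ofNat n => simpa using translation_pow c n
  | negSucc n =>
    rw [zpow_negSucc, translation_pow, inv_translation]
    congr 1
    push_cast
    ring

theorem commute_translation_one (F : CircleLift) : Commute F (translation 1) :=
  ext fun x => F.lift x

theorem commute_translation_int (F : CircleLift) (m : ℤ) : Commute F (translation m) := by
  have := F.commute_translation_one.zpow_right m
  rwa [translation_zpow, mul_one] at this

theorem map_add_int (F : CircleLift) (x : ℝ) (m : ℤ) : F (x + m) = F x + m := by
  have := congrArg (fun G : CircleLift => G x) (F.commute_translation_int m)
  simpa using this

theorem differentiable (F : CircleLift) : Differentiable ℝ F :=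
  F.smooth.differentiable (by simp)

theorem deriv_mul (F G : CircleLift) (x : ℝ) :
    deriv (F * G).toFun x = deriv F (G x) * deriv G x :=
  deriv_comp x (F.differentiable _) (G.differentiable _)

theorem deriv_pos (F : CircleLift) (x : ℝ) : 0 < deriv F x := by
  have h := deriv_mul F⁻¹ F x
  have h1 : deriv (F⁻¹ * F).toFun x = 1 := by
    rw [inv_mul_cancel]
    exact deriv_id x
  have h2 : 0 ≤ deriv F x := F.mono.monotone.deriv_nonneg
  rcases h2.lt_or_eq with h3 | h3
  · exact h3
  · rw [h1, ← h3] at h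
    simp at h

theorem deriv_inv (F : CircleLift) (x : ℝ) : deriv (F⁻¹).toFun x = (deriv F (F⁻¹ x))⁻¹ := by
  have h := deriv_mul F F⁻¹ x
  have h1 : deriv (F * F⁻¹).toFun x = 1 := by
    rw [mul_inv_cancel]
    exact deriv_id x
  rw [h1] at h
  exact eq_inv_of_mul_eq_one_right h.symm

@[simp] theorem deriv_translation (c x : ℝ) : deriv (translation c) x = 1 := by
  change deriv (fun x => x + c) x = 1
  simp

theorem deriv_add_int (F : CircleLift) (x : ℝ) (m : ℤ) : deriv F (x + m) = deriv F x := by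
  have h := congrArg (fun G : CircleLift => deriv G x) (F.commute_translation_int m)
  simpa [deriv_mul] using h

theorem contDiff_deriv (F : CircleLift) : ContDiff ℝ (⊤ : ℕ∞) (deriv F) :=
  (contDiff_infty_iff_deriv.1 F.smooth).2

theorem contDiff_log_deriv (F : CircleLift) :
    ContDiff ℝ (⊤ : ℕ∞) fun x => Real.log (deriv F x) :=
  F.contDiff_deriv.log fun x => (F.deriv_pos x).ne'

/-- A smooth map commuting with the unit translation and with positive derivative is
the lift of a diffeomorphism. -/
def ofDerivPos (f : ℝ → ℝ) (hf : ContDiff ℝ (⊤ : ℕ∞) f) (hpos : ∀ x, 0 < deriv f x)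
    (hlift : ∀ x, f (x + 1) = f x + 1) : CircleLift :=
  have hmono : StrictMono f := strictMono_of_deriv_pos hpos
  have hsurj : Function.Surjective f := by
    have hn : ∀ n : ℕ, f n = f 0 + n ∧ f (-n) = f 0 - n := by
      intro n
      induction n with
      | zero => simp
      | succ n ih =>
        have h1 := hlift n
        have h2 := hlift (-(n + 1 : ℝ))
        rw [show -(n + 1 : ℝ) + 1 = -n by ring] at h2
        push_cast
        constructor <;> linarith [ih.1, ih.2]
    intro y
    obtain ⟨n, hn'⟩ := exists_nat_gt |y - f 0|
    have := abs_lt.1 hn'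
    have hI := intermediate_value_Icc (a := -(n : ℝ)) (b := n)
      (by linarith [abs_nonneg (y - f 0)]) hf.continuous.continuousOn
    obtain ⟨x, -, hx⟩ := hI (show y ∈ Icc _ _ from
      ⟨by rw [(hn n).2]; linarith, by rw [(hn n).1]; linarith⟩)
    exact ⟨x, hx⟩
  let e := Equiv.ofBijective f ⟨hmono.injective, hsurj⟩
  { toFun := f
    invFun := e.symm
    smooth := hf
    smooth_inv := by
      let o := (hmono.orderIsoOfSurjective f hsurj).toHomeomorph
      have : ⇑e.symm = o.symm := by
        funext y
        apply hmono.injective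
        exact (e.apply_symm_apply y).trans (o.apply_symm_apply y).symm
      rw [this, contDiff_iff_contDiffAt]
      intro y
      exact o.toOpenPartialHomeomorph.contDiffAt_symm_deriv (f₀' := deriv f (o.symm y))
        (hpos _).ne' (mem_univ _)
        (hf.differentiable (by simp) _).hasDerivAt hf.contDiffAt
    left_inv := e.symm_apply_apply
    right_inv := e.apply_symm_apply
    mono := hmono
    lift := hlift }

@[simp] theorem ofDerivPos_apply (f : ℝ → ℝ) (hf hpos hlift) (x : ℝ) :
    ofDerivPos f hf hpos hlift x = f x := rfl

end CircleLift

/-! ### Variation of the logarithmic derivative -/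

theorem eVariationOn_add_le (f g : ℝ → ℝ) (s : Set ℝ) :
    eVariationOn (fun x => f x + g x) s ≤ eVariationOn f s + eVariationOn g s := by
  refine iSup_le fun p => ?_
  calc _ ≤ ∑ i ∈ Finset.range p.1, (edist (f (p.2.1 (i + 1))) (f (p.2.1 i)) +
        edist (g (p.2.1 (i + 1))) (g (p.2.1 i))) :=
        Finset.sum_le_sum fun i _ => edist_add_add_le _ _ _ _
    _ ≤ _ := by
      rw [Finset.sum_add_distrib]
      exact add_le_add (eVariationOn.sum_le p.2.2.1 p.2.2.2)
        (eVariationOn.sum_le p.2.2.1 p.2.2.2)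

theorem eVariationOn_comp_Icc (f : ℝ → ℝ) {φ : ℝ → ℝ} (hφ : Monotone φ) (hc : Continuous φ)
    {a b : ℝ} (hab : a ≤ b) :
    eVariationOn (f ∘ φ) (Icc a b) = eVariationOn f (Icc (φ a) (φ b)) := by
  rw [eVariationOn.comp_eq_of_monotoneOn f φ (hφ.monotoneOn _)]
  congr 1
  exact (hφ.mapsTo_Icc.image_subset).antisymm (intermediate_value_Icc hab hc.continuousOn)

theorem Function.Periodic.eVariationOn_Icc_add_one {f : ℝ → ℝ} (hf : Function.Periodic f 1)
    (c : ℝ) : eVariationOn f (Icc c (c + 1)) = eVariationOn f (Icc 0 1) := by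
  have hshift : ∀ (m : ℤ) {a b : ℝ}, a ≤ b →
      eVariationOn f (Icc (a + m) (b + m)) = eVariationOn f (Icc a b) := by
    intro m a b hab
    rw [← eVariationOn_comp_Icc f (φ := fun x => x + m) (fun _ _ h => by simpa using h)
      (by fun_prop) hab]
    congr 1
    funext x
    simpa using hf.int_mul m x
  have h1 := hshift ⌊c⌋ (a := Int.fract c) (b := Int.fract c + 1) (by linarith)
  rw [show Int.fract c + 1 + ⌊c⌋ = (Int.fract c + ⌊c⌋) + 1 by ring, Int.fract_add_floor] at h1
  have h0 := Int.fract_nonneg c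
  have h2 := (Int.fract_lt_one c).le
  have h3 := hshift 1 (a := 0) (b := Int.fract c) h0
  rw [Int.cast_one, zero_add, add_comm (Int.fract c)] at h3
  rw [h1, add_comm (Int.fract c),
    ← univ_inter (Icc (Int.fract c) _), ← univ_inter (Icc 0 1),
    ← eVariationOn.Icc_add_Icc f h2 (by linarith) (mem_univ _),
    ← eVariationOn.Icc_add_Icc f h0 h2 (mem_univ _)]
  simp only [univ_inter]
  rw [h3, add_comm]

namespace CircleLift

theorem periodic_log_deriv (F : CircleLift) :
    Function.Periodic (fun x => Real.log (deriv F x)) 1 := by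
  intro x
  have := F.deriv_add_int x 1
  simp only [Int.cast_one] at this
  simp only [this]

/-- The variation of `log DF` over one period. -/
def eLogVar (F : CircleLift) : ENNReal :=
  eVariationOn (fun x => Real.log (deriv F x)) (Icc 0 1)

theorem eVariationOn_log_deriv (F : CircleLift) (c : ℝ) :
    eVariationOn (fun x => Real.log (deriv F x)) (Icc c (c + 1)) = F.eLogVar :=
  F.periodic_log_deriv.eVariationOn_Icc_add_one c

theorem eLogVar_ne_top (F : CircleLift) : F.eLogVar ≠ ⊤ := by
  have h : LocallyLipschitz fun x => Real.log (deriv F x) :=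
    (F.contDiff_log_deriv.of_le (by simp : (1 : WithTop ℕ∞) ≤ _)).locallyLipschitz
  obtain ⟨K, hK⟩ := h.locallyLipschitzOn.exists_lipschitzOnWith_of_compact
    (isCompact_Icc (a := (0 : ℝ)) (b := 1))
  have h1 := hK.locallyBoundedVariationOn 0 1 (by simp) (by simp)
  rwa [inter_self] at h1

theorem eLogVar_mul_le (F G : CircleLift) : (F * G).eLogVar ≤ F.eLogVar + G.eLogVar := by
  have h1 : (fun x => Real.log (deriv (F * G).toFun x)) = fun x =>
      ((fun x => Real.log (deriv F x)) ∘ G) x + Real.log (deriv G x) := by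
    funext x
    rw [deriv_mul, Real.log_mul (F.deriv_pos _).ne' (G.deriv_pos _).ne']
    rfl
  calc (F * G).eLogVar ≤ _ + _ := by
        unfold eLogVar
        rw [h1]
        exact eVariationOn_add_le _ _ _
    _ = F.eLogVar + G.eLogVar := by
        rw [eVariationOn_comp_Icc _ G.mono.monotone G.smooth.continuous zero_le_one]
        have := G.lift 0
        rw [zero_add] at this
        rw [this, eVariationOn_log_deriv]
        rfl

theorem eLogVar_translation (c : ℝ) : (translation c).eLogVar = 0 := by
  unfold eLogVar
  simp only [deriv_translation]
  exact eVariationOn.constant_on (by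
    rintro _ ⟨x, -, rfl⟩ _ ⟨y, -, rfl⟩
    rfl)

theorem asympVarVanishesC_iff (F : CircleLift) :
    AsympVarVanishesC F ↔
      Tendsto (fun n : ℕ => (F ^ n).eLogVar.toReal / n) atTop (nhds 0) := by
  unfold AsympVarVanishesC eLogVar
  simp only [coe_pow]

end CircleLift

section AsympVar

open CircleLift

/-- A diffeomorphism whose iterates have variation controlled by those of `F`, up to a
constant, has vanishing asymptotic variation if `F` has. -/
theorem AsympVarVanishesC.of_le {F G : CircleLift} (hF : AsympVarVanishesC F) {C : ENNReal}
    (hC : C ≠ ⊤) (h : ∀ n, (G ^ n).eLogVar ≤ (F ^ n).eLogVar + C) : AsympVarVanishesC G := by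
  rw [asympVarVanishesC_iff] at hF ⊢
  have h1 : Tendsto (fun n : ℕ => (F ^ n).eLogVar.toReal / n + C.toReal / n) atTop (nhds 0) := by
    simpa using hF.add (tendsto_const_div_atTop_nhds_zero_nat C.toReal)
  refine squeeze_zero (fun n => by positivity) (fun n => ?_) h1
  rw [← add_div, ← ENNReal.toReal_add (eLogVar_ne_top _) hC]
  gcongr
  · exact ENNReal.add_ne_top.2 ⟨eLogVar_ne_top _, hC⟩
  · exact h n

theorem AsympVarVanishesC.conj {F : CircleLift} (hF : AsympVarVanishesC F) (Φ : CircleLift) :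
    AsympVarVanishesC (Φ * F * Φ⁻¹) := by
  refine hF.of_le (C := Φ.eLogVar + (Φ⁻¹).eLogVar)
    (ENNReal.add_ne_top.2 ⟨eLogVar_ne_top _, eLogVar_ne_top _⟩) fun n => ?_
  rw [conj_pow]
  calc _ ≤ (Φ * F ^ n).eLogVar + (Φ⁻¹).eLogVar := eLogVar_mul_le _ _
    _ ≤ Φ.eLogVar + (F ^ n).eLogVar + (Φ⁻¹).eLogVar := by gcongr; exact eLogVar_mul_le _ _
    _ = _ := by ring

theorem AsympVarVanishesC.mul_translation {F : CircleLift} (hF : AsympVarVanishesC F) (m : ℤ) :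
    AsympVarVanishesC (F * translation m) := by
  refine hF.of_le (C := 0) (by simp) fun n => ?_
  rw [(F.commute_translation_int m).mul_pow, translation_pow]
  simpa [eLogVar_translation] using eLogVar_mul_le (F ^ n) (translation (n * m))

theorem AsympVarVanishesC.pow {F : CircleLift} (hF : AsympVarVanishesC F) {q : ℕ} (hq : 1 ≤ q) :
    AsympVarVanishesC (F ^ q) := by
  rw [asympVarVanishesC_iff] at hF ⊢
  have h1 : Tendsto (fun n : ℕ => q * n) atTop atTop :=
    tendsto_id.const_mul_atTop' (by omega)
  have h2 := (hF.comp h1).const_mul (q : ℝ)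
  rw [mul_zero] at h2
  refine h2.congr fun n => ?_
  have : (q : ℝ) ≠ 0 := by positivity
  simp only [Function.comp, ← pow_mul, Nat.cast_mul]
  rw [mul_div_assoc']
  exact mul_div_mul_left _ _ this

theorem AsympVarVanishesC.of_pow {F : CircleLift} {q : ℕ} (hq : 1 ≤ q)
    (hF : AsympVarVanishesC (F ^ q)) : AsympVarVanishesC F := by
  rw [asympVarVanishesC_iff] at hF ⊢
  set C : ℝ := ∑ r ∈ Finset.range q, (F ^ r).eLogVar.toReal with hC
  have hdiv : Tendsto (fun n : ℕ => n / q) atTop atTop :=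
    Nat.tendsto_div_const_atTop (by omega)
  have h1 : Tendsto (fun n : ℕ => (((F ^ q) ^ (n / q)).eLogVar.toReal / (n / q : ℕ)) + C / n)
      atTop (nhds 0) := by
    simpa using (hF.comp hdiv).add (tendsto_const_div_atTop_nhds_zero_nat C)
  refine squeeze_zero' (Eventually.of_forall fun n => by positivity) ?_ h1
  filter_upwards [eventually_ge_atTop q] with n hn
  have h2 : (F ^ n).eLogVar.toReal ≤ ((F ^ q) ^ (n / q)).eLogVar.toReal + C := by
    have h3 : F ^ n = (F ^ q) ^ (n / q) * F ^ (n % q) := by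
      rw [← pow_mul, ← pow_add, Nat.div_add_mod]
    calc (F ^ n).eLogVar.toReal
        ≤ (((F ^ q) ^ (n / q)).eLogVar + (F ^ (n % q)).eLogVar).toReal := by
          refine ENNReal.toReal_mono
            (ENNReal.add_ne_top.2 ⟨eLogVar_ne_top _, eLogVar_ne_top _⟩) ?_
          conv_lhs => rw [h3]
          exact eLogVar_mul_le _ _
      _ = ((F ^ q) ^ (n / q)).eLogVar.toReal + (F ^ (n % q)).eLogVar.toReal :=
          ENNReal.toReal_add (eLogVar_ne_top _) (eLogVar_ne_top _)
      _ ≤ _ := by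
          gcongr
          exact Finset.single_le_sum (f := fun r => (F ^ r).eLogVar.toReal)
            (fun r _ => ENNReal.toReal_nonneg)
            (Finset.mem_range.2 (Nat.mod_lt _ (by omega)))
  have h4 : 0 < n / q := Nat.div_pos hn (by omega)
  calc (F ^ n).eLogVar.toReal / n ≤ (((F ^ q) ^ (n / q)).eLogVar.toReal + C) / n := by gcongr
    _ ≤ _ := by
      rw [add_div]
      gcongr
      exact Nat.div_le_self n q

end AsympVar

namespace CircleLift

/-! ### Periodic orbits -/

/-- The underlying monotone degree one map. -/
def toDeg1Lift (F : CircleLift) : CircleDeg1Lift := ⟨⟨F, F.mono.monotone⟩, F.lift⟩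

theorem translationNumber_eq (F : CircleLift) {ρ : ℝ}
    (h : Tendsto (fun n : ℕ => F.toFun^[n] 0 / n) atTop (nhds ρ)) :
    F.toDeg1Lift.translationNumber = ρ := by
  refine tendsto_nhds_unique F.toDeg1Lift.tendsto_translation_number₀ (h.congr fun n => ?_)
  rw [CircleDeg1Lift.coe_pow]
  rfl

theorem exists_periodic_point (F : CircleLift) {q : ℕ} (hq : 1 ≤ q) {P : ℤ}
    (h : Tendsto (fun n : ℕ => F.toFun^[n] 0 / n) atTop (nhds ((P : ℝ) / q))) :
    ∃ x, (F ^ q) x = x + P := by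
  obtain ⟨x, hx⟩ := (F.toDeg1Lift.translationNumber_eq_rat_iff F.smooth.continuous (by omega)).1
    (F.translationNumber_eq h)
  refine ⟨x, ?_⟩
  rw [CircleDeg1Lift.coe_pow] at hx
  rw [coe_pow]
  exact hx

theorem eq_of_pow_apply_eq (F : CircleLift) {q : ℕ} (hq : 1 ≤ q) {P n : ℤ}
    (h : Tendsto (fun n : ℕ => F.toFun^[n] 0 / n) atTop (nhds ((P : ℝ) / q))) {a : ℝ}
    (ha : (F ^ q) a = a + n) : n = P := by
  have h1 := F.toDeg1Lift.translationNumber_of_map_pow_eq_add_int (x := a) (n := q) (m := n)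
    (by
      rw [CircleDeg1Lift.coe_pow]
      rw [coe_pow] at ha
      exact ha) (by omega)
  rw [F.translationNumber_eq h, div_left_inj' (by positivity)] at h1
  exact_mod_cast h1.symm

/-- The order of an orbit of period `q` is that of the orbit of the rotation. -/
theorem orbit_lt_orbit_iff (F : CircleLift) {q : ℕ} (hq : 1 ≤ q) {P : ℤ} {a : ℝ}
    (ha : (F ^ q) a = a + P) (i m j n : ℤ) :
    (F ^ i) a + m < (F ^ j) a + n ↔ i * P + q * m < j * P + q * n := by
  have hfix : ∀ l : ℤ, ((F ^ q) ^ l) a = a + (l * P : ℤ) := by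
    have hs : (translation ((-P : ℤ) : ℝ) * F ^ q) a = a := by
      simp [ha]
    have hz : ∀ l : ℤ, ((translation ((-P : ℤ) : ℝ) * F ^ q) ^ l) a = a := by
      have hn : ∀ l : ℕ, ((translation ((-P : ℤ) : ℝ) * F ^ q) ^ l) a = a := by
        intro l
        induction l with
        | zero => rfl
        | succ l ih => rw [pow_succ, mul_apply, hs, ih]
      intro l
      cases l with
      | ofNat l => exact_mod_cast hn l
      | negSucc l =>
        rw [zpow_negSucc]
        conv_lhs => rw [← hn (l + 1)]
        exact inv_apply_self _ _
    intro l
    have h1 := hz l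
    rw [((commute_translation_int (F ^ q) (-P)).symm).mul_zpow, translation_zpow] at h1
    simp only [mul_apply, translation_apply] at h1
    push_cast at h1 ⊢
    linarith
  let u := F ^ i * translation (m : ℝ)
  let v := F ^ j * translation (n : ℝ)
  have hu : (u ^ q) a = a + (i * P + q * m : ℤ) := by
    have : u ^ q = (F ^ q) ^ i * translation ((q * m : ℤ) : ℝ) := by
      rw [(commute_translation_int (F ^ i) m).mul_pow, translation_pow, ← zpow_natCast,
        ← zpow_natCast, zpow_comm]
      push_cast
      rfl
    rw [this, mul_apply, translation_apply, map_add_int, hfix]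
    push_cast
    ring
  have hv : (v ^ q) a = a + (j * P + q * n : ℤ) := by
    have : v ^ q = (F ^ q) ^ j * translation ((q * n : ℤ) : ℝ) := by
      rw [(commute_translation_int (F ^ j) n).mul_pow, translation_pow, ← zpow_natCast,
        ← zpow_natCast, zpow_comm]
      push_cast
      rfl
    rw [this, mul_apply, translation_apply, map_add_int, hfix]
    push_cast
    ring
  have huv : Commute u v :=
    ((Commute.refl F).zpow_zpow i j |>.mul_right (commute_translation_int _ _)).mul_left
      ((commute_translation_int _ _).symm.mul_right
        (commute_translation_int _ _))
  have hc : Function.Commute u.toFun v.toFun := fun x =>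
    congrArg (fun G : CircleLift => G x) huv
  have h1 : u a = (F ^ i) a + m := map_add_int _ _ _
  have h2 : v a = (F ^ j) a + n := map_add_int _ _ _
  rw [← h1, ← h2, ← hc.iterate_pos_lt_iff_map_lt' u.mono v.mono.monotone (by omega : 0 < q),
    ← coe_pow, ← coe_pow, hu, hv, add_lt_add_iff_left, Int.cast_lt]

/-! ### Linearization of diffeomorphisms of finite order -/

theorem exists_conj_translation (σ : CircleLift) {q : ℕ} (hq : 1 ≤ q) {P : ℤ}
    (hσ : σ ^ q = translation P) (a b : ℝ) :
    ∃ Φ : CircleLift, Φ * σ * Φ⁻¹ = translation ((P : ℝ) / q) ∧ Φ a = b := by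
  have hq0 : (0 : ℝ) < q := by positivity
  let f : ℝ → ℝ := fun x => (∑ i ∈ Finset.range q, ((σ ^ i) x - i * (P / q))) / q
  have hs : ContDiff ℝ (⊤ : ℕ∞) f :=
    (ContDiff.sum fun i _ => (σ ^ i).smooth.sub contDiff_const).div_const _
  have hd : ∀ x, HasDerivAt f ((∑ i ∈ Finset.range q, deriv (σ ^ i).toFun x) / q) x := fun x =>
    (HasDerivAt.fun_sum fun i _ => ((σ ^ i).differentiable x).hasDerivAt.sub_const _).div_const _
  have hpos : ∀ x, 0 < deriv f x := fun x => by
    rw [(hd x).deriv]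
    exact div_pos (Finset.sum_pos (fun i _ => (σ ^ i).deriv_pos x)
      (Finset.nonempty_range_iff.2 (by omega))) hq0
  have hlift : ∀ x, f (x + 1) = f x + 1 := fun x => by
    have h1 : ∀ i : ℕ, (σ ^ i) (x + 1) - i * ((P : ℝ) / q) =
        ((σ ^ i) x - i * ((P : ℝ) / q)) + 1 := fun i => by rw [(σ ^ i).lift]; ring
    simp only [f, h1]
    rw [Finset.sum_add_distrib, add_div]
    simp [hq0.ne']
  have hconj : ∀ x, f (σ x) = f x + P / q := fun x => by
    have h1 : ∀ i : ℕ, (σ ^ i) (σ x) = (σ ^ (i + 1)) x := fun i => by rw [pow_succ]; rfl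
    have h2 := Finset.sum_range_succ' (fun i : ℕ => (σ ^ i) x - i * ((P : ℝ) / q)) q
    rw [Finset.sum_range_succ, hσ] at h2
    simp only [f, h1]
    have h3 : ∑ i ∈ Finset.range q, ((σ ^ (i + 1)) x - i * ((P : ℝ) / q)) =
        ∑ i ∈ Finset.range q, ((σ ^ (i + 1)) x - (i + 1 : ℕ) * ((P : ℝ) / q)) + P := by
      have : ∀ i ∈ Finset.range q, ((σ ^ (i + 1)) x - i * ((P : ℝ) / q)) =
          ((σ ^ (i + 1)) x - (i + 1 : ℕ) * ((P : ℝ) / q)) + P / q := fun i _ => by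
        push_cast
        ring
      rw [Finset.sum_congr rfl this, Finset.sum_add_distrib]
      simp
      field_simp
    rw [h3, ← add_div]
    congr 1
    have h4 : (q : ℝ) * (P / q) = P := by field_simp
    simp only [translation_apply, h4, pow_zero, one_apply, Nat.cast_zero, zero_mul] at h2
    linarith
  let Ψ := ofDerivPos f hs hpos hlift
  have hΨ : Ψ * σ = translation ((P : ℝ) / q) * Ψ := ext hconj
  refine ⟨translation (b - Ψ a) * Ψ, ?_, by simp⟩
  rw [mul_inv_eq_iff_eq_mul, mul_assoc, hΨ, ← mul_assoc, ← mul_assoc, translation_mul,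
    translation_mul, add_comm]

end CircleLift

/-! ### Flat functions -/

section Flat

open Asymptotics Topology

theorem eq_zero_of_mul_pow_isBigO {c x₀ : ℝ} {k : ℕ}
    (h : (fun x => c * (x - x₀) ^ k) =O[𝓝 x₀] fun x => (x - x₀) ^ (k + 1)) : c = 0 := by
  have h1 : (fun _ : ℝ => c) =O[𝓝[≠] x₀] fun x => x - x₀ := by
    obtain ⟨C, hC⟩ := h.bound
    refine IsBigO.of_bound C ?_
    filter_upwards [hC.filter_mono nhdsWithin_le_nhds, self_mem_nhdsWithin] with x hx hne
    have hpos : 0 < ‖x - x₀‖ ^ k := pow_pos (norm_pos_iff.2 (sub_ne_zero.2 hne)) k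
    rw [norm_mul, pow_succ, norm_mul, norm_pow] at hx
    refine le_of_mul_le_mul_right ?_ hpos
    linarith
  have h2 : Tendsto (fun x : ℝ => x - x₀) (𝓝[≠] x₀) (𝓝 0) := by
    have : Tendsto (fun x : ℝ => x - x₀) (𝓝 x₀) (𝓝 (x₀ - x₀)) :=
      (continuous_id.sub continuous_const).tendsto x₀
    rw [sub_self] at this
    exact this.mono_left nhdsWithin_le_nhds
  exact tendsto_nhds_unique tendsto_const_nhds (h1.trans_tendsto h2)

theorem isBigO_pow_of_le {x₀ : ℝ} {m n : ℕ} (h : m ≤ n) :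
    (fun x : ℝ => (x - x₀) ^ n) =O[𝓝 x₀] fun x => (x - x₀) ^ m := by
  have h1 : (fun x : ℝ => (x - x₀) ^ (n - m)) =O[𝓝 x₀] fun _ => (1 : ℝ) :=
    ((continuous_id.sub continuous_const).pow _).continuousAt.tendsto.isBigO_one ℝ
  have h2 := (isBigO_refl (fun x : ℝ => (x - x₀) ^ m) (𝓝 x₀)).mul h1
  simpa [← pow_add, Nat.add_sub_cancel' h] using h2

theorem ContDiff.sub_monomial_isBigO {u : ℝ → ℝ} (hu : ContDiff ℝ (⊤ : ℕ∞) u) {x₀ : ℝ} {N : ℕ}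
    (h : ∀ k < N, iteratedDeriv k u x₀ = 0) :
    (fun x => u x - iteratedDeriv N u x₀ / N.factorial * (x - x₀) ^ N) =O[𝓝 x₀]
      fun x => (x - x₀) ^ (N + 1) := by
  have h1 := (taylor_isLittleO_univ (x₀ := x₀) (n := N + 1)
    (hu.of_le (by exact_mod_cast le_top))).isBigO
  have h2 : ∀ x, taylorWithinEval u (N + 1) univ x₀ x =
      iteratedDeriv N u x₀ / N.factorial * (x - x₀) ^ N +
        iteratedDeriv (N + 1) u x₀ / (N + 1).factorial * (x - x₀) ^ (N + 1) := by
    intro x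
    rw [taylor_within_apply, Finset.sum_range_succ, Finset.sum_range_succ,
      Finset.sum_eq_zero fun k hk => ?_]
    · simp only [iteratedDerivWithin_univ, smul_eq_mul]
      ring
    · rw [iteratedDerivWithin_univ, h k (Finset.mem_range.1 hk), smul_zero]
  have h3 := h1.add ((isBigO_refl (fun x : ℝ => (x - x₀) ^ (N + 1)) (𝓝 x₀)).const_mul_left
    (iteratedDeriv (N + 1) u x₀ / (N + 1).factorial))
  refine h3.congr_left fun x => ?_
  rw [h2]
  ring

theorem ContDiff.isBigO_pow_iff {u : ℝ → ℝ} (hu : ContDiff ℝ (⊤ : ℕ∞) u) {x₀ : ℝ} {N : ℕ} :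
    u =O[𝓝 x₀] (fun x => (x - x₀) ^ N) ↔ ∀ k < N, iteratedDeriv k u x₀ = 0 := by
  constructor
  · intro h k
    induction k using Nat.strong_induction_on with
    | _ k ih =>
      intro hk
      have h1 := hu.sub_monomial_isBigO fun j hj => ih j hj (hj.trans hk)
      have h2 := (h.trans (isBigO_pow_of_le (Nat.succ_le_of_lt hk))).sub h1
      simp only [sub_sub_cancel] at h2
      have h3 := eq_zero_of_mul_pow_isBigO h2
      rcases div_eq_zero_iff.1 h3 with h4 | h4
      · exact h4
      · exact absurd h4 (by positivity)
  · intro h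
    have h1 := hu.sub_monomial_isBigO h
    have h2 := (h1.trans (isBigO_pow_of_le N.le_succ)).add
      ((isBigO_refl (fun x : ℝ => (x - x₀) ^ N) (𝓝 x₀)).const_mul_left
        (iteratedDeriv N u x₀ / N.factorial))
    simpa using h2

theorem ContDiff.deriv_isBigO_pow {u : ℝ → ℝ} (hu : ContDiff ℝ (⊤ : ℕ∞) u) {x₀ : ℝ} {N : ℕ}
    (h : u =O[𝓝 x₀] fun x => (x - x₀) ^ (N + 1)) :
    deriv u =O[𝓝 x₀] fun x => (x - x₀) ^ N := by
  rw [(contDiff_infty_iff_deriv.1 hu).2.isBigO_pow_iff]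
  intro k hk
  rw [← iteratedDeriv_succ']
  exact hu.isBigO_pow_iff.1 h _ (by omega)

theorem isBigO_pow_comp {u φ : ℝ → ℝ} {x₀ y₀ : ℝ} {N : ℕ}
    (h : u =O[𝓝 x₀] fun x => (x - x₀) ^ N) (hφ : DifferentiableAt ℝ φ y₀) (hy : φ y₀ = x₀) :
    (fun y => u (φ y)) =O[𝓝 y₀] fun y => (y - y₀) ^ N := by
  subst hy
  exact (h.comp_tendsto hφ.continuousAt.tendsto).trans (hφ.isBigO_sub.pow N)

/-- All derivatives of `u`, including `u` itself, vanish at `x`. -/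
def FlatAt (u : ℝ → ℝ) (x : ℝ) : Prop := ∀ k, iteratedDeriv k u x = 0

theorem ContDiff.flatAt_iff {u : ℝ → ℝ} (hu : ContDiff ℝ (⊤ : ℕ∞) u) {x₀ : ℝ} :
    FlatAt u x₀ ↔ ∀ N : ℕ, u =O[𝓝 x₀] fun x => (x - x₀) ^ N := by
  simp only [hu.isBigO_pow_iff]
  exact ⟨fun h _ k _ => h k, fun h k => h (k + 1) k k.lt_succ_self⟩

theorem FlatAt.deriv {u : ℝ → ℝ} {x : ℝ} (h : FlatAt u x) : FlatAt (deriv u) x := fun k => by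
  rw [← iteratedDeriv_succ']
  exact h _

theorem FlatAt.self_eq_zero {u : ℝ → ℝ} {x : ℝ} (h : FlatAt u x) : u x = 0 := by
  simpa using h 0

theorem FlatAt.comp_add_const {u : ℝ → ℝ} {x : ℝ} (h : FlatAt u x) {c : ℝ}
    (hc : ∀ y, u (y + c) = u y) : FlatAt u (x + c) := by
  intro k
  have := congrFun (iteratedDeriv_comp_add_const k u c) x
  simp only [hc] at this
  rw [← this]
  exact h k

theorem hasDerivAt_indicator_of_flatAt {u : ℝ → ℝ} (hu : Differentiable ℝ u) {A : Set ℝ}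
    (hA : ∀ x, FlatAt u x ∨ A ∈ 𝓝 x ∨ Aᶜ ∈ 𝓝 x) (x : ℝ) :
    HasDerivAt (A.indicator u) (A.indicator (deriv u) x) x := by
  rcases hA x with h | h | h
  · have h0 : u x = 0 := h.self_eq_zero
    have h1 : deriv u x = 0 := h.deriv.self_eq_zero
    have h2 : ∀ v : ℝ → ℝ, v x = 0 → A.indicator v x = 0 := fun v hv => by
      by_cases hx : x ∈ A <;> simp [hx, hv]
    rw [h2 _ h1, hasDerivAt_iff_isLittleO]
    have h3 := hasDerivAt_iff_isLittleO.1 (hu x).hasDerivAt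
    rw [h1] at h3
    simp only [h0, h2 u h0, sub_zero, smul_zero] at h3 ⊢
    exact (IsBigO.of_bound 1 (Eventually.of_forall fun y => by
      rw [one_mul]; exact norm_indicator_le_norm_self _ _)).trans_isLittleO h3
  · rw [indicator_of_mem (mem_of_mem_nhds h)]
    refine (hu x).hasDerivAt.congr_of_eventuallyEq ?_
    filter_upwards [h] with y hy using indicator_of_mem hy u
  · rw [indicator_of_notMem (mem_of_mem_nhds h)]
    refine (hasDerivAt_const x (0 : ℝ)).congr_of_eventuallyEq ?_
    filter_upwards [h] with y hy using indicator_of_notMem hy u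

theorem contDiff_indicator_of_flatAt {u : ℝ → ℝ} (hu : ContDiff ℝ (⊤ : ℕ∞) u) {A : Set ℝ}
    (hA : ∀ x, FlatAt u x ∨ A ∈ 𝓝 x ∨ Aᶜ ∈ 𝓝 x) : ContDiff ℝ (⊤ : ℕ∞) (A.indicator u) := by
  rw [contDiff_infty]
  intro n
  induction n generalizing u with
  | zero =>
    exact contDiff_zero.2 (continuous_iff_continuousAt.2 fun x =>
      (hasDerivAt_indicator_of_flatAt (hu.differentiable (by simp)) hA x).continuousAt)
  | succ n ih =>
    have h1 := hasDerivAt_indicator_of_flatAt (hu.differentiable (by simp)) hA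
    push_cast
    rw [contDiff_succ_iff_deriv]
    refine ⟨fun x => (h1 x).differentiableAt, by simp, ?_⟩
    rw [funext fun x => (h1 x).deriv]
    exact ih (contDiff_infty_iff_deriv.1 hu).2 fun x => (hA x).imp_left FlatAt.deriv

/-! ### Infinitely tangent fixed points -/

namespace CircleLift

theorem contDiff_sub_id (F : CircleLift) (m : ℝ) :
    ContDiff ℝ (⊤ : ℕ∞) fun y => F y - y - m :=
  (F.smooth.sub contDiff_id).sub contDiff_const

theorem itiFixedPoint_iff (F : CircleLift) (x : ℝ) :
    ITIFixedPoint F x ↔ ∃ m : ℤ, FlatAt (fun y => F y - y - m) x := by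
  have h1 : ∀ m : ℤ, deriv (fun y => F y - y - m) = fun y => deriv F y - 1 := fun m => by
    funext y
    exact (((F.differentiable y).hasDerivAt.sub (hasDerivAt_id y)).sub_const _).deriv
  have h2 : ∀ (m : ℤ) (k : ℕ), iteratedDeriv (k + 2) (fun y => F y - y - m) x =
      iteratedDeriv (k + 2) F x := fun m k => by
    rw [iteratedDeriv_succ', h1, iteratedDeriv_succ', iteratedDeriv_succ', iteratedDeriv_succ',
      deriv_sub_const_fun]
  unfold ITIFixedPoint FlatAt
  constructor
  · rintro ⟨⟨m, hm⟩, hd, hk⟩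
    refine ⟨m, fun k => ?_⟩
    match k with
    | 0 => simp [hm]
    | 1 => simp only [iteratedDeriv_one, h1, hd, sub_self]
    | k + 2 => rw [h2]; exact hk _ (by omega)
  · rintro ⟨m, hm⟩
    refine ⟨⟨m, by have := hm 0; simp at this; linarith⟩, ?_, fun k hk => ?_⟩
    · have := hm 1
      simp only [iteratedDeriv_one, h1] at this
      linarith
    · obtain ⟨j, rfl⟩ := Nat.exists_eq_add_of_le' hk
      rw [← h2 m]
      exact hm _

theorem _root_.ITIFixedPoint.conj {F : CircleLift} {x : ℝ} (h : ITIFixedPoint F x)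
    (Φ : CircleLift) :
    ITIFixedPoint (Φ * F * Φ⁻¹).toFun (Φ x) := by
  rw [itiFixedPoint_iff] at h ⊢
  obtain ⟨m, hm⟩ := h
  refine ⟨m, ?_⟩
  rw [(contDiff_sub_id _ _).flatAt_iff] at hm ⊢
  intro N
  have h0 : F x = x + m := by
    have h2 := ((contDiff_sub_id F m).flatAt_iff.2 hm).self_eq_zero
    linarith
  have h1 : (fun y => Φ (F y) - Φ (y + m)) =O[𝓝 x] fun y => F y - y - m := by
    have hd : HasStrictDerivAt Φ.toFun (deriv Φ (x + m)) (x + m) :=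
      (Φ.smooth.contDiffAt).hasStrictDerivAt (by simp)
    have h3 := hd.hasStrictFDerivAt.isBigO_sub
    have h4 : Tendsto (fun y => (F y, y + (m : ℝ))) (𝓝 x) (𝓝 (x + m, x + m)) := by
      have : ContinuousAt (fun y => (F y, y + (m : ℝ))) x :=
        (F.smooth.continuous.prodMk (continuous_id.add continuous_const)).continuousAt
      simpa [ContinuousAt, h0] using this
    refine (h3.comp_tendsto h4).congr (fun y => rfl) fun y => ?_
    simp only [Function.comp]
    ring
  have h5 := isBigO_pow_comp (h1.trans (hm N)) (φ := (Φ⁻¹).toFun) (y₀ := Φ x)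
    ((Φ⁻¹).differentiable _) (inv_apply_self _ _)
  refine h5.congr_left fun y => ?_
  simp [map_add_int]
  ring

theorem _root_.ITIFixedPoint.mul {F G : CircleLift} {x : ℝ} (hF : ITIFixedPoint F x)
    (hG : ITIFixedPoint G x) : ITIFixedPoint (F * G).toFun x := by
  rw [itiFixedPoint_iff] at hF hG ⊢
  obtain ⟨m, hm⟩ := hF
  obtain ⟨n, hn⟩ := hG
  refine ⟨m + n, ?_⟩
  rw [(contDiff_sub_id _ _).flatAt_iff] at hm hn ⊢
  intro N
  have h0 : G x = x + n := by
    have h2 := ((contDiff_sub_id G n).flatAt_iff.2 hn).self_eq_zero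
    linarith
  have h1 := isBigO_pow_comp (hm N) (φ := fun y => G y - n) (y₀ := x)
    ((G.differentiable _).sub_const _) (by simp [h0])
  refine (h1.add (hn N)).congr_left fun y => ?_
  have := F.map_add_int (G y - n) n
  rw [sub_add_cancel] at this
  simp [this]
  ring

theorem itiFixedPoint_translation (m : ℤ) (x : ℝ) :
    ITIFixedPoint (translation (m : ℝ)).toFun x := by
  rw [itiFixedPoint_iff]
  refine ⟨m, fun k => ?_⟩
  have : (fun y => translation (m : ℝ) y - y - m) = fun _ => (0 : ℝ) := by
    funext y
    simp
  rw [this]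
  simp

theorem _root_.ITIFixedPoint.pow {F : CircleLift} {x : ℝ} (hF : ITIFixedPoint F x) (n : ℕ) :
    ITIFixedPoint (F ^ n).toFun x := by
  induction n with
  | zero =>
    have := itiFixedPoint_translation 0 x
    convert this using 1
    funext y
    simp
  | succ n ih => rw [pow_succ]; exact ih.mul hF

end CircleLift

end Flat

namespace CircleLift

open Topology in
/-- A diffeomorphism that is infinitely tangent to the identity at `a` and `b` can be replaced
by the identity outside the arc `[a, b]`. -/
theorem exists_cutoff (g : CircleLift) {a b : ℝ}
    (hga : FlatAt (fun y => g y - y) a) (hgb : FlatAt (fun y => g y - y) b) :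
    ∃ γ : CircleLift, (∀ x : ℝ, (∃ n : ℤ, x + n ∈ Icc a b) → γ x = g x) ∧
      ∀ x : ℝ, (¬ ∃ n : ℤ, x + n ∈ Icc a b) → γ x = x := by
  let A : Set ℝ := {x | ∃ n : ℤ, x + n ∈ Icc a b}
  let u : ℝ → ℝ := fun y => g y - y
  have hu : ContDiff ℝ (⊤ : ℕ∞) u := by simpa [u] using contDiff_sub_id g 0
  have hper : ∀ (n : ℤ) y, u (y + n) = u y := fun n y => by
    simp only [u, map_add_int]
    ring
  have hA1 : ∀ x, x + 1 ∈ A ↔ x ∈ A := fun x => by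
    constructor
    · rintro ⟨n, hn⟩
      exact ⟨n + 1, by push_cast; rwa [add_comm (n : ℝ), ← add_assoc]⟩
    · rintro ⟨n, hn⟩
      exact ⟨n - 1, by push_cast; rwa [add_assoc, add_sub_cancel]⟩
  have hA : ∀ x, FlatAt u x ∨ A ∈ 𝓝 x ∨ Aᶜ ∈ 𝓝 x := fun x => by
    set n := ⌊x - a⌋ with hn
    have h1 : (n : ℝ) ≤ x - a := Int.floor_le _
    have h2 : x - a < n + 1 := Int.lt_floor_add_one _
    rcases h1.eq_or_lt with h | h
    · left
      have := hga.comp_add_const (hper n)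
      rwa [h, add_sub_cancel] at this
    rcases lt_trichotomy (x - n) b with h3 | h3 | h3
    · right; left
      filter_upwards [Ioo_mem_nhds (show a + n < x by linarith) (show x < b + n by linarith)]
        with y hy
      exact ⟨-n, by push_cast; constructor <;> linarith [hy.1, hy.2]⟩
    · left
      have := hgb.comp_add_const (hper n)
      rwa [← h3, sub_add_cancel] at this
    · right; right
      filter_upwards [Ioo_mem_nhds (show b + n < x by linarith) (show x < a + (n + 1) by linarith)]
        with y hy
      rintro ⟨m, hm⟩
      have h4 : ((-m : ℤ) : ℝ) < ((n + 1 : ℤ) : ℝ) := by push_cast; linarith [hm.1, hy.2]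
      have h5 : (n : ℝ) < ((-m : ℤ) : ℝ) := by push_cast; linarith [hm.2, hy.1]
      norm_cast at h4 h5
      omega
  have hd : ∀ x, HasDerivAt (fun x => x + A.indicator u x) (1 + A.indicator (deriv u) x) x :=
    fun x => (hasDerivAt_id x).add
      (hasDerivAt_indicator_of_flatAt (hu.differentiable (by simp)) hA x)
  have hdu : ∀ x, deriv u x = deriv g x - 1 := fun x =>
    ((g.differentiable x).hasDerivAt.sub (hasDerivAt_id x)).deriv
  refine ⟨ofDerivPos (fun x => x + A.indicator u x)
    (contDiff_id.add (contDiff_indicator_of_flatAt hu hA)) (fun x => ?_) (fun x => ?_),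
    fun x hx => ?_, fun x hx => ?_⟩
  · rw [(hd x).deriv]
    by_cases hx : x ∈ A
    · rw [indicator_of_mem hx, hdu]
      linarith [g.deriv_pos x]
    · rw [indicator_of_notMem hx]
      norm_num
  · by_cases hx : x ∈ A
    · rw [indicator_of_mem hx, indicator_of_mem ((hA1 x).2 hx)]
      have := hper 1 x
      rw [Int.cast_one] at this
      rw [this]
      ring
    · rw [indicator_of_notMem hx, indicator_of_notMem (mt (hA1 x).1 hx)]
      ring
  · rw [ofDerivPos_apply, indicator_of_mem (show x ∈ A from hx)]
    simp [u]
  · rw [ofDerivPos_apply, indicator_of_notMem (show x ∉ A from hx), add_zero]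

theorem eLogVar_le_of_eqOn {γ g : CircleLift} {a b : ℝ} (hab : a < b) (hb : b ≤ a + 1)
    (h1 : EqOn γ g (Icc a b)) (h2 : EqOn γ id (Icc b (a + 1))) : γ.eLogVar ≤ g.eLogVar := by
  have hD : EqOn (deriv γ) (deriv g) (Icc a b) := by
    have : EqOn (deriv γ) (deriv g) (Ioo a b) := fun x hx =>
      Filter.EventuallyEq.deriv_eq (by
        filter_upwards [Ioo_mem_nhds hx.1 hx.2] with y hy using h1 (Ioo_subset_Icc_self hy))
    rw [← closure_Ioo hab.ne]
    exact this.closure γ.contDiff_deriv.continuous g.contDiff_deriv.continuous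
  rw [← γ.eVariationOn_log_deriv a, ← g.eVariationOn_log_deriv a]
  have hadd := eVariationOn.Icc_add_Icc (fun x => Real.log (deriv γ x)) (s := univ) hab.le hb
    (mem_univ _)
  simp only [univ_inter] at hadd
  have h0 : eVariationOn (fun x => Real.log (deriv γ x)) (Icc b (a + 1)) = 0 := by
    rcases hb.eq_or_lt with rfl | hb'
    · exact eVariationOn.subsingleton _ (by simp)
    · have hD2 : EqOn (deriv γ) (fun _ => 1) (Icc b (a + 1)) := by
        have : EqOn (deriv γ) (fun _ => 1) (Ioo b (a + 1)) := fun x hx => by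
          have h3 : γ.toFun =ᶠ[nhds x] id := by
            filter_upwards [Ioo_mem_nhds hx.1 hx.2] with y hy using h2 (Ioo_subset_Icc_self hy)
          rw [h3.deriv_eq]
          simp
        rw [← closure_Ioo hb'.ne]
        exact this.closure γ.contDiff_deriv.continuous continuous_const
      refine eVariationOn.constant_on ?_
      rintro _ ⟨x, hx, rfl⟩ _ ⟨y, hy, rfl⟩
      simp only [hD2 hx, hD2 hy]
  rw [← hadd, h0, add_zero]
  calc _ = eVariationOn (fun x => Real.log (deriv g x)) (Icc a b) :=
        eVariationOn.eq_of_eqOn fun x hx => by simp only [hD hx]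
    _ ≤ _ := eVariationOn.mono _ (Icc_subset_Icc_right hb)

theorem exists_bezout {q : ℕ} (hq : 1 ≤ q) {P : ℤ} (hcop : IsCoprime P (q : ℤ)) :
    ∃ (k : ℕ) (l : ℤ), k < q ∧ k * P + q * l = 1 := by
  obtain ⟨u, v, huv⟩ := hcop
  have h1 : 0 ≤ u % q := Int.emod_nonneg _ (by omega)
  have h2 : u % q < q := Int.emod_lt_of_pos _ (by omega)
  refine ⟨(u % q).toNat, v + u / q * P, by omega, ?_⟩
  rw [Int.toNat_of_nonneg h1]
  have h3 := Int.emod_add_mul_ediv u q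
  linear_combination huv - P * (-1 * h3)

theorem _root_.ITIFixedPoint.flatAt {G : CircleLift} {x : ℝ} {P : ℤ} (h : ITIFixedPoint G x)
    (hx : G x = x + P) : FlatAt (fun y => G y - y - P) x := by
  obtain ⟨m, hm⟩ := (itiFixedPoint_iff G x).1 h
  have h1 : (m : ℝ) = P := by linarith [hm.self_eq_zero]
  rwa [h1] at hm

theorem exists_factorization_of_iti (F : CircleLift) {q : ℕ} (hq : 1 ≤ q) {P : ℤ}
    (hcop : IsCoprime P (q : ℤ)) (hvar : AsympVarVanishesC F) {a : ℝ}
    (ha : FlatAt (fun y => (F ^ q) y - y - P) a) :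
    ∃ γ σ : CircleLift, ∃ b : ℝ, F = γ * σ ∧ σ ^ q = translation P ∧ AsympVarVanishesC γ ∧
      (∃ (k : ℕ) (l : ℤ), k * P + q * l = 1 ∧ (σ ^ k) a + l = b) ∧
      ∀ x : ℝ, (¬ ∃ n : ℤ, x + n ∈ Icc a b) → γ x = x := by
  have haP : (F ^ q) a = a + P := by linarith [ha.self_eq_zero]
  obtain ⟨k, l, hkq, hkl⟩ := exists_bezout hq hcop
  have hord := fun i m j n => F.orbit_lt_orbit_iff hq haP i m j n
  set b := (F ^ k) a + l with hb
  have hb' : b = (F ^ (k : ℤ)) a + l := by rw [zpow_natCast]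
  have ha' : a = (F ^ (0 : ℤ)) a + (0 : ℤ) := by simp
  have hab : a < b := by
    rw [hb']
    conv_lhs => rw [ha']
    rw [hord]
    omega
  have hba : b ≤ a + 1 := by
    rw [← not_lt, hb', show a + 1 = (F ^ (0 : ℤ)) a + (1 : ℤ) by simp, hord]
    omega
  have hcomm : ∀ (i j : ℕ) x, (F ^ i) ((F ^ j) x) = (F ^ j) ((F ^ i) x) := fun i j x => by
    rw [← mul_apply, ← mul_apply, ← pow_add, ← pow_add, add_comm]
  have hbP : (F ^ q) b = b + P := by
    rw [hb, map_add_int, hcomm, haP, map_add_int]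
    ring
  have hbflat : FlatAt (fun y => (F ^ q) y - y - P) b := by
    refine ITIFixedPoint.flatAt ?_ hbP
    have h1 := ((itiFixedPoint_iff _ _).2 ⟨P, ha⟩).conj (translation (l : ℝ) * F ^ k)
    have h2 : (translation (l : ℝ) * F ^ k) * F ^ q * (translation (l : ℝ) * F ^ k)⁻¹ = F ^ q := by
      rw [mul_inv_eq_iff_eq_mul]
      exact (((commute_translation_int (F ^ q) l)).mul_right
        ((Commute.refl F).pow_pow q k)).symm
    rwa [h2] at h1
  set g := F ^ q * translation ((-P : ℤ) : ℝ) with hg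
  have hgx : ∀ x, g x = (F ^ q) x - P := fun x => by
    rw [hg, mul_apply, translation_apply, map_add_int]
    push_cast
    ring
  have hgu : (fun y => g y - y) = fun y => (F ^ q) y - y - P := by
    funext y
    rw [hgx]
    ring
  obtain ⟨γ, hγ1, hγ2⟩ := exists_cutoff g (a := a) (b := b) (by rwa [hgu]) (by rwa [hgu])
  have hga : g a = a := by rw [hgx, haP]; ring
  have hgb : g b = b := by rw [hgx, hbP]; ring
  have hγa : γ a = a := by rw [hγ1 a ⟨0, by simp [hab.le]⟩, hga]
  have hγb : γ b = b := by rw [hγ1 b ⟨0, by simp [hab.le]⟩, hgb]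
  have hmaps : ∀ y ∈ Icc a b, g y ∈ Icc a b := fun y hy =>
    ⟨hga ▸ g.mono.monotone hy.1, (g.mono.monotone hy.2).trans_eq hgb⟩
  have hγJ : EqOn γ g (Icc a b) := fun y hy => hγ1 y ⟨0, by simpa using hy⟩
  have hγJ' : EqOn γ id (Icc b (a + 1)) := fun y hy => by
    by_cases h : ∃ n : ℤ, y + n ∈ Icc a b
    · obtain ⟨n, hn⟩ := h
      rcases hy.1.eq_or_lt with rfl | h1
      · exact hγb
      rcases hy.2.eq_or_lt with h2 | h2
      · have := γ.lift a
        rw [hγa] at this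
        rw [h2]
        exact this
      · have h3 : ((-1 : ℤ) : ℝ) < n := by push_cast; linarith [hn.1]
        have h4 : (n : ℝ) < ((0 : ℤ) : ℝ) := by push_cast; linarith [hn.2]
        norm_cast at h3 h4
        omega
    · exact hγ2 y h
  have hpow : ∀ n : ℕ, EqOn (γ ^ n).toFun (g ^ n).toFun (Icc a b) ∧
      EqOn (γ ^ n).toFun id (Icc b (a + 1)) := fun n => by
    induction n with
    | zero => exact ⟨fun _ _ => rfl, fun _ _ => rfl⟩
    | succ n ih =>
      simp only [pow_succ]
      exact ⟨fun y hy => by rw [mul_apply, mul_apply, hγJ hy, ih.1 (hmaps y hy)],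
        fun y hy => by rw [mul_apply, hγJ' hy]; exact ih.2 hy⟩
  have hγvar : AsympVarVanishesC γ := by
    have h1 : AsympVarVanishesC g := (hvar.pow hq).mul_translation (-P)
    refine h1.of_le (C := 0) (by simp) fun n => ?_
    rw [add_zero]
    exact eLogVar_le_of_eqOn hab hba (hpow n).1 (hpow n).2
  have hfix : ∀ (i : ℕ), 0 < i → i < q → ∀ y ∈ Icc a b, γ ((F ^ i) y) = (F ^ i) y := by
    intro i hi0 hiq y hy
    by_cases h : ∃ n : ℤ, (F ^ i) y + n ∈ Icc a b
    · obtain ⟨n, hn⟩ := h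
      have h0 : γ ((F ^ i) y + n) = (F ^ i) y + n := by
        rcases hn.1.eq_or_lt with h1 | h1
        · rw [← h1, hγa]
        rcases hn.2.eq_or_lt with h2 | h2
        · rw [h2, hγb]
        exfalso
        have h3 : (F ^ (i : ℤ)) a + n < (F ^ (k : ℤ)) a + l := by
          rw [← hb', zpow_natCast]
          exact lt_of_le_of_lt (by gcongr; exact (F ^ i).mono.monotone hy.1) h2
        have h4 : (F ^ (0 : ℤ)) a + (0 : ℤ) < (F ^ ((i + k : ℕ) : ℤ)) a + ((l + n : ℤ) : ℝ) := by
          rw [← ha', zpow_natCast, pow_add, mul_apply]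
          have := (F ^ i).mono.monotone hy.2
          rw [hb, map_add_int] at this
          push_cast
          linarith
        rw [hord] at h3 h4
        push_cast at h3 h4
        have h5 : (i : ℤ) * P + q * n = 0 := by nlinarith
        have h6 : (q : ℤ) ∣ i * P := ⟨-n, by linarith⟩
        have h7 : (q : ℤ) ∣ i := hcop.symm.dvd_of_dvd_mul_right h6
        have h8 := Nat.le_of_dvd hi0 (Int.natCast_dvd_natCast.1 h7)
        omega
      rw [map_add_int] at h0
      linarith
    · exact hγ2 _ h
  have hfix' : ∀ (i : ℕ), 0 < i → i < q → ∀ y ∈ Icc a b, γ⁻¹ ((F ^ i) y) = (F ^ i) y :=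
    fun i h1 h2 y hy => by
      conv_lhs => rw [← hfix i h1 h2 y hy]
      exact inv_apply_self _ _
  set σ := γ⁻¹ * F with hσ
  have hσF : ∀ (i : ℕ), i < q → ∀ y ∈ Icc a b, (σ ^ i) y = (F ^ i) y := by
    intro i hi y hy
    induction i with
    | zero => rfl
    | succ i ih =>
      have h1 := hfix' (i + 1) (by omega) hi y hy
      rw [pow_succ', mul_apply, ih (by omega), hσ, mul_apply, ← mul_apply F, ← pow_succ', h1]
  have hσq : ∀ y ∈ Icc a b, (σ ^ q) y = y + P := by
    intro y hy
    obtain ⟨r, rfl⟩ : ∃ r, q = r + 1 := ⟨q - 1, by omega⟩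
    rw [pow_succ', mul_apply, hσF r (by omega) y hy, hσ, mul_apply, ← mul_apply F, ← pow_succ']
    have h1 : (F ^ (r + 1)) y = γ (y + P) := by
      rw [map_add_int, hγJ hy, hgx]
      ring
    rw [h1, inv_apply_self]
  have hFJ : ∀ (s : ℕ), ∀ y ∈ Icc a b, ∃ z ∈ Icc a b, ∃ n : ℤ, ((F ^ q) ^ s) y = z + n := by
    intro s y hy
    induction s with
    | zero => exact ⟨y, hy, 0, by simp⟩
    | succ s ih =>
      obtain ⟨z, hz, n, hzn⟩ := ih
      refine ⟨g z, hmaps z hz, P + n, ?_⟩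
      rw [pow_succ', mul_apply, hzn, map_add_int, hgx]
      push_cast
      ring
  set S := F ^ k * translation (l : ℝ) with hS
  have hSa : S a = b := by rw [hS, mul_apply, translation_apply, map_add_int]
  have hSpow : ∀ (j : ℕ) y, (S ^ j) y = (F ^ (k * j)) y + ((j * l : ℤ) : ℝ) := fun j y => by
    rw [hS, (commute_translation_int (F ^ k) l).mul_pow, translation_pow, mul_apply,
      translation_apply, ← pow_mul, ← map_add_int]
    push_cast
    rfl
  have hSq : (S ^ q) a = a + 1 := by
    have h1 : ∀ j : ℕ, ((F ^ q) ^ j) a = a + ((j * P : ℤ) : ℝ) := fun j => by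
      induction j with
      | zero => simp
      | succ j ih =>
        rw [pow_succ', mul_apply, ih, map_add_int, haP]
        push_cast
        ring
    have h2 : (k : ℝ) * P + q * l = 1 := by exact_mod_cast hkl
    rw [hSpow, mul_comm k q, pow_mul, h1]
    push_cast
    linarith
  have hcover : ∀ (j : ℕ) x, a ≤ x → x < (S ^ j) a → ∃ i, ∃ y ∈ Icc a b, x = (S ^ i) y := by
    intro j x hx
    induction j with
    | zero =>
      intro h
      exact absurd hx (not_le.2 h)
    | succ j ih =>
      intro h
      rcases lt_or_ge x ((S ^ j) a) with h1 | h1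
      · exact ih h1
      · refine ⟨j, ((S ^ j)⁻¹) x, ⟨?_, ?_⟩, by simp⟩
        · have := ((S ^ j)⁻¹).mono.monotone h1
          rwa [inv_apply_self] at this
        · have := ((S ^ j)⁻¹).mono.monotone h.le
          rwa [pow_succ, mul_apply, inv_apply_self, hSa] at this
  have hσP : σ ^ q = translation P := by
    refine ext fun x => ?_
    have h1 : a ≤ x + ((-⌊x - a⌋ : ℤ) : ℝ) := by
      push_cast
      linarith [Int.floor_le (x - a)]
    have h2 : x + ((-⌊x - a⌋ : ℤ) : ℝ) < (S ^ q) a := by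
      rw [hSq]
      push_cast
      linarith [Int.lt_floor_add_one (x - a)]
    obtain ⟨i, y, hy, hxy⟩ := hcover q _ h1 h2
    obtain ⟨z, hz, n, hzn⟩ := hFJ (k * i / q) y hy
    have h3 : (S ^ i) y = (σ ^ (k * i % q)) z + ((n + i * l : ℤ) : ℝ) := by
      have h4 : (F ^ (k * i)) y = (F ^ (k * i % q)) (((F ^ q) ^ (k * i / q)) y) := by
        rw [← mul_apply, ← pow_mul, ← pow_add, Nat.mod_add_div]
      rw [hSpow, h4, hzn, map_add_int, hσF _ (Nat.mod_lt _ (by omega)) z hz]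
      push_cast
      ring
    have h5 : x = (σ ^ (k * i % q)) z + ((n + i * l + ⌊x - a⌋ : ℤ) : ℝ) := by
      rw [h3] at hxy
      push_cast at hxy ⊢
      linarith
    rw [h5, map_add_int, ← mul_apply, ← pow_add, add_comm q, pow_add, mul_apply, hσq z hz,
      map_add_int, translation_apply]
    ring
  refine ⟨γ, σ, b, by rw [hσ, mul_inv_cancel_left], hσP, hγvar, ⟨k, l, hkl, ?_⟩, hγ2⟩
  rw [hσF k hkq a ⟨le_rfl, hab.le⟩]

theorem exists_normal_form_of_iti (F : CircleLift) {p m : ℤ} {q : ℕ} (hq : 1 ≤ q)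
    (hcop : IsCoprime (p + q * m) (q : ℤ)) (hvar : AsympVarVanishesC F) {a : ℝ}
    (ha : FlatAt (fun y => (F ^ q) y - y - (p + q * m : ℤ)) a) :
    ∃ Φ H : CircleLift, Φ * F * Φ⁻¹ = H * translation ((p : ℝ) / q) ∧
      (∀ x : ℝ, (∀ k : ℤ, x + k ∉ Icc (-((p : ℝ) / q)) (-((p : ℝ) / q) + 1 / q)) →
          H x = x + m) ∧ AsympVarVanishesC H := by
  obtain ⟨γ, σ, b, hF, hσ, hγ, ⟨k, l, hkl, hb⟩, hid⟩ :=
    exists_factorization_of_iti F hq hcop hvar ha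
  obtain ⟨Φ, hΦ, hΦa⟩ := exists_conj_translation σ hq hσ a (-((p : ℝ) / q))
  have hq0 : (q : ℝ) ≠ 0 := by positivity
  have hPq : ((p + q * m : ℤ) : ℝ) / q = m + p / q := by
    push_cast
    field_simp
    ring
  have hΦb : Φ b = -((p : ℝ) / q) + 1 / q := by
    have h1 : (Φ * σ * Φ⁻¹) ^ k = Φ * σ ^ k * Φ⁻¹ := conj_pow
    have h2 := congrArg (fun G : CircleLift => G (Φ a)) h1
    simp only [hΦ, translation_pow] at h2
    rw [mul_apply, mul_apply, inv_apply_self, translation_apply, hΦa] at h2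
    have h3 : (k : ℝ) * (p + q * m : ℤ) + q * l = 1 := by exact_mod_cast hkl
    rw [← hb, map_add_int, ← h2, ← h3]
    field_simp
    ring
  refine ⟨Φ, Φ * γ * Φ⁻¹ * translation m, ?_, fun x hx => ?_, (hγ.conj Φ).mul_translation m⟩
  · rw [mul_assoc (Φ * γ * Φ⁻¹), translation_mul, ← hPq, ← hΦ, hF]
    group
  · rw [mul_apply, translation_apply, map_add_int, mul_apply, mul_apply, hid, apply_inv_self]
    rintro ⟨n, hn⟩
    refine hx n ?_
    have h1 := Φ.mono.monotone hn.1
    have h2 := Φ.mono.monotone hn.2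
    rw [map_add_int, apply_inv_self] at h1 h2
    rw [hΦa] at h1
    rw [hΦb] at h2
    exact ⟨h1, h2⟩

end CircleLift

/-! ### Formal vector fields -/

section Formal

open Asymptotics Topology

theorem isBigO_pow_of_le_zero {m n : ℕ} (h : m ≤ n) :
    (fun x : ℝ => x ^ n) =O[𝓝 0] fun x => x ^ m := by
  simpa using isBigO_pow_of_le (x₀ := 0) h

theorem Asymptotics.IsBigO.mul_pow_zero {u v : ℝ → ℝ} {m n l : ℕ}
    (hu : u =O[𝓝 0] fun x : ℝ => x ^ m) (hv : v =O[𝓝 0] fun x : ℝ => x ^ n) (h : l ≤ m + n) :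
    (fun x => u x * v x) =O[𝓝 0] fun x : ℝ => x ^ l := by
  have h1 := hu.mul hv
  simp only [← pow_add] at h1
  exact h1.trans (isBigO_pow_of_le_zero h)

/-- The vector field `x ^ m` is almost invariant under `g = id + ψ`. -/
theorem monomial_transport_isBigO {ψ : ℝ → ℝ} (hψ : ContDiff ℝ (⊤ : ℕ∞) ψ) {c : ℝ} {k m : ℕ}
    (hk : 1 ≤ k) (hm : 1 ≤ m)
    (hc : (fun x => ψ x - c * x ^ (k + 1)) =O[𝓝 0] fun x : ℝ => x ^ (k + 2)) :
    (fun x => (x + ψ x) ^ m - (1 + deriv ψ x) * x ^ m - c * (m - k - 1) * x ^ (m + k)) =O[𝓝 0]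
      fun x : ℝ => x ^ (m + k + 1) := by
  have hψ0 : ψ =O[𝓝 0] fun x : ℝ => x ^ (k + 1) := by
    have h1 := (hc.trans (isBigO_pow_of_le_zero (k + 1).le_succ)).add
      ((isBigO_refl (fun x : ℝ => x ^ (k + 1)) (𝓝 0)).const_mul_left c)
    simpa using h1
  have hid : (fun x : ℝ => x + ψ x) =O[𝓝 0] fun x : ℝ => x ^ 1 := by
    have h1 : (fun x : ℝ => x) =O[𝓝 0] fun x : ℝ => x ^ 1 := by simpa using isBigO_refl _ _
    exact h1.add (hψ0.trans (isBigO_pow_of_le_zero (by omega)))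
  have hpow : (fun x => (x + ψ x) ^ m - x ^ m - m * x ^ (m - 1) * ψ x) =O[𝓝 0]
      fun x : ℝ => x ^ (m + k + 1) := by
    induction m, hm using Nat.le_induction with
    | base => simpa using isBigO_zero _ _
    | succ m hm ih =>
      obtain ⟨j, rfl⟩ : ∃ j, m = j + 1 := ⟨m - 1, by omega⟩
      have h1 := hid.mul_pow_zero ih (l := j + 1 + 1 + k + 1) (by omega)
      have h2 := (hψ0.mul_pow_zero hψ0 (l := 2 * k + 2) (by omega)).mul_pow_zero
        ((isBigO_refl (fun x : ℝ => x ^ j) (𝓝 0)).const_mul_left ((j + 1 : ℕ) : ℝ))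
        (l := j + 1 + 1 + k + 1) (by omega)
      refine (h1.add h2).congr_left fun x => ?_
      simp only [Nat.add_sub_cancel]
      push_cast
      ring
  have hd : (fun x => deriv ψ x - c * (k + 1) * x ^ k) =O[𝓝 0] fun x : ℝ => x ^ (k + 1) := by
    have hs : ContDiff ℝ (⊤ : ℕ∞) fun x => ψ x - c * x ^ (k + 1) :=
      hψ.sub (contDiff_const.mul (contDiff_id.pow _))
    have h1 := hs.deriv_isBigO_pow (x₀ := 0) (N := k + 1) (by simpa using hc)
    simp only [sub_zero] at h1
    refine h1.congr_left fun x => ?_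
    have := ((hψ.differentiable (by simp) x).hasDerivAt.sub
      ((hasDerivAt_pow (k + 1) x).const_mul c)).deriv
    refine this.trans ?_
    push_cast
    ring
  have h1 := hc.mul_pow_zero ((isBigO_refl (fun x : ℝ => x ^ (m - 1)) (𝓝 0)).const_mul_left (m : ℝ))
    (l := m + k + 1) (by omega)
  have h2 := hd.mul_pow_zero (isBigO_refl (fun x : ℝ => x ^ m) (𝓝 0)) (l := m + k + 1) (by omega)
  refine ((hpow.add h1).sub h2).congr_left fun x => ?_
  obtain ⟨j, rfl⟩ : ∃ j, m = j + 1 := ⟨m - 1, by omega⟩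
  simp only [Nat.add_sub_cancel]
  push_cast
  ring

/-- A diffeomorphism `g` tangent, but not infinitely tangent, to the identity at `0` preserves
a vector field up to any finite order. -/
theorem exists_formal_vectorField {g : ℝ → ℝ} (hg : ContDiff ℝ (⊤ : ℕ∞) g) {c : ℝ} (hc0 : c ≠ 0)
    {k : ℕ} (hk : 1 ≤ k)
    (hc : (fun x => g x - x - c * x ^ (k + 1)) =O[𝓝 0] fun x : ℝ => x ^ (k + 2)) (N : ℕ) :
    ∃ P : ℝ → ℝ, ContDiff ℝ (⊤ : ℕ∞) P ∧
      ((fun x => P x - c * x ^ (k + 1)) =O[𝓝 0] fun x : ℝ => x ^ (k + 2)) ∧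
      ((fun x => P (g x) - deriv g x * P x) =O[𝓝 0] fun x : ℝ => x ^ N) := by
  have hψ : ContDiff ℝ (⊤ : ℕ∞) fun x => g x - x := hg.sub contDiff_id
  have hdg : ∀ x, deriv g x = 1 + deriv (fun x => g x - x) x := fun x => by
    have := ((hg.differentiable (by simp) x).hasDerivAt.sub (hasDerivAt_id x)).deriv
    have h2 : deriv (fun x => g x - x) x = deriv g x - 1 := this
    rw [h2]
    ring
  have hmon : ∀ m : ℕ, 1 ≤ m → (fun x => g x ^ m - deriv g x * x ^ m -
      c * (m - k - 1) * x ^ (m + k)) =O[𝓝 0] fun x : ℝ => x ^ (m + k + 1) := fun m hm => by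
    refine (monomial_transport_isBigO hψ hk hm hc).congr_left fun x => ?_
    rw [hdg, add_sub_cancel]
  suffices h : ∀ j : ℕ, ∃ P : ℝ → ℝ, ContDiff ℝ (⊤ : ℕ∞) P ∧
      ((fun x => P x - c * x ^ (k + 1)) =O[𝓝 0] fun x : ℝ => x ^ (k + 2)) ∧
      ((fun x => P (g x) - deriv g x * P x) =O[𝓝 0] fun x : ℝ => x ^ (2 * k + 2 + j)) by
    obtain ⟨P, h1, h2, h3⟩ := h N
    exact ⟨P, h1, h2, h3.trans (isBigO_pow_of_le_zero (by omega))⟩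
  intro j
  induction j with
  | zero =>
    refine ⟨fun x => c * x ^ (k + 1), contDiff_const.mul (contDiff_id.pow _), ?_, ?_⟩
    · simpa using isBigO_zero _ _
    · refine (((hmon (k + 1) (by omega)).const_mul_left c).congr_left fun x => ?_).trans
        (isBigO_pow_of_le_zero (by omega))
      push_cast
      ring
  | succ j ih =>
    obtain ⟨P, hP, hPc, hPN⟩ := ih
    set m := k + 2 + j with hm
    set E : ℝ → ℝ := fun x => P (g x) - deriv g x * P x with hE
    have hEs : ContDiff ℝ (⊤ : ℕ∞) E :=
      (hP.comp hg).sub ((contDiff_infty_iff_deriv.1 hg).2.mul hP)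
    obtain ⟨e, he⟩ : ∃ e : ℝ, (fun x => E x - e * x ^ (2 * k + 2 + j)) =O[𝓝 0]
        fun x : ℝ => x ^ (2 * k + 2 + j + 1) := by
      have h1 := hEs.sub_monomial_isBigO (x₀ := 0) (N := 2 * k + 2 + j)
        (hEs.isBigO_pow_iff.1 (by simpa using hPN))
      exact ⟨_, by simpa using h1⟩
    have hne : c * ((m : ℝ) - k - 1) ≠ 0 := by
      refine mul_ne_zero hc0 (ne_of_gt ?_)
      rw [hm]
      push_cast
      have : (0 : ℝ) ≤ j := j.cast_nonneg
      linarith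
    refine ⟨fun x => P x - e / (c * (m - k - 1)) * x ^ m,
      hP.sub (contDiff_const.mul (contDiff_id.pow _)), ?_, ?_⟩
    · have h1 := ((isBigO_refl (fun x : ℝ => x ^ m) (𝓝 0)).const_mul_left
        (e / (c * (m - k - 1)))).trans (isBigO_pow_of_le_zero (show k + 2 ≤ m by omega))
      refine (hPc.sub h1).congr_left fun x => ?_
      ring
    · have h1 := ((hmon m (by omega)).const_mul_left (e / (c * (m - k - 1)))).trans
        (isBigO_pow_of_le_zero (show 2 * k + 2 + (j + 1) ≤ m + k + 1 by omega))
      refine ((he.trans (isBigO_pow_of_le_zero (by omega))).sub h1).congr_left fun x => ?_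
      have h2 : e / (c * ((m : ℝ) - k - 1)) * (c * (m - k - 1)) = e := div_mul_cancel₀ _ hne
      have h3 : x ^ (m + k) = x ^ (2 * k + 2 + j) := by congr 1; omega
      simp only [hE]
      rw [h3]
      linear_combination x ^ (2 * k + 2 + j) * h2

end Formal

/-! ### Symbol classes -/

section Symbols

open Asymptotics Topology

/-- Functions on `D` whose derivatives up to order `m` satisfy the bounds
`u ^ (j) = O(|x| ^ (N - j))`. -/
def SymbolOn (D : Set ℝ) : ℕ → ℤ → (ℝ → ℝ) → Prop
  | 0, N, u => ∃ C, ∀ x ∈ D, |u x| ≤ C * |x| ^ N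
  | m + 1, N, u => (∃ C, ∀ x ∈ D, |u x| ≤ C * |x| ^ N) ∧ DifferentiableOn ℝ u D ∧
      SymbolOn D m (N - 1) (deriv u)

/-- The domains on which symbols are considered. -/
structure SymbolDomain (D : Set ℝ) : Prop where
  isOpen : IsOpen D
  ne_zero : ∀ x ∈ D, x ≠ 0
  abs_le_one : ∀ x ∈ D, |x| ≤ 1

theorem SymbolDomain.neg {D : Set ℝ} (hD : SymbolDomain D) : SymbolDomain (-D) :=
  ⟨hD.isOpen.neg, fun x hx => neg_ne_zero.1 (hD.ne_zero _ hx), fun x hx => by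
    simpa using hD.abs_le_one _ hx⟩

namespace SymbolOn

variable {D D' : Set ℝ} {m : ℕ} {N M : ℤ} {u v : ℝ → ℝ}

theorem bound (h : SymbolOn D m N u) : ∃ C, 0 ≤ C ∧ ∀ x ∈ D, |u x| ≤ C * |x| ^ N := by
  have h1 : ∃ C, ∀ x ∈ D, |u x| ≤ C * |x| ^ N := by
    cases m with
    | zero => exact h
    | succ m => exact h.1
  obtain ⟨C, hC⟩ := h1
  refine ⟨|C|, abs_nonneg _, fun x hx => (hC x hx).trans ?_⟩
  gcongr
  exact le_abs_self C

theorem differentiableAt (hD : SymbolDomain D) (h : SymbolOn D (m + 1) N u) {x : ℝ} (hx : x ∈ D) :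
    DifferentiableAt ℝ u x :=
  h.2.1.differentiableAt (hD.isOpen.mem_nhds hx)

theorem mono_set (h : SymbolOn D m N u) (hD : D' ⊆ D) : SymbolOn D' m N u := by
  induction m generalizing N u with
  | zero =>
    obtain ⟨C, hC⟩ := h
    exact ⟨C, fun x hx => hC x (hD hx)⟩
  | succ m ih =>
    obtain ⟨⟨C, hC⟩, h1, h2⟩ := h
    exact ⟨⟨C, fun x hx => hC x (hD hx)⟩, h1.mono hD, ih h2⟩

theorem of_succ (h : SymbolOn D (m + 1) N u) : SymbolOn D m N u := by
  induction m generalizing N u with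
  | zero => exact h.1
  | succ m ih => exact ⟨h.1, h.2.1, ih h.2.2⟩

theorem mono_order (h : SymbolOn D m N u) {n : ℕ} (hn : n ≤ m) : SymbolOn D n N u := by
  induction m, hn using Nat.le_induction with
  | base => exact h
  | succ m _ ih => exact ih h.of_succ

theorem congr (hD : SymbolDomain D) (h : SymbolOn D m N u) (huv : EqOn v u D) :
    SymbolOn D m N v := by
  induction m generalizing N u v with
  | zero =>
    obtain ⟨C, hC⟩ := h
    exact ⟨C, fun x hx => huv hx ▸ hC x hx⟩
  | succ m ih =>
    obtain ⟨⟨C, hC⟩, h1, h2⟩ := h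
    exact ⟨⟨C, fun x hx => huv hx ▸ hC x hx⟩, h1.congr huv,
      ih h2 (huv.deriv hD.isOpen)⟩

theorem mono_weight (hD : SymbolDomain D) (h : SymbolOn D m N u) (hM : M ≤ N) :
    SymbolOn D m M u := by
  have h0 : ∃ C, ∀ x ∈ D, |u x| ≤ C * |x| ^ M := by
    obtain ⟨C, hC0, hC⟩ := h.bound
    refine ⟨C, fun x hx => (hC x hx).trans ?_⟩
    gcongr 1
    exact zpow_le_zpow_right_of_le_one₀ (abs_pos.2 (hD.ne_zero x hx)) (hD.abs_le_one x hx) hM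
  induction m generalizing N M u with
  | zero => exact h0
  | succ m ih =>
    exact ⟨h0, h.2.1, ih h.2.2 (by omega) (by
      obtain ⟨C, hC0, hC⟩ := h.2.2.bound
      refine ⟨C, fun x hx => (hC x hx).trans ?_⟩
      gcongr 1
      exact zpow_le_zpow_right_of_le_one₀ (abs_pos.2 (hD.ne_zero x hx)) (hD.abs_le_one x hx)
        (by omega))⟩

theorem zero (D : Set ℝ) (m : ℕ) (N : ℤ) : SymbolOn D m N fun _ => 0 := by
  induction m generalizing N with
  | zero => exact ⟨0, by simp⟩
  | succ m ih => exact ⟨⟨0, by simp⟩, differentiableOn_const _, by simpa using ih (N - 1)⟩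

theorem const (D : Set ℝ) (m : ℕ) (c : ℝ) : SymbolOn D m 0 fun _ => c := by
  cases m with
  | zero => exact ⟨|c|, by simp⟩
  | succ m => exact ⟨⟨|c|, by simp⟩, differentiableOn_const _, by simpa using zero D m _⟩

theorem add (hD : SymbolDomain D) (hu : SymbolOn D m N u) (hv : SymbolOn D m N v) :
    SymbolOn D m N fun x => u x + v x := by
  have h0 : ∃ C, ∀ x ∈ D, |u x + v x| ≤ C * |x| ^ N := by
    obtain ⟨C, hC0, hC⟩ := hu.bound
    obtain ⟨C', hC0', hC'⟩ := hv.bound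
    refine ⟨C + C', fun x hx => (abs_add_le _ _).trans ?_⟩
    rw [add_mul]
    exact add_le_add (hC x hx) (hC' x hx)
  induction m generalizing N u v with
  | zero => exact h0
  | succ m ih =>
    refine ⟨h0, hu.2.1.add hv.2.1, ?_⟩
    refine (ih hu.2.2 hv.2.2 ?_).congr hD fun x hx =>
      deriv_fun_add (hu.differentiableAt hD hx) (hv.differentiableAt hD hx)
    obtain ⟨C, hC0, hC⟩ := hu.2.2.bound
    obtain ⟨C', hC0', hC'⟩ := hv.2.2.bound
    refine ⟨C + C', fun x hx => (abs_add_le _ _).trans ?_⟩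
    rw [add_mul]
    exact add_le_add (hC x hx) (hC' x hx)

theorem mul (hD : SymbolDomain D) (hu : SymbolOn D m N u) (hv : SymbolOn D m M v) :
    SymbolOn D m (N + M) fun x => u x * v x := by
  have h0 : ∀ {m N M u v}, SymbolOn D m N u → SymbolOn D m M v →
      ∃ C, ∀ x ∈ D, |u x * v x| ≤ C * |x| ^ (N + M) := fun hu hv => by
    obtain ⟨C, hC0, hC⟩ := hu.bound
    obtain ⟨C', hC0', hC'⟩ := hv.bound
    refine ⟨C * C', fun x hx => ?_⟩
    rw [abs_mul, zpow_add₀ (abs_ne_zero.2 (hD.ne_zero x hx)), mul_mul_mul_comm]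
    exact mul_le_mul (hC x hx) (hC' x hx) (abs_nonneg _) ((abs_nonneg _).trans (hC x hx))
  induction m generalizing N M u v with
  | zero => exact h0 hu hv
  | succ m ih =>
    refine ⟨h0 hu hv, hu.2.1.mul hv.2.1, ?_⟩
    have h1 := ih hu.2.2 hv.of_succ
    have h2 := ih hu.of_succ hv.2.2
    rw [show N - 1 + M = N + M - 1 by ring] at h1
    rw [show N + (M - 1) = N + M - 1 by ring] at h2
    exact (h1.add hD h2).congr hD fun x hx =>
      deriv_fun_mul (hu.differentiableAt hD hx) (hv.differentiableAt hD hx)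

theorem neg (hD : SymbolDomain D) (hu : SymbolOn D m N u) : SymbolOn D m N fun x => -u x := by
  have := (const D m (-1)).mul hD hu
  rw [zero_add] at this
  simpa using this

theorem inv (hD : SymbolDomain D) (hu : SymbolOn D m N u) {c : ℝ} (hc : 0 < c)
    (h : ∀ x ∈ D, c * |x| ^ N ≤ |u x|) : SymbolOn D m (-N) fun x => (u x)⁻¹ := by
  have hpos : ∀ x ∈ D, 0 < |x| ^ N := fun x hx => zpow_pos (abs_pos.2 (hD.ne_zero x hx)) _
  have hne : ∀ x ∈ D, u x ≠ 0 := fun x hx => by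
    have := (mul_pos hc (hpos x hx)).trans_le (h x hx)
    exact abs_pos.1 this
  have h0 : ∃ C, ∀ x ∈ D, |(u x)⁻¹| ≤ C * |x| ^ (-N) := by
    refine ⟨c⁻¹, fun x hx => ?_⟩
    rw [abs_inv, zpow_neg, ← mul_inv]
    exact inv_anti₀ (mul_pos hc (hpos x hx)) (h x hx)
  induction m with
  | zero => exact h0
  | succ m ih =>
    refine ⟨h0, fun x hx => (hu.2.1 x hx).inv (hne x hx), ?_⟩
    have h1 := ((hu.2.2.mul hD (ih hu.of_succ)).mul hD (ih hu.of_succ)).neg hD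
    rw [show N - 1 + -N + -N = -N - 1 by ring] at h1
    refine h1.congr hD fun x hx => ?_
    have h2 := ((hu.differentiableAt hD hx).hasDerivAt.inv (hne x hx)).deriv
    refine h2.trans ?_
    have := hne x hx
    field_simp

theorem exp_sub_one (hD : SymbolDomain D) (hN : 0 ≤ N) (hu : SymbolOn D m N u) :
    SymbolOn D m N fun x => Real.exp (u x) - 1 := by
  have h0 : ∃ C, ∀ x ∈ D, |Real.exp (u x) - 1| ≤ C * |x| ^ N := by
    obtain ⟨C, hC0, hC⟩ := hu.bound
    refine ⟨Real.exp C * C, fun x hx => ?_⟩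
    have h1 : |u x| ≤ C := (hC x hx).trans (mul_le_of_le_one_right hC0
      (zpow_le_one₀ (abs_pos.2 (hD.ne_zero x hx)) (hD.abs_le_one x hx) hN))
    have h2 : |Real.exp (u x) - 1| ≤ Real.exp C * |u x| := by
      have h3 := Real.add_one_le_exp (u x)
      have h4 := Real.add_one_le_exp (-u x)
      have h5 : Real.exp (u x) * Real.exp (-u x) = 1 := by rw [← Real.exp_add]; simp
      have h6 : Real.exp (u x) ≤ Real.exp C := Real.exp_le_exp.2 ((le_abs_self _).trans h1)
      have h7 : (1 : ℝ) ≤ Real.exp C := Real.one_le_exp hC0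
      rw [abs_le]
      constructor
      · nlinarith [neg_abs_le (u x), abs_nonneg (u x)]
      · nlinarith [le_abs_self (u x), abs_nonneg (u x), Real.exp_pos (u x)]
    rw [mul_assoc]
    exact h2.trans (mul_le_mul_of_nonneg_left (hC x hx) (Real.exp_pos C).le)
  induction m with
  | zero => exact h0
  | succ m ih =>
    refine ⟨h0, fun x hx => (hu.2.1 x hx).exp.sub_const _, ?_⟩
    have h1 := (hu.2.2.mul hD (ih hu.of_succ)).mono_weight hD (M := N - 1) (by omega)
    refine (h1.add hD hu.2.2).congr hD fun x hx => ?_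
    have h2 := ((hu.differentiableAt hD hx).hasDerivAt.exp.sub_const 1).deriv
    refine h2.trans ?_
    ring

theorem log_one_add (hD : SymbolDomain D) (hN : 0 ≤ N) (hu : SymbolOn D m N u)
    (hhalf : ∀ x ∈ D, |u x| ≤ 1 / 2) : SymbolOn D m N fun x => Real.log (1 + u x) := by
  have hpos : ∀ x ∈ D, 1 / 2 ≤ 1 + u x := fun x hx => by linarith [(abs_le.1 (hhalf x hx)).1]
  have h0 : ∃ C, ∀ x ∈ D, |Real.log (1 + u x)| ≤ C * |x| ^ N := by
    obtain ⟨C, hC0, hC⟩ := hu.bound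
    refine ⟨2 * C, fun x hx => ?_⟩
    have h1 : 0 < 1 + u x := by linarith [hpos x hx]
    have h2 := Real.log_le_sub_one_of_pos h1
    have h3 := Real.one_sub_inv_le_log_of_pos h1
    have h4 : (1 + u x)⁻¹ ≤ 2 := by
      rw [inv_le_comm₀ h1 (by norm_num)]
      linarith [hpos x hx]
    have h5 : 1 - (1 + u x)⁻¹ = u x * (1 + u x)⁻¹ := by field_simp; ring
    have h6 : -(2 * |u x|) ≤ u x * (1 + u x)⁻¹ := by
      have : |u x * (1 + u x)⁻¹| ≤ |u x| * 2 := by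
        rw [abs_mul, abs_of_pos (inv_pos.2 h1)]
        gcongr
      linarith [(abs_le.1 this).1]
    have h7 : |Real.log (1 + u x)| ≤ 2 * |u x| := by
      rw [abs_le]
      constructor <;> linarith [le_abs_self (u x), abs_nonneg (u x)]
    linarith [hC x hx]
  cases m with
  | zero => exact h0
  | succ m =>
    refine ⟨h0, fun x hx => ((hu.2.1 x hx).const_add _).log (by linarith [hpos x hx]), ?_⟩
    have h1 : SymbolOn D m 0 fun x => 1 + u x :=
      (const D m 1).add hD (hu.of_succ.mono_weight hD hN)
    have h2 := h1.inv hD (c := 1 / 2) (by norm_num) fun x hx => by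
      rw [zpow_zero, mul_one]
      exact (hpos x hx).trans (le_abs_self _)
    have h3 := hu.2.2.mul hD h2
    rw [neg_zero, add_zero] at h3
    refine h3.congr hD fun x hx => ?_
    exact (((hu.differentiableAt hD hx).hasDerivAt.const_add 1).log
      (by linarith [hpos x hx])).deriv

theorem of_contDiff (hD : SymbolDomain D) (hu : ContDiff ℝ (⊤ : ℕ∞) u) {N : ℕ}
    (h : u =O[𝓝 0] fun x : ℝ => x ^ N) (m : ℕ) : SymbolOn D m N u := by
  have h0 : ∀ {u : ℝ → ℝ} {N : ℕ}, ContDiff ℝ (⊤ : ℕ∞) u → u =O[𝓝 0] (fun x : ℝ => x ^ N) →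
      ∃ C, ∀ x ∈ D, |u x| ≤ C * |x| ^ (N : ℤ) := by
    intro u N hu h
    obtain ⟨C, hC⟩ := h.bound
    obtain ⟨δ, hδ, hδC⟩ := Metric.eventually_nhds_iff.1 hC
    obtain ⟨K, hK⟩ := (isCompact_Icc (a := (-1 : ℝ)) (b := 1)).exists_bound_of_continuousOn
      hu.continuous.continuousOn
    refine ⟨max C (K / δ ^ N), fun x hx => ?_⟩
    rw [zpow_natCast]
    have hx0 := abs_pos.2 (hD.ne_zero x hx)
    rcases lt_or_ge |x| δ with h1 | h1
    · have := hδC (y := x) (by simpa using h1)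
      rw [norm_pow, Real.norm_eq_abs, Real.norm_eq_abs] at this
      exact this.trans (by gcongr; exact le_max_left _ _)
    · have h2 := hK x (abs_le.1 (hD.abs_le_one x hx))
      rw [Real.norm_eq_abs] at h2
      have hK0 : 0 ≤ K := (abs_nonneg _).trans h2
      calc |u x| ≤ K := h2
        _ = K / δ ^ N * δ ^ N := by field_simp
        _ ≤ max C (K / δ ^ N) * |x| ^ N := by gcongr; exact le_max_right _ _
  induction m generalizing N u with
  | zero => exact h0 hu h
  | succ m ih =>
    refine ⟨h0 hu h, (hu.differentiable (by simp)).differentiableOn, ?_⟩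
    have hu' := (contDiff_infty_iff_deriv.1 hu).2
    cases N with
    | zero =>
      refine (ih hu' (N := 0) ?_).mono_weight hD (by simp)
      simpa using (hu'.continuous.tendsto 0).isBigO_one ℝ
    | succ N =>
      have h1 := hu.deriv_isBigO_pow (x₀ := 0) (N := N) (by simpa using h)
      simpa using ih hu' (by simpa using h1)

theorem union (hu : SymbolOn D m N u) (hu' : SymbolOn D' m N u) (hD : IsOpen D)
    (hD' : IsOpen D') : SymbolOn (D ∪ D') m N u := by
  have h0 : ∀ {m N u}, SymbolOn D m N u → SymbolOn D' m N u →
      ∃ C, ∀ x ∈ D ∪ D', |u x| ≤ C * |x| ^ N := by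
    intro m N u hu hu'
    obtain ⟨C, hC0, hC⟩ := hu.bound
    obtain ⟨C', hC0', hC'⟩ := hu'.bound
    refine ⟨max C C', fun x hx => ?_⟩
    rcases hx with hx | hx
    · exact (hC x hx).trans (by gcongr; exact le_max_left _ _)
    · exact (hC' x hx).trans (by gcongr; exact le_max_right _ _)
  induction m generalizing N u with
  | zero => exact h0 hu hu'
  | succ m ih => exact ⟨h0 hu hu', hu.2.1.union_of_isOpen hu'.2.1 hD hD', ih hu.2.2 hu'.2.2⟩

theorem comp_neg (hD : SymbolDomain D) (hu : SymbolOn D m N u) :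
    SymbolOn (-D) m N fun x => u (-x) := by
  have h0 : ∀ {m N u}, SymbolOn D m N u → ∃ C, ∀ x ∈ -D, |u (-x)| ≤ C * |x| ^ N := by
    intro m N u hu
    obtain ⟨C, hC0, hC⟩ := hu.bound
    exact ⟨C, fun x hx => by simpa using hC (-x) hx⟩
  induction m generalizing N u with
  | zero => exact h0 hu
  | succ m ih =>
    refine ⟨h0 hu, hu.2.1.comp differentiable_neg.differentiableOn fun x hx => hx, ?_⟩
    refine ((ih hu.2.2).neg hD.neg).congr hD.neg fun x _ => ?_
    exact deriv_comp_neg u x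

/-- A symbol of high weight on a punctured neighbourhood of `0` extends smoothly. -/
theorem contDiffOn_of_punctured {ε : ℝ} (hε : 0 < ε)
    (hu : SymbolOn (Ioo (-ε) ε \ {0}) (m + 1) N u) (hu0 : u 0 = 0) (hN : (m : ℤ) + 2 ≤ N) :
    ContDiffOn ℝ m u (Ioo (-ε) ε) := by
  have h0 : ∀ {m : ℕ} {N : ℤ} {u : ℝ → ℝ}, SymbolOn (Ioo (-ε) ε \ {0}) m N u → u 0 = 0 →
      2 ≤ N → HasDerivAt u 0 0 := by
    intro m N u hu hu0 hN
    obtain ⟨C, hC0, hC⟩ := hu.bound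
    rw [hasDerivAt_iff_isLittleO]
    simp only [hu0, sub_zero, smul_zero]
    have h1 : u =O[𝓝 0] fun x : ℝ => x ^ 2 := by
      refine IsBigO.of_bound C ?_
      filter_upwards [Ioo_mem_nhds (neg_lt_zero.2 hε) hε, Ioo_mem_nhds (neg_lt_zero.2 one_pos)
        one_pos] with x hx hx1
      by_cases hx0 : x = 0
      · simp [hx0, hu0]
      · refine (hC x ⟨hx, hx0⟩).trans ?_
        rw [norm_pow, Real.norm_eq_abs, ← zpow_natCast]
        gcongr 1
        exact zpow_le_zpow_right_of_le_one₀ (abs_pos.2 hx0) (abs_lt.2 hx1).le (by exact_mod_cast hN)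
    refine h1.trans_isLittleO ?_
    simpa using isLittleO_pow_pow (𝕜 := ℝ) (m := 1) (n := 2) (by norm_num)
  have hopen : IsOpen (Ioo (-ε) ε \ {0}) := isOpen_Ioo.sdiff isClosed_singleton
  induction m generalizing N u with
  | zero =>
    refine contDiffOn_zero.2 fun x hx => ?_
    by_cases hx0 : x = 0
    · subst hx0
      exact (h0 hu hu0 (by simpa using hN)).continuousAt.continuousWithinAt
    · exact (hu.2.1.differentiableAt (hopen.mem_nhds ⟨hx, hx0⟩)).continuousAt.continuousWithinAt
  | succ m ih =>
    have hd0 := h0 hu hu0 (by push_cast at hN; omega)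
    push_cast
    rw [contDiffOn_succ_iff_deriv_of_isOpen isOpen_Ioo]
    refine ⟨fun x hx => ?_, by simp, ih hu.2.2 hd0.deriv (by push_cast at hN; omega)⟩
    by_cases hx0 : x = 0
    · subst hx0
      exact hd0.differentiableAt.differentiableWithinAt
    · exact (hu.2.1.differentiableAt (hopen.mem_nhds ⟨hx, hx0⟩)).differentiableWithinAt

end SymbolOn

end Symbols

/-! ### Invariant vector fields near a contracting fixed point -/

section Contracting

open Asymptotics Topology

theorem symbolDomain_Ioo {ε : ℝ} (hε : ε ≤ 1) : SymbolDomain (Ioo 0 ε) :=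
  ⟨isOpen_Ioo, fun _ hx => hx.1.ne', fun x hx => by
    rw [abs_of_pos hx.1]
    exact hx.2.le.trans hε⟩

/-- The map `g` contracts `(0, ε)` to `0` at speed at least `a x ^ (k + 1)`. -/
structure IsContraction (g : ℝ → ℝ) (ε a : ℝ) (k : ℕ) : Prop where
  pos : 0 < ε
  le_one : ε ≤ 1
  speed_pos : 0 < a
  mono : StrictMono g
  smooth : ContDiff ℝ (⊤ : ℕ∞) g
  maps_pos : ∀ x ∈ Ioo 0 ε, 0 < g x
  gap : ∀ x ∈ Ioo 0 ε, a * x ^ (k + 1) ≤ x - g x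

/-- The sum of `u` along forward orbits of `g`. -/
def orbitSum (g u : ℝ → ℝ) (x : ℝ) : ℝ := ∑' n : ℕ, u (g^[n] x)

namespace IsContraction

variable {g : ℝ → ℝ} {ε a : ℝ} {k : ℕ} {u : ℝ → ℝ}

theorem lt_self (h : IsContraction g ε a k) {x : ℝ} (hx : x ∈ Ioo 0 ε) : g x < x := by
  have := h.gap x hx
  have h1 : 0 < a * x ^ (k + 1) := mul_pos h.speed_pos (pow_pos hx.1 _)
  linarith

theorem maps (h : IsContraction g ε a k) {x : ℝ} (hx : x ∈ Ioo 0 ε) : g x ∈ Ioo 0 ε :=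
  ⟨h.maps_pos x hx, (h.lt_self hx).trans hx.2⟩

theorem iterate_mem (h : IsContraction g ε a k) {x : ℝ} (hx : x ∈ Ioo 0 ε) (n : ℕ) :
    g^[n] x ∈ Ioo 0 ε := by
  induction n with
  | zero => exact hx
  | succ n ih => rw [Function.iterate_succ_apply']; exact h.maps ih

theorem sum_pow_le (h : IsContraction g ε a k) {x : ℝ} (hx : x ∈ Ioo 0 ε) {r : ℕ} (hr : 1 ≤ r)
    (n : ℕ) : ∑ i ∈ Finset.range n, (g^[i] x) ^ (r + k) ≤ a⁻¹ * x ^ r := by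
  have h1 : ∀ y ∈ Ioo 0 ε, a * y ^ (r + k) ≤ y ^ r - (g y) ^ r := fun y hy => by
    obtain ⟨j, rfl⟩ : ∃ j, r = j + 1 := ⟨r - 1, by omega⟩
    have h2 : (g y) ^ j ≤ y ^ j := pow_le_pow_left₀ (h.maps hy).1.le (h.lt_self hy).le j
    have h3 := mul_le_mul_of_nonneg_right (h.gap y hy) (pow_nonneg hy.1.le j)
    have h4 := mul_le_mul_of_nonneg_left h2 (h.maps hy).1.le
    have h5 : a * y ^ (k + 1) * y ^ j = a * y ^ (j + 1 + k) := by ring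
    rw [← h5, pow_succ' y j, pow_succ' (g y) j]
    linarith
  have h2 : a * ∑ i ∈ Finset.range n, (g^[i] x) ^ (r + k) ≤ x ^ r - (g^[n] x) ^ r := by
    induction n with
    | zero => simp
    | succ n ih =>
      rw [Finset.sum_range_succ, mul_add]
      have h3 := h1 _ (h.iterate_mem hx n)
      rw [← Function.iterate_succ_apply' g n x] at h3
      linarith
  have h3 : 0 ≤ (g^[n] x) ^ r := pow_nonneg (h.iterate_mem hx n).1.le _
  rw [← div_eq_inv_mul, le_div_iff₀ h.speed_pos]
  linarith

theorem summable_pow (h : IsContraction g ε a k) {x : ℝ} (hx : x ∈ Ioo 0 ε) {M : ℕ}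
    (hM : k + 1 ≤ M) : Summable fun n => (g^[n] x) ^ M := by
  obtain ⟨r, rfl⟩ : ∃ r, M = r + k := ⟨M - k, by omega⟩
  exact summable_of_sum_range_le (fun n => pow_nonneg (h.iterate_mem hx n).1.le _)
    (h.sum_pow_le hx (by omega))

theorem summable_of_bound (h : IsContraction g ε a k) {C : ℝ} {M : ℕ} (hM : k + 1 ≤ M)
    (hu : ∀ x ∈ Ioo 0 ε, |u x| ≤ C * x ^ M) {x : ℝ} (hx : x ∈ Ioo 0 ε) :
    Summable fun n => u (g^[n] x) :=
  .of_norm_bounded ((h.summable_pow hx hM).mul_left C) fun n => hu _ (h.iterate_mem hx n)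

theorem abs_orbitSum_le (h : IsContraction g ε a k) {C : ℝ} {r : ℕ} (hr : 1 ≤ r)
    (hu : ∀ x ∈ Ioo 0 ε, |u x| ≤ C * x ^ (r + k)) {x : ℝ} (hx : x ∈ Ioo 0 ε) :
    |orbitSum g u x| ≤ C * a⁻¹ * x ^ r := by
  have hC : 0 ≤ C := by
    have h1 := (abs_nonneg _).trans (hu x hx)
    exact nonneg_of_mul_nonneg_left h1 (pow_pos hx.1 _)
  have h1 := (h.summable_pow hx (show k + 1 ≤ r + k by omega)).mul_left C
  have h2 : ‖∑' n, u (g^[n] x)‖ ≤ _ :=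
    tsum_of_norm_bounded h1.hasSum fun n => hu _ (h.iterate_mem hx n)
  refine h2.trans ?_
  rw [tsum_mul_left, mul_assoc]
  gcongr
  exact Real.tsum_le_of_sum_range_le (fun n => pow_nonneg (h.iterate_mem hx n).1.le _)
    (h.sum_pow_le hx hr)

theorem orbitSum_eq (h : IsContraction g ε a k) {C : ℝ} {M : ℕ} (hM : k + 1 ≤ M)
    (hu : ∀ x ∈ Ioo 0 ε, |u x| ≤ C * x ^ M) {x : ℝ} (hx : x ∈ Ioo 0 ε) :
    orbitSum g u x = u x + orbitSum g u (g x) :=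
  (h.summable_of_bound hM hu hx).tsum_eq_zero_add

variable {X : ℝ → ℝ} {b : ℝ}

theorem hasDerivAt_iterate (h : IsContraction g ε a k)
    (hX : ∀ x ∈ Ioo 0 ε, X (g x) = deriv g x * X x) (hX0 : ∀ x ∈ Ioo 0 ε, X x ≠ 0) {x : ℝ}
    (hx : x ∈ Ioo 0 ε) (n : ℕ) : HasDerivAt (g^[n]) (X (g^[n] x) / X x) x := by
  induction n with
  | zero =>
    simp only [Function.iterate_zero, id]
    rw [div_self (hX0 x hx)]
    exact hasDerivAt_id x
  | succ n ih =>
    rw [Function.iterate_succ', Function.comp_apply, hX _ (h.iterate_mem hx n), mul_div_assoc]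
    exact ((h.smooth.differentiable (by simp) _).hasDerivAt).comp x ih

theorem hasDerivAt_orbitSum (h : IsContraction g ε a k)
    (hX : ∀ x ∈ Ioo 0 ε, X (g x) = deriv g x * X x) (hb : 0 < b)
    (hXb : ∀ x ∈ Ioo 0 ε, b * x ^ (k + 1) ≤ |X x|) {C C' : ℝ} {M M' : ℕ}
    (hM : k + 1 ≤ M) (hM' : k + 1 ≤ M') (hu : ∀ x ∈ Ioo 0 ε, |u x| ≤ C * x ^ M)
    (hud : DifferentiableOn ℝ u (Ioo 0 ε))
    (hu' : ∀ x ∈ Ioo 0 ε, |deriv u x * X x| ≤ C' * x ^ M') {x : ℝ} (hx : x ∈ Ioo 0 ε) :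
    HasDerivAt (orbitSum g u) (orbitSum g (fun y => deriv u y * X y) x * (X x)⁻¹) x := by
  have hX0 : ∀ x ∈ Ioo 0 ε, X x ≠ 0 := fun y hy =>
    abs_pos.1 ((mul_pos hb (pow_pos hy.1 _)).trans_le (hXb y hy))
  set x₁ := (x + ε) / 2 with hx₁
  have hx₁D : x₁ ∈ Ioo 0 ε := ⟨by linarith [hx.1, h.pos], by linarith [hx.2]⟩
  have hsub : ∀ y ∈ Ioo (x / 2) x₁, y ∈ Ioo 0 ε := fun y hy =>
    ⟨by linarith [hy.1, hx.1], hy.2.trans hx₁D.2⟩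
  have hC' : 0 ≤ C' := by
    have h1 := (abs_nonneg _).trans (hu' x hx)
    exact nonneg_of_mul_nonneg_left h1 (pow_pos hx.1 _)
  have hxm : x ∈ Ioo (x / 2) x₁ := ⟨by linarith [hx.1], by linarith [hx.2]⟩
  have h1 := hasDerivAt_tsum_of_isPreconnected (g := fun n y => u (g^[n] y))
    (g' := fun n y => deriv u (g^[n] y) * (X (g^[n] y) / X y))
    (u := fun n => C' * (g^[n] x₁) ^ M' * (b * (x / 2) ^ (k + 1))⁻¹) (t := Ioo (x / 2) x₁)
    (y₀ := x) (y := x)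
    (((h.summable_pow hx₁D hM').mul_left C').mul_right _) isOpen_Ioo isPreconnected_Ioo
    (fun n y hy => ?_) (fun n y hy => ?_) hxm (h.summable_of_bound hM hu hx) hxm
  · refine h1.congr_deriv ?_
    rw [orbitSum, ← tsum_mul_right]
    exact tsum_congr fun n => by rw [mul_assoc, div_eq_mul_inv]
  · have h2 := h.iterate_mem (hsub y hy) n
    exact ((hud.differentiableAt (isOpen_Ioo.mem_nhds h2)).hasDerivAt).comp y
      (h.hasDerivAt_iterate hX hX0 (hsub y hy) n)
  · have h2 := h.iterate_mem (hsub y hy) n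
    have h3 : g^[n] y ≤ g^[n] x₁ := (h.mono.iterate n).monotone hy.2.le
    have h4 : b * (x / 2) ^ (k + 1) ≤ |X y| := by
      refine le_trans ?_ (hXb y (hsub y hy))
      have : 0 ≤ x / 2 := by linarith [hx.1]
      gcongr
      exact hy.1.le
    have h5 : 0 < b * (x / 2) ^ (k + 1) := mul_pos hb (pow_pos (by linarith [hx.1]) _)
    rw [div_eq_mul_inv, ← mul_assoc, norm_mul, Real.norm_eq_abs, norm_inv, Real.norm_eq_abs]
    have h6 : 0 ≤ C' * (g^[n] x₁) ^ M' :=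
      mul_nonneg hC' (pow_nonneg (h.iterate_mem hx₁D n).1.le _)
    refine mul_le_mul ((hu' _ h2).trans ?_) (inv_anti₀ h5 h4) (by positivity) h6
    have := h2.1.le
    gcongr

theorem symbolOn_orbitSum (h : IsContraction g ε a k)
    (hX : ∀ x ∈ Ioo 0 ε, X (g x) = deriv g x * X x) (hb : 0 < b)
    (hXb : ∀ x ∈ Ioo 0 ε, b * x ^ (k + 1) ≤ |X x|) {m : ℕ}
    (hXs : SymbolOn (Ioo 0 ε) (m - 1) (k + 1) X) {M : ℕ} (hM : k + 1 ≤ M)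
    (hu : SymbolOn (Ioo 0 ε) m M u) : SymbolOn (Ioo 0 ε) m (M - k) (orbitSum g u) := by
  have hD := symbolDomain_Ioo h.le_one
  have hbound : ∀ {m M : ℕ} {u : ℝ → ℝ}, SymbolOn (Ioo 0 ε) m M u →
      ∃ C, ∀ x ∈ Ioo 0 ε, |u x| ≤ C * x ^ M := fun hu => by
    obtain ⟨C, -, hC⟩ := hu.bound
    exact ⟨C, fun x hx => by simpa [abs_of_pos hx.1] using hC x hx⟩
  have h0 : ∀ {m M : ℕ} {u : ℝ → ℝ}, k + 1 ≤ M → SymbolOn (Ioo 0 ε) m M u →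
      ∃ C, ∀ x ∈ Ioo 0 ε, |orbitSum g u x| ≤ C * |x| ^ ((M : ℤ) - k) := by
    intro m M u hM hu
    obtain ⟨C, hC⟩ := hbound hu
    obtain ⟨r, rfl⟩ : ∃ r, M = r + k := ⟨M - k, by omega⟩
    refine ⟨C * a⁻¹, fun x hx => ?_⟩
    have := h.abs_orbitSum_le (by omega) hC hx
    simpa [abs_of_pos hx.1] using this
  induction m generalizing M u with
  | zero => exact h0 hM hu
  | succ m ih =>
    have hd : SymbolOn (Ioo 0 ε) m (M + k : ℕ) fun y => deriv u y * X y := by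
      have := hu.2.2.mul hD hXs
      rwa [show (M : ℤ) - 1 + (k + 1) = (M + k : ℕ) by push_cast; ring] at this
    obtain ⟨C, hC⟩ := hbound hu
    obtain ⟨C', hC'⟩ := hbound hd
    have hder := fun x (hx : x ∈ Ioo 0 ε) => h.hasDerivAt_orbitSum hX hb hXb hM (by omega) hC
      hu.2.1 hC' hx
    refine ⟨h0 hM hu, fun x hx => (hder x hx).differentiableAt.differentiableWithinAt, ?_⟩
    have h1 := ih (hXs.mono_order (Nat.sub_le m 1)) (by omega) hd
    have h2 := h1.mul hD (hXs.inv hD hb fun x hx => by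
      have := hXb x hx
      rw [abs_of_pos hx.1]
      exact_mod_cast this)
    rw [show ((M + k : ℕ) : ℤ) - k + -(k + 1) = M - k - 1 by push_cast; ring] at h2
    exact h2.congr hD fun x hx => (hder x hx).deriv

end IsContraction

end Contracting

section InvariantField

open Asymptotics Topology

variable {g P : ℝ → ℝ} {c : ℝ} {k N : ℕ}

theorem eventually_abs_le_pow {u : ℝ → ℝ} {n m : ℕ} (hu : u =O[𝓝 0] fun x : ℝ => x ^ m)
    (hnm : n < m) {δ : ℝ} (hδ : 0 < δ) : ∀ᶠ x in 𝓝[>] (0 : ℝ), |u x| ≤ δ * x ^ n := by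
  have h1 : u =o[𝓝 0] fun x : ℝ => x ^ n := hu.trans_isLittleO (isLittleO_pow_pow hnm)
  filter_upwards [(h1.bound hδ).filter_mono nhdsWithin_le_nhds, self_mem_nhdsWithin] with x hx hx0
  have h2 : (0 : ℝ) < x := hx0
  simpa [abs_of_pos h2] using hx

theorem exists_isContraction (hg : ContDiff ℝ (⊤ : ℕ∞) g) (hmono : StrictMono g)
    (hg0 : g 0 = 0) (hg1 : deriv g 0 = 1) (hc : c < 0)
    (hgc : (fun x => g x - x - c * x ^ (k + 1)) =O[𝓝 0] fun x : ℝ => x ^ (k + 2))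
    (hPc : (fun x => P x - c * x ^ (k + 1)) =O[𝓝 0] fun x : ℝ => x ^ (k + 2))
    (hN : 2 * k + 2 ≤ N)
    (hE : (fun x => P (g x) - deriv g x * P x) =O[𝓝 0] fun x : ℝ => x ^ N) :
    ∃ ε, IsContraction g ε (-c / 2) k ∧ ∀ x ∈ Ioo 0 ε, P x ≤ -(-c / 2 * x ^ (k + 1)) ∧
      1 / 2 ≤ deriv g x ∧ |P (g x) - deriv g x * P x| ≤ -c / 8 * x ^ (k + 1) := by
  have ha : 0 < -c / 2 := by linarith
  have hd : ∀ᶠ x in 𝓝[>] (0 : ℝ), 1 / 2 ≤ deriv g x := by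
    have h1 : ContinuousAt (deriv g) 0 := (hg.continuous_deriv (by simp)).continuousAt
    have h2 := h1.eventually (lt_mem_nhds (show (1 / 2 : ℝ) < deriv g 0 by rw [hg1]; norm_num))
    exact (h2.mono fun x hx => hx.le).filter_mono nhdsWithin_le_nhds
  have h1 := eventually_abs_le_pow hgc (show k + 1 < k + 2 by omega) ha
  have h2 := eventually_abs_le_pow hPc (show k + 1 < k + 2 by omega) ha
  have h3 := eventually_abs_le_pow hE (show k + 1 < N by omega)
    (show 0 < -c / 8 by linarith)
  obtain ⟨ε, hε, h⟩ := mem_nhdsGT_iff_exists_Ioo_subset.1 (h1.and (h2.and (h3.and hd)))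
  have hε : 0 < ε := hε
  refine ⟨min ε 1, ⟨lt_min hε one_pos, min_le_right _ _, ha, hmono, hg,
    fun x hx => hg0 ▸ hmono hx.1, fun x hx => ?_⟩, fun x hx => ?_⟩
  · have := (abs_le.1 (h ⟨hx.1, hx.2.trans_le (min_le_left _ _)⟩).1).2
    linarith
  · obtain ⟨-, h4, h5, h6⟩ := h ⟨hx.1, hx.2.trans_le (min_le_left _ _)⟩
    have := (abs_le.1 h4).2
    exact ⟨by linarith, h6, h5⟩

/-- A formally invariant vector field can be corrected, by a flat error, to a vector field which is
invariant on the contracting side of the fixed point `0`. -/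
theorem exists_invariant_field (hg : ContDiff ℝ (⊤ : ℕ∞) g) (hmono : StrictMono g)
    (hg0 : g 0 = 0) (hg1 : deriv g 0 = 1) (hP : ContDiff ℝ (⊤ : ℕ∞) P) (hc : c < 0)
    (hgc : (fun x => g x - x - c * x ^ (k + 1)) =O[𝓝 0] fun x : ℝ => x ^ (k + 2))
    (hPc : (fun x => P x - c * x ^ (k + 1)) =O[𝓝 0] fun x : ℝ => x ^ (k + 2))
    (hN : 2 * k + 2 ≤ N)
    (hE : (fun x => P (g x) - deriv g x * P x) =O[𝓝 0] fun x : ℝ => x ^ N) :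
    ∃ (ε : ℝ) (X : ℝ → ℝ), IsContraction g ε (-c / 2) k ∧
      (∀ x ∈ Ioo 0 ε, X (g x) = deriv g x * X x) ∧ (∀ x ∈ Ioo 0 ε, X x < 0) ∧
      (∀ m, SymbolOn (Ioo 0 ε) m (N - k) fun x => X x - P x) ∧
      Tendsto (fun x => X x / (g x - x)) (𝓝[>] 0) (𝓝 1) := by
  obtain ⟨ε, h, hloc⟩ := exists_isContraction hg hmono hg0 hg1 hc hgc hPc hN hE
  have hD := symbolDomain_Ioo h.le_one
  set a := -c / 2 with ha
  set s : ℝ → ℝ := fun x => (P (g x) - deriv g x * P x) * (deriv g x)⁻¹ * (P x)⁻¹ with hs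
  set w : ℝ → ℝ := fun x => Real.log (1 + s x) with hw
  set v := orbitSum g w with hv
  have hPneg : ∀ x ∈ Ioo 0 ε, P x < 0 := fun x hx => by
    have := mul_pos h.speed_pos (pow_pos hx.1 (k + 1))
    linarith [(hloc x hx).1]
  have hPabs : ∀ x ∈ Ioo 0 ε, a * x ^ (k + 1) ≤ |P x| := fun x hx => by
    rw [abs_of_neg (hPneg x hx)]
    linarith [(hloc x hx).1]
  have hs2 : ∀ x ∈ Ioo 0 ε, |s x| ≤ 1 / 2 := fun x hx => by
    obtain ⟨-, h2, h3⟩ := hloc x hx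
    have h1 := hPabs x hx
    have h4 : 0 < |P x| := abs_pos.2 (hPneg x hx).ne
    rw [hs]
    simp only [abs_mul, abs_inv]
    rw [abs_of_pos (show 0 < deriv g x by linarith), mul_assoc, ← mul_inv, ← div_eq_mul_inv,
      div_le_iff₀ (mul_pos (by linarith) h4)]
    have h5 := mul_le_mul_of_nonneg_right h2 h4.le
    have h6 : -c / 8 * x ^ (k + 1) = a * x ^ (k + 1) / 4 := by rw [ha]; ring
    linarith
  have hgP : ContDiff ℝ (⊤ : ℕ∞) (deriv g) := (contDiff_infty_iff_deriv.1 hg).2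
  have hPs : ∀ m, SymbolOn (Ioo 0 ε) m (k + 1) P := fun m => by
    have h1 : P =O[𝓝 0] fun x : ℝ => x ^ (k + 1) := by
      have h2 := (hPc.trans (isBigO_pow_of_le_zero (show k + 1 ≤ k + 2 by omega))).add
        ((isBigO_refl (fun x : ℝ => x ^ (k + 1)) (𝓝 0)).const_mul_left c)
      simpa using h2
    exact_mod_cast SymbolOn.of_contDiff hD hP h1 m
  obtain ⟨M, hM⟩ : ∃ M : ℕ, N = M + (k + 1) := ⟨N - (k + 1), by omega⟩
  have hws : ∀ m, SymbolOn (Ioo 0 ε) m M w := fun m => by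
    have h1 : SymbolOn (Ioo 0 ε) m 0 (deriv g) := by
      have : deriv g =O[𝓝 0] fun x : ℝ => x ^ 0 := by
        simpa using hgP.continuous.continuousAt.isBigO_one ℝ
      exact_mod_cast SymbolOn.of_contDiff hD hgP this m
    have h2 := SymbolOn.of_contDiff hD
      ((hP.comp hg).sub (hgP.mul hP)) hE m
    have h3 := (h2.mul hD (h1.inv hD (c := 1 / 2) (by norm_num) fun x hx => by
      rw [zpow_zero, mul_one]
      exact (hloc x hx).2.1.trans (le_abs_self _))).mul hD
      ((hPs m).inv hD h.speed_pos fun x hx => by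
        rw [abs_of_pos hx.1]
        exact_mod_cast hPabs x hx)
    rw [show (N : ℤ) + -0 + -(k + 1) = M by rw [hM]; push_cast; ring] at h3
    exact h3.log_one_add hD (by positivity) hs2
  have hkM : k + 1 ≤ M := by omega
  obtain ⟨r, hr⟩ : ∃ r : ℕ, M = r + k := ⟨M - k, by omega⟩
  obtain ⟨C, hC⟩ : ∃ C, ∀ x ∈ Ioo 0 ε, |w x| ≤ C * x ^ M := by
    obtain ⟨C, -, hC⟩ := (hws 0).bound
    exact ⟨C, fun x hx => by simpa [abs_of_pos hx.1] using hC x hx⟩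
  have hvb : ∀ x ∈ Ioo 0 ε, |v x| ≤ C * a⁻¹ * x ^ r := fun x hx =>
    h.abs_orbitSum_le (by omega) (by rwa [hr] at hC) hx
  have hv0 : SymbolOn (Ioo 0 ε) 0 r v := ⟨C * a⁻¹, fun x hx => by
    simpa [abs_of_pos hx.1] using hvb x hx⟩
  set X : ℝ → ℝ := fun x => P x * Real.exp (v x) with hX
  have htr : ∀ x ∈ Ioo 0 ε, X (g x) = deriv g x * X x := fun x hx => by
    have h1 : v x = w x + v (g x) := h.orbitSum_eq hkM hC hx
    have h2 : 0 < 1 + s x := by linarith [(abs_le.1 (hs2 x hx)).1]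
    have h3 : (1 + s x) * (deriv g x * P x) = P (g x) := by
      have := (hPneg x hx).ne
      have : deriv g x ≠ 0 := by linarith [(hloc x hx).2.1]
      rw [hs]
      field_simp
      ring
    simp only [hX]
    rw [h1, Real.exp_add, show Real.exp (w x) = 1 + s x from Real.exp_log h2, ← h3]
    ring
  have hXv : ∀ m, SymbolOn (Ioo 0 ε) m r v → SymbolOn (Ioo 0 ε) m (k + 1) X := fun m hm => by
    have h1 := (hPs m).mul hD ((SymbolOn.const _ m 1).add hD
      ((hm.exp_sub_one hD (by positivity)).mono_weight hD (show (0 : ℤ) ≤ r by positivity)))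
    rw [add_zero] at h1
    exact h1.congr hD fun x hx => by simp only [hX]; ring
  obtain ⟨b, hb, hXb⟩ : ∃ b, 0 < b ∧ ∀ x ∈ Ioo 0 ε, b * x ^ (k + 1) ≤ |X x| := by
    refine ⟨a * Real.exp (-|C * a⁻¹|), mul_pos h.speed_pos (Real.exp_pos _), fun x hx => ?_⟩
    simp only [hX]
    rw [abs_mul (P x), Real.abs_exp, mul_right_comm]
    refine mul_le_mul (hPabs x hx) (Real.exp_le_exp.2 ?_) (Real.exp_pos _).le (abs_nonneg _)
    have h1 := (abs_le.1 (hvb x hx)).1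
    have h2 : x ^ r ≤ 1 := pow_le_one₀ hx.1.le (hx.2.le.trans h.le_one)
    have h3 : C * a⁻¹ * x ^ r ≤ |C * a⁻¹| * 1 :=
      mul_le_mul (le_abs_self _) h2 (pow_nonneg hx.1.le _) (abs_nonneg _)
    linarith
  have hvs : ∀ m, SymbolOn (Ioo 0 ε) m r v := fun m => by
    induction m with
    | zero => exact hv0
    | succ m ih =>
      have h1 := h.symbolOn_orbitSum htr hb hXb (m := m + 1) (hXv m ih) hkM (hws (m + 1))
      rwa [show (M : ℤ) - k = r by rw [hr]; push_cast; ring] at h1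
  refine ⟨ε, X, h, htr, fun x hx => mul_neg_of_neg_of_pos (hPneg x hx) (Real.exp_pos _),
    fun m => ?_, ?_⟩
  · have h1 := (hPs m).mul hD ((hvs m).exp_sub_one hD (by positivity))
    rw [show (k : ℤ) + 1 + r = N - k by rw [hM, hr]; push_cast; ring] at h1
    exact h1.congr hD fun x hx => by simp only [hX]; ring
  · have hv1 : Tendsto v (𝓝[>] 0) (𝓝 0) := by
      have h1 : Tendsto (fun x : ℝ => C * a⁻¹ * x ^ r) (𝓝[>] 0) (𝓝 0) := by
        have : ContinuousAt (fun x : ℝ => C * a⁻¹ * x ^ r) 0 := by fun_prop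
        have h2 := this.tendsto
        simp only [zero_pow (show r ≠ 0 by omega), mul_zero] at h2
        exact h2.mono_left nhdsWithin_le_nhds
      refine squeeze_zero_norm' ?_ h1
      filter_upwards [Ioo_mem_nhdsGT h.pos] with x hx using hvb x hx
    have hratio : ∀ {u : ℝ → ℝ},
        ((fun x => u x - c * x ^ (k + 1)) =O[𝓝 0] fun x : ℝ => x ^ (k + 2)) →
        Tendsto (fun x => u x / x ^ (k + 1)) (𝓝[>] 0) (𝓝 c) := fun {u} hu => by
      have h1 : (fun x => u x - c * x ^ (k + 1)) =o[𝓝[>] 0] fun x : ℝ => x ^ (k + 1) :=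
        (hu.trans_isLittleO (isLittleO_pow_pow (by omega))).mono nhdsWithin_le_nhds
      have h2 := h1.tendsto_div_nhds_zero.add_const c
      rw [zero_add] at h2
      refine h2.congr' ?_
      filter_upwards [self_mem_nhdsWithin] with x hx
      have h3 : (0 : ℝ) < x := hx
      field_simp
      ring
    have h1 := ((hratio hPc).mul hv1.rexp).div (hratio hgc) hc.ne
    rw [Real.exp_zero, mul_one, div_self hc.ne] at h1
    refine h1.congr' ?_
    filter_upwards [self_mem_nhdsWithin] with x hx
    have h3 : (0 : ℝ) < x := hx
    simp only [hX, Pi.div_apply]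
    rw [div_mul_eq_mul_div, div_div_div_cancel_right₀ (pow_pos h3 _).ne']

end InvariantField

namespace CircleLift

section FieldGerm

open Asymptotics Topology

/-- The conjugate of `F` by `x ↦ -x`. -/
def reflect (F : CircleLift) : CircleLift where
  toFun x := -F (-x)
  invFun x := -F.invFun (-x)
  smooth := (F.smooth.comp contDiff_neg).neg
  smooth_inv := (F.smooth_inv.comp contDiff_neg).neg
  left_inv x := by simp [F.left_inv (-x)]
  right_inv x := by simp [F.right_inv (-x)]
  mono x y h := neg_lt_neg (F.mono (neg_lt_neg h))
  lift x := by
    have := F.lift (-(x + 1))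
    rw [show -(x + 1) + 1 = -x by ring] at this
    rw [this]
    ring

@[simp] theorem reflect_apply (F : CircleLift) (x : ℝ) : F.reflect x = -F (-x) := rfl

theorem inv_reflect (F : CircleLift) : F.reflect⁻¹ = F⁻¹.reflect := rfl

theorem reflect_reflect (F : CircleLift) : F.reflect.reflect = F := ext fun x => by simp

theorem reflect_pow (F : CircleLift) (n : ℕ) : F.reflect ^ n = (F ^ n).reflect := by
  induction n with
  | zero => ext; simp
  | succ n ih => rw [pow_succ, ih, pow_succ]; ext; simp

theorem deriv_reflect (F : CircleLift) (x : ℝ) : deriv F.reflect.toFun x = deriv F (-x) := by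
  have : deriv (fun y => -F (-y)) x = deriv F (-x) := by
    rw [deriv.fun_neg, deriv_comp_neg, neg_neg]
  exact this

/-- The generating vector field of `g` at `x`, computed along the forward orbit, is `l`. -/
def HasField (g : CircleLift) (x l : ℝ) : Prop :=
  Tendsto (fun n : ℕ => ((g ^ (n + 1)) x - (g ^ n) x) / deriv (g ^ n).toFun x) atTop (𝓝 l)

variable {g : CircleLift} {x x₀ l : ℝ}

theorem HasField.reflect (h : HasField g x l) : HasField g.reflect (-x) (-l) := by
  refine (Tendsto.neg h).congr fun n => ?_
  rw [reflect_pow, reflect_pow, deriv_reflect]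
  simp only [reflect_apply, neg_neg]
  ring

theorem HasField.of_pow_apply {m : ℕ} (h : HasField g ((g ^ m) x) l) :
    HasField g x (l / deriv (g ^ m).toFun x) := by
  rw [HasField, ← tendsto_add_atTop_iff_nat m]
  refine (h.div_const _).congr fun n => ?_
  rw [show n + m + 1 = n + 1 + m by ring, pow_add g (n + 1) m, pow_add g n m, deriv_mul, mul_apply,
    mul_apply, div_div]

theorem HasField.apply_eq_zero (hx : g x = x) : HasField g x 0 := by
  refine tendsto_const_nhds.congr fun n => ?_
  rw [pow_succ, mul_apply, hx, sub_self, zero_div]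

/-- Near `x₀`, the map `g` differs from the identity by `c (y - x₀) ^ (k + 1)`, up to higher order
terms. -/
def HasOrder (g : CircleLift) (x₀ c : ℝ) (k : ℕ) : Prop :=
  (fun y => g y - y - c * (y - x₀) ^ (k + 1)) =O[𝓝 x₀] fun y => (y - x₀) ^ (k + 2)

theorem HasOrder.sub_isBigO {c : ℝ} {k : ℕ} (h : HasOrder g x₀ c k) :
    (fun y => g y - y) =O[𝓝 x₀] fun y => (y - x₀) ^ (k + 1) := by
  have h1 := (IsBigO.trans h (isBigO_pow_of_le (show k + 1 ≤ k + 2 by omega))).add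
    ((isBigO_refl (fun y : ℝ => (y - x₀) ^ (k + 1)) (𝓝 x₀)).const_mul_left c)
  simpa using h1

theorem HasOrder.apply_eq {c : ℝ} {k : ℕ} (h : HasOrder g x₀ c k) : g x₀ = x₀ := by
  have h1 := (h.sub_isBigO.norm_right.congr_right fun y =>
    norm_pow (y - x₀) (k + 1)).eq_zero_of_norm_pow (by omega)
  exact sub_eq_zero.1 h1

theorem HasOrder.deriv_eq_one {c : ℝ} {k : ℕ} (h : HasOrder g x₀ c k) (hk : 1 ≤ k) :
    deriv g x₀ = 1 := by
  obtain ⟨k, rfl⟩ : ∃ j, k = j + 1 := ⟨k - 1, by omega⟩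
  have h1 := (g.smooth.sub contDiff_id).isBigO_pow_iff.1 h.sub_isBigO 1 (by omega)
  rw [iteratedDeriv_one] at h1
  have h2 : deriv (fun y => g y - y) x₀ = deriv g x₀ - 1 :=
    ((g.differentiable x₀).hasDerivAt.sub (hasDerivAt_id x₀)).deriv
  have h3 : deriv (fun y => g y - y) x₀ = 0 := h1
  linarith

theorem HasOrder.inv {c : ℝ} {k : ℕ} (h : HasOrder g x₀ c k) (hk : 1 ≤ k) :
    HasOrder g⁻¹ x₀ (-c) k := by
  have hfix : g⁻¹ x₀ = x₀ := by
    conv_lhs => rw [← h.apply_eq]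
    exact g.inv_apply_self x₀
  have hd := g⁻¹.differentiable x₀
  have h1 := isBigO_pow_comp h hd hfix
  have h2 := isBigO_pow_comp h.sub_isBigO hd hfix
  simp only [apply_inv_self] at h1 h2
  have h3 : (fun y => (g⁻¹ y - x₀) ^ (k + 1) - (y - x₀) ^ (k + 1)) =O[𝓝 x₀]
      fun y => (y - x₀) ^ (k + 2) := by
    have h4 : (fun y => g⁻¹ y - x₀) =O[𝓝 x₀] fun y => y - x₀ := by
      have := hd.isBigO_sub
      rwa [hfix] at this
    have h5 : ∀ n : ℕ, (fun y => (g⁻¹ y - x₀) ^ (n + 1) - (y - x₀) ^ (n + 1)) =O[𝓝 x₀]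
        fun y => (y - x₀) ^ (k + 1 + n) := fun n => by
      induction n with
      | zero => simpa using h2.neg_left
      | succ n ih =>
        have h7 : ∀ y, (y - x₀) * (y - x₀) ^ (k + 1 + n) = (y - x₀) ^ (k + 1 + (n + 1)) :=
          fun y => by ring
        have h8 : ∀ y, (y - x₀) ^ (k + 1) * (y - x₀) ^ (n + 1) = (y - x₀) ^ (k + 1 + (n + 1)) :=
          fun y => by ring
        have h9 := ((h4.mul ih).congr_right h7).add (((h2.neg_left).mul
          (isBigO_refl (fun y : ℝ => (y - x₀) ^ (n + 1)) (𝓝 x₀))).congr_right h8)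
        exact h9.congr_left fun y => by ring
    exact (h5 k).trans (isBigO_pow_of_le (by omega))
  have h4 := (h1.add (h3.const_mul_left c)).neg_left
  exact h4.congr_left fun y => by ring

theorem HasOrder.reflect {c : ℝ} {k : ℕ} (h : HasOrder g x₀ c k) :
    HasOrder g.reflect (-x₀) ((-1) ^ k * c) k := by
  have h1 := (isBigO_pow_comp h (φ := fun y => -y) (y₀ := -x₀) (by fun_prop) (neg_neg _)).neg_left
  refine h1.congr_left fun y => ?_
  have h2 : (-y - x₀) ^ (k + 1) = (-1) ^ (k + 1) * (y - -x₀) ^ (k + 1) := by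
    rw [← mul_pow]; ring
  rw [h2, reflect_apply]
  ring

/-- On the right of `x₀` the map `g` contracts to `x₀`, and its generating vector field differs
from `P (· - x₀)` by a symbol of weight `M`. -/
def FieldGerm (g : CircleLift) (x₀ : ℝ) (P : ℝ → ℝ) (M : ℕ) : Prop :=
  ∃ (ε : ℝ) (X : ℝ → ℝ), 0 < ε ∧ ε ≤ 1 ∧
    (∀ x ∈ Ioo 0 ε, g (x₀ + x) < x₀ + x ∧ HasField g (x₀ + x) (X x) ∧ X x < 0) ∧
    (∀ m, SymbolOn (Ioo 0 ε) m M fun x => X x - P x) ∧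
    Tendsto (fun x => X x / (g (x₀ + x) - (x₀ + x))) (𝓝[>] 0) (𝓝 1)

theorem HasOrder.fieldGerm {P : ℝ → ℝ} {c : ℝ} {k M : ℕ} (h : HasOrder g x₀ c k) (hk : 1 ≤ k)
    (hP : ContDiff ℝ (⊤ : ℕ∞) P) (hc : c < 0)
    (hPc : (fun x => P x - c * x ^ (k + 1)) =O[𝓝 0] fun x : ℝ => x ^ (k + 2))
    (hM : k + 2 ≤ M)
    (hE : (fun x => P (g (x₀ + x) - x₀) - deriv g (x₀ + x) * P x) =O[𝓝 0]
      fun x : ℝ => x ^ (M + k)) : FieldGerm g x₀ P M := by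
  set γ : ℝ → ℝ := fun x => g (x₀ + x) - x₀ with hγ
  have hγs : ContDiff ℝ (⊤ : ℕ∞) γ :=
    (g.smooth.comp (contDiff_const.add contDiff_id)).sub contDiff_const
  have hdγ : ∀ x, deriv γ x = deriv g (x₀ + x) := fun x => by
    rw [hγ, deriv_sub_const_fun, deriv_comp_const_add]
  have hγi : ∀ (n : ℕ) x, γ^[n] x = (g ^ n) (x₀ + x) - x₀ := fun n x => by
    induction n with
    | zero => simp
    | succ n ih => rw [Function.iterate_succ_apply', ih, pow_succ', mul_apply]; simp [hγ]
  have hγc : (fun x => γ x - x - c * x ^ (k + 1)) =O[𝓝 0] fun x : ℝ => x ^ (k + 2) := by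
    have := isBigO_pow_comp h (φ := fun y => x₀ + y) (y₀ := 0) (by fun_prop) (add_zero _)
    simp only [sub_zero, add_sub_cancel_left] at this
    exact this.congr_left fun y => by simp only [hγ]; ring
  obtain ⟨ε, X, hcon, htr, hneg, hsym, hlim⟩ := exists_invariant_field (N := M + k) hγs
    (fun x y hxy => sub_lt_sub_right (g.mono (by linarith)) _)
    (by simp [hγ, h.apply_eq]) (by rw [hdγ, add_zero]; exact h.deriv_eq_one hk) hP hc hγc hPc
    (by omega) (by simpa only [hdγ] using hE)
  have hsub : ∀ x, γ x - x = g (x₀ + x) - (x₀ + x) := fun x => by simp only [hγ]; ring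
  refine ⟨ε, X, hcon.pos, hcon.le_one, fun x hx => ⟨?_, ?_, hneg x hx⟩, fun m => ?_, ?_⟩
  · have := hcon.lt_self hx
    linarith [hsub x]
  · have h1 : Tendsto (fun n => γ^[n] x) atTop (𝓝[>] 0) := by
      refine tendsto_nhdsWithin_iff.2 ⟨?_, .of_forall fun n => (hcon.iterate_mem hx n).1⟩
      have h2 := (hcon.summable_pow hx (le_refl (k + 1))).tendsto_atTop_zero
      have h3 := h2.rpow_const (p := ((k + 1 : ℕ) : ℝ)⁻¹) (Or.inr (by positivity))
      rw [Real.zero_rpow (by positivity)] at h3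
      exact h3.congr fun n => Real.pow_rpow_inv_natCast (hcon.iterate_mem hx n).1.le (by omega)
    have h2 := ((hlim.comp h1).inv₀ one_ne_zero).mul_const (X x)
    rw [inv_one, one_mul] at h2
    refine h2.congr fun n => ?_
    have h3 : deriv (g ^ n).toFun (x₀ + x) = X (γ^[n] x) / X x := by
      rw [← (hcon.hasDerivAt_iterate htr (fun y hy => (hneg y hy).ne) hx n).deriv]
      rw [show γ^[n] = fun x => (g ^ n) (x₀ + x) - x₀ from funext (hγi n), deriv_sub_const_fun,
        deriv_comp_const_add]
    rw [h3, pow_succ', mul_apply, Function.comp_apply, hsub, hγi, add_sub_cancel, inv_div,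
      div_div_eq_mul_div, div_mul_eq_mul_div]
  · have := hsym m
    rwa [show ((M + k : ℕ) : ℤ) - k = M by push_cast; ring] at this
  · simpa only [hsub] using hlim

end FieldGerm

end CircleLift

namespace CircleLift

section FormalField

open Asymptotics Topology

variable {g : CircleLift} {x₀ c : ℝ} {k N : ℕ} {P : ℝ → ℝ}

/-- The vector field `P (· - x₀)` is invariant under `g` up to order `N`. -/
structure FormalField (g : CircleLift) (x₀ c : ℝ) (k N : ℕ) (P : ℝ → ℝ) : Prop where
  smooth : ContDiff ℝ (⊤ : ℕ∞) P
  leading : (fun x => P x - c * x ^ (k + 1)) =O[𝓝 0] fun x : ℝ => x ^ (k + 2)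
  transport : (fun x => P (g (x₀ + x) - x₀) - deriv g (x₀ + x) * P x) =O[𝓝 0]
    fun x : ℝ => x ^ N

theorem HasOrder.exists_formalField (h : HasOrder g x₀ c k) (hc : c ≠ 0) (hk : 1 ≤ k) (N : ℕ) :
    ∃ P, FormalField g x₀ c k N P := by
  set γ : ℝ → ℝ := fun x => g (x₀ + x) - x₀ with hγ
  have hγs : ContDiff ℝ (⊤ : ℕ∞) γ :=
    (g.smooth.comp (contDiff_const.add contDiff_id)).sub contDiff_const
  have hdγ : ∀ x, deriv γ x = deriv g (x₀ + x) := fun x => by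
    rw [hγ, deriv_sub_const_fun, deriv_comp_const_add]
  have hγc : (fun x => γ x - x - c * x ^ (k + 1)) =O[𝓝 0] fun x : ℝ => x ^ (k + 2) := by
    have := isBigO_pow_comp h (φ := fun y => x₀ + y) (y₀ := 0) (by fun_prop) (add_zero _)
    simp only [sub_zero, add_sub_cancel_left] at this
    exact this.congr_left fun y => by simp only [hγ]; ring
  obtain ⟨P, h1, h2, h3⟩ := exists_formal_vectorField hγs hc hk hγc N
  exact ⟨P, h1, h2, by simpa only [hdγ] using h3⟩

theorem FormalField.inv (h : FormalField g x₀ c k N P) (hx : g x₀ = x₀) :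
    FormalField g⁻¹ x₀ (-c) k N fun x => -P x := by
  refine ⟨h.smooth.neg, h.leading.neg_left.congr_left fun x => by ring, ?_⟩
  have hfix : g⁻¹ x₀ = x₀ := by
    conv_lhs => rw [← hx]
    exact g.inv_apply_self x₀
  have h1 := isBigO_pow_comp (u := fun x => P (g (x₀ + x) - x₀) - deriv g (x₀ + x) * P x)
    (x₀ := 0) (y₀ := 0) (φ := fun x => g⁻¹ (x₀ + x) - x₀) (N := N)
    (by simpa using h.transport)
    ((((g⁻¹).differentiable _).comp (0 : ℝ) (by fun_prop)).sub_const _) (by simp [hfix])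
  simp only [sub_zero, add_sub_cancel, apply_inv_self, add_sub_cancel_left] at h1
  have h2 : (fun x => deriv (g⁻¹).toFun (x₀ + x)) =O[𝓝 0] fun _ => (1 : ℝ) :=
    ((g⁻¹).contDiff_deriv.continuous.comp
      (continuous_const.add continuous_id)).continuousAt.isBigO_one ℝ
  refine (h2.mul h1).congr (fun x => ?_) fun x => one_mul _
  have h3 := (g.deriv_pos (g⁻¹ (x₀ + x))).ne'
  rw [deriv_inv]
  field_simp
  ring

theorem FormalField.reflect (h : FormalField g x₀ c k N P) :
    FormalField g.reflect (-x₀) ((-1) ^ k * c) k N fun x => -P (-x) := by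
  have key : ∀ {u : ℝ → ℝ} {n : ℕ}, u =O[𝓝 0] (fun x : ℝ => x ^ n) →
      (fun x => u (-x)) =O[𝓝 0] fun x : ℝ => x ^ n := fun {u n} hu => by
    have := isBigO_pow_comp (x₀ := 0) (y₀ := 0) (φ := fun x : ℝ => -x) (N := n)
      (by simpa using hu) (by fun_prop) neg_zero
    simpa using this
  refine ⟨(h.smooth.comp contDiff_neg).neg, (key h.leading).neg_left.congr_left fun x => ?_,
    (key h.transport).neg_left.congr_left fun x => ?_⟩
  · rw [neg_pow x]
    ring
  · rw [deriv_reflect, reflect_apply, show -(-x₀ + x) = x₀ + -x by ring,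
      show -(-g (x₀ + -x) - -x₀) = g (x₀ + -x) - x₀ by ring]
    ring

theorem FieldGerm.mono {M M' : ℕ} (h : FieldGerm g x₀ P M) (hM : M' ≤ M) : FieldGerm g x₀ P M' := by
  obtain ⟨ε, X, h0, h1, h2, h3, h4⟩ := h
  exact ⟨ε, X, h0, h1, h2, fun m => (h3 m).mono_weight (symbolDomain_Ioo h1) (by exact_mod_cast hM),
    h4⟩

theorem HasOrder.fieldGerm_or (h : HasOrder g x₀ c k) (hc : c ≠ 0) (hk : 1 ≤ k) {M : ℕ}
    (hP : FormalField g x₀ c k (M + k + 2 + k) P) :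
    FieldGerm g x₀ P M ∨ FieldGerm g⁻¹ x₀ (fun x => -P x) M := by
  rcases hc.lt_or_gt with hc | hc
  · exact .inl ((h.fieldGerm (M := M + k + 2) hk hP.smooth hc hP.leading (by omega)
      hP.transport).mono (by omega))
  · have h1 := hP.inv h.apply_eq
    exact .inr (((h.inv hk).fieldGerm (M := M + k + 2) hk h1.smooth (by linarith) h1.leading
      (by omega) h1.transport).mono (by omega))

/-- One of `g`, `g⁻¹` contracts on the right of `x₀` and one of them on the left, and the
generating vector fields have a common expansion. -/
theorem HasOrder.exists_fieldGerm (h : HasOrder g x₀ c k) (hc : c ≠ 0) (hk : 1 ≤ k) (M : ℕ) :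
    ∃ P : ℝ → ℝ, ContDiff ℝ (⊤ : ℕ∞) P ∧ P 0 = 0 ∧
      (FieldGerm g x₀ P M ∨ FieldGerm g⁻¹ x₀ (fun x => -P x) M) ∧
      (FieldGerm g.reflect (-x₀) (fun x => -P (-x)) M ∨
        FieldGerm g⁻¹.reflect (-x₀) (fun x => P (-x)) M) := by
  obtain ⟨P, hP⟩ := h.exists_formalField hc hk (M + k + 2 + k)
  refine ⟨P, hP.smooth, ?_, h.fieldGerm_or hc hk hP, ?_⟩
  · have h1 := (hP.leading.trans (isBigO_pow_of_le_zero (show k + 1 ≤ k + 2 by omega))).add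
      ((isBigO_refl (fun x : ℝ => x ^ (k + 1)) (𝓝 0)).const_mul_left c)
    have h2 := h1.norm_right.congr_right fun y => show _ = ‖y - 0‖ ^ (k + 1) by
      rw [norm_pow, sub_zero]
    simpa using h2.eq_zero_of_norm_pow (by omega)
  · have h1 := h.reflect.fieldGerm_or (mul_ne_zero (by positivity) hc) hk hP.reflect
    rw [inv_reflect] at h1
    simpa only [neg_neg] using h1

end FormalField

section Tame

open Asymptotics Topology

/-- A lift of a circle diffeomorphism with fixed points, tangent to the identity to a finite
order at all of them. -/
structure Tame (g : CircleLift) : Prop where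
  exists_fixed : ∃ x, g x = x
  exists_order : ∀ x, g x = x → ∃ (c : ℝ) (k : ℕ), c ≠ 0 ∧ 1 ≤ k ∧ HasOrder g x c k

theorem inv_apply_eq_self {g : CircleLift} {x : ℝ} : g⁻¹ x = x ↔ g x = x := by
  constructor <;> intro h
  · conv_lhs => rw [← h]
    exact g.apply_inv_self x
  · conv_lhs => rw [← h]
    exact g.inv_apply_self x

namespace Tame

variable {g : CircleLift} {x : ℝ}

theorem inv (h : Tame g) : Tame g⁻¹ := by
  refine ⟨h.exists_fixed.imp fun x => inv_apply_eq_self.2, fun x hx => ?_⟩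
  obtain ⟨c, k, hc, hk, h1⟩ := h.exists_order x (inv_apply_eq_self.1 hx)
  exact ⟨-c, k, neg_ne_zero.2 hc, hk, h1.inv hk⟩

theorem reflect (h : Tame g) : Tame g.reflect := by
  refine ⟨h.exists_fixed.imp' (fun x => -x) fun x hx => by simp [hx], fun x hx => ?_⟩
  obtain ⟨c, k, hc, hk, h1⟩ := h.exists_order (-x) (by
    rw [reflect_apply] at hx
    linarith)
  have := h1.reflect
  rw [neg_neg] at this
  exact ⟨_, k, mul_ne_zero (by positivity) hc, hk, this⟩

theorem deriv_eq_one (h : Tame g) (hx : g x = x) : deriv g x = 1 := by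
  obtain ⟨c, k, -, hk, h1⟩ := h.exists_order x hx
  exact h1.deriv_eq_one hk

end Tame

theorem pow_apply_eq_self {g : CircleLift} {x : ℝ} (hx : g x = x) (n : ℕ) : (g ^ n) x = x := by
  induction n with
  | zero => rfl
  | succ n ih => rw [pow_succ, mul_apply, hx, ih]

theorem exists_fixed_le {g : CircleLift} (h : ∃ x, g x = x) (x : ℝ) :
    ∃ a, g a = a ∧ a ≤ x ∧ x < a + 1 := by
  obtain ⟨b, hb⟩ := h
  refine ⟨b + ⌊x - b⌋, by rw [map_add_int, hb], ?_, ?_⟩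
  · linarith [Int.floor_le (x - b)]
  · linarith [Int.lt_floor_add_one (x - b)]

theorem pow_apply_antitone {g : CircleLift} {x : ℝ} (hx : g x ≤ x) :
    Antitone fun n : ℕ => (g ^ n) x := antitone_nat_of_succ_le fun n => by
  rw [pow_succ, mul_apply]
  exact (g ^ n).mono.monotone hx

theorem pow_apply_strictAnti {g : CircleLift} {x : ℝ} (hx : g x < x) :
    StrictAnti fun n : ℕ => (g ^ n) x := strictAnti_nat_of_succ_lt fun n => by
  rw [pow_succ, mul_apply]
  exact (g ^ n).mono hx

/-- Decreasing orbits converge to a fixed point. -/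
theorem exists_tendsto_pow {g : CircleLift} (h : ∃ x, g x = x) {x : ℝ} (hx : g x < x) :
    ∃ a, g a = a ∧ Tendsto (fun n : ℕ => (g ^ n) x) atTop (𝓝[>] a) := by
  obtain ⟨b, hb, hbx, -⟩ := exists_fixed_le h x
  have hbd : BddBelow (range fun n : ℕ => (g ^ n) x) := ⟨b, by
    rintro _ ⟨n, rfl⟩
    have := (g ^ n).mono.monotone hbx
    rwa [pow_apply_eq_self hb] at this⟩
  have h1 := tendsto_atTop_ciInf (pow_apply_antitone hx.le) hbd
  set a := ⨅ n : ℕ, (g ^ n) x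
  refine ⟨a, ?_, tendsto_nhdsWithin_iff.2 ⟨h1, .of_forall fun n => ?_⟩⟩
  · have h2 := (g.differentiable.continuous.tendsto a).comp h1
    refine tendsto_nhds_unique h2 (((tendsto_add_atTop_iff_nat 1).2 h1).congr fun n => ?_)
    rw [pow_succ', mul_apply]
    rfl
  · exact (ciInf_le hbd (n + 1)).trans_lt (pow_apply_strictAnti hx n.lt_succ_self)

/-- The generating vector field of a tame diffeomorphism. -/
def field (g : CircleLift) (x : ℝ) : ℝ :=
  limUnder atTop fun n : ℕ => ((g ^ (n + 1)) x - (g ^ n) x) / deriv (g ^ n).toFun x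

theorem HasField.field_eq {g : CircleLift} {x l : ℝ} (h : HasField g x l) : field g x = l :=
  h.limUnder_eq

namespace Tame

variable {g : CircleLift} {x : ℝ}

theorem fieldGerm_of_tendsto (h : Tame g) {a : ℝ} (hx : g x < x) (ha : g a = a)
    (hxa : Tendsto (fun n : ℕ => (g ^ n) x) atTop (𝓝[>] a)) (M : ℕ) :
    ∃ P, ContDiff ℝ (⊤ : ℕ∞) P ∧ FieldGerm g a P M := by
  obtain ⟨c, k, hc, hk, h1⟩ := h.exists_order a ha
  obtain ⟨P, hP, -, h2 | h2, -⟩ := h1.exists_fieldGerm hc hk M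
  · exact ⟨P, hP, h2⟩
  · exfalso
    obtain ⟨ε, X, hε, -, h3, -⟩ := h2
    obtain ⟨n, hn⟩ := (hxa.eventually (Ioo_mem_nhdsGT (show a < a + ε by linarith))).exists
    have h4 := (h3 ((g ^ n) x - a) ⟨by linarith [hn.1], by linarith [hn.2]⟩).1
    rw [add_sub_cancel] at h4
    have h5 := g.mono h4
    rw [apply_inv_self] at h5
    have h6 := (g ^ n).mono hx
    rw [← mul_apply, (Commute.refl g).pow_left n, mul_apply] at h6
    linarith

theorem hasField_of_lt (h : Tame g) (hx : g x < x) : ∃ l < 0, HasField g x l := by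
  obtain ⟨a, ha, hxa⟩ := exists_tendsto_pow h.exists_fixed hx
  obtain ⟨P, -, ε, X, hε, -, h3, -⟩ := h.fieldGerm_of_tendsto hx ha hxa 0
  obtain ⟨n, hn⟩ := (hxa.eventually (Ioo_mem_nhdsGT (show a < a + ε by linarith))).exists
  obtain ⟨-, h4, h5⟩ := h3 ((g ^ n) x - a) ⟨by linarith [hn.1], by linarith [hn.2]⟩
  rw [add_sub_cancel] at h4
  exact ⟨_, div_neg_of_neg_of_pos h5 ((g ^ n).deriv_pos x), h4.of_pow_apply⟩

theorem hasField_of_gt (h : Tame g) (hx : x < g x) : ∃ l > 0, HasField g x l := by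
  obtain ⟨l, hl, h1⟩ := h.reflect.hasField_of_lt (x := -x) (by simpa using hx)
  have h2 := h1.reflect
  rw [reflect_reflect, neg_neg] at h2
  exact ⟨-l, by linarith, h2⟩

theorem hasField (h : Tame g) (x : ℝ) : HasField g x (field g x) := by
  suffices ∃ l, HasField g x l by
    obtain ⟨l, hl⟩ := this
    rwa [hl.field_eq]
  rcases lt_trichotomy (g x) x with hx | hx | hx
  · exact (h.hasField_of_lt hx).imp fun _ => And.right
  · exact ⟨0, .apply_eq_zero hx⟩
  · exact (h.hasField_of_gt hx).imp fun _ => And.right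

theorem field_neg (h : Tame g) (hx : g x < x) : field g x < 0 := by
  obtain ⟨l, hl, h1⟩ := h.hasField_of_lt hx
  rwa [h1.field_eq]

theorem field_pos (h : Tame g) (hx : x < g x) : 0 < field g x := by
  obtain ⟨l, hl, h1⟩ := h.hasField_of_gt hx
  rwa [h1.field_eq]

theorem field_eq_zero (hx : g x = x) : field g x = 0 :=
  (HasField.apply_eq_zero hx).field_eq

theorem field_ne_zero (h : Tame g) (hx : g x ≠ x) : field g x ≠ 0 :=
  hx.lt_or_gt.elim (fun hx => (h.field_neg hx).ne) fun hx => (h.field_pos hx).ne'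

theorem field_reflect (h : Tame g) (x : ℝ) : field g.reflect x = -field g (-x) := by
  have := (h.hasField (-x)).reflect
  rw [neg_neg] at this
  exact this.field_eq

end Tame

end Tame

end CircleLift

theorem SymbolOn.contDiffOn {D : Set ℝ} {m : ℕ} {N : ℤ} {u : ℝ → ℝ} (hD : IsOpen D)
    (h : SymbolOn D (m + 1) N u) : ContDiffOn ℝ m u D := by
  induction m generalizing u N with
  | zero => exact contDiffOn_zero.2 h.2.1.continuousOn
  | succ m ih =>
    rw [show ((m + 1 : ℕ) : WithTop ℕ∞) = m + 1 by simp, contDiffOn_succ_iff_deriv_of_isOpen hD]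
    exact ⟨h.2.1, by simp, ih h.2.2⟩

namespace CircleLift

section FieldProperties

open Asymptotics Topology

theorem tendsto_pow_nhds {g : CircleLift} (h : ∃ x, g x = x) (x : ℝ) :
    ∃ a, g a = a ∧ Tendsto (fun n : ℕ => (g ^ n) x) atTop (𝓝 a) := by
  rcases lt_trichotomy (g x) x with hx | hx | hx
  · obtain ⟨a, ha, h1⟩ := exists_tendsto_pow h hx
    exact ⟨a, ha, h1.mono_right nhdsWithin_le_nhds⟩
  · exact ⟨x, hx, tendsto_const_nhds.congr fun n => (pow_apply_eq_self hx n).symm⟩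
  · obtain ⟨a, ha, h1⟩ := exists_tendsto_pow (g := g.reflect) (x := -x)
      (h.imp' (fun x => -x) fun x hx => by simp [hx]) (by simpa using hx)
    refine ⟨-a, ?_, ?_⟩
    · rw [reflect_apply] at ha
      linarith
    · refine (h1.mono_right nhdsWithin_le_nhds).neg.congr fun n => ?_
      rw [reflect_pow]
      simp

theorem apply_ne_of_mem_uIcc {g : CircleLift} {x y : ℝ} (hx : g x ≠ x)
    (hy : y ∈ uIcc x (g x)) : g y ≠ y := by
  intro h
  rcases hx.lt_or_gt with hx | hx
  · rw [uIcc_of_ge hx.le] at hy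
    have h1 := g.mono.monotone hy.2
    have h2 : y = g x := by linarith [hy.1]
    rw [h2] at h
    exact hx.ne (g.mono.injective h)
  · rw [uIcc_of_le hx.le] at hy
    have h1 := g.mono.monotone hy.1
    have h2 : y = g x := by linarith [hy.2]
    rw [h2] at h
    exact hx.ne' (g.mono.injective h)

theorem pow_apply_mem_uIcc {g : CircleLift} {x y : ℝ} (hy : y ∈ uIcc x (g x)) (n : ℕ) :
    (g ^ n) y ∈ uIcc ((g ^ n) x) ((g ^ (n + 1)) x) := by
  rw [pow_succ, mul_apply]
  have hm := (g ^ n).mono.monotone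
  rcases le_total x (g x) with h | h
  · rw [uIcc_of_le h] at hy
    rw [uIcc_of_le (hm h)]
    exact ⟨hm hy.1, hm hy.2⟩
  · rw [uIcc_of_ge h] at hy
    rw [uIcc_of_ge (hm h)]
    exact ⟨hm hy.1, hm hy.2⟩

theorem pow_apply_ne {g : CircleLift} {x : ℝ} (hx : g x ≠ x) (n : ℕ) :
    (g ^ (n + 1)) x ≠ (g ^ n) x := by
  rw [pow_succ, mul_apply]
  exact fun h => hx ((g ^ n).mono.injective h)

namespace Tame

variable {g F : CircleLift} {x : ℝ}

/-- The generating vector field is invariant under the centralizer. -/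
theorem field_map (h : Tame g) (hF : Commute F g) (x : ℝ) :
    field g (F x) = deriv F x * field g x := by
  have hc : ∀ n : ℕ, ∀ y, (g ^ n) (F y) = F ((g ^ n) y) := fun n y =>
    (congrArg (fun G : CircleLift => G y) (hF.pow_right n)).symm
  by_cases hx : g x = x
  · have : g (F x) = F x := by simpa [hx] using hc 1 x
    rw [field_eq_zero hx, field_eq_zero this, mul_zero]
  obtain ⟨a, -, ha⟩ := tendsto_pow_nhds h.exists_fixed x
  have ha1 := (tendsto_add_atTop_iff_nat 1).2 ha
  have hs : HasStrictDerivAt F (deriv F a) a :=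
    (F.smooth.contDiffAt).hasStrictDerivAt (by simp)
  have h1 := (hs.isLittleO.comp_tendsto (ha1.prodMk_nhds ha)).tendsto_div_nhds_zero
  have h2 := (F.contDiff_deriv.continuous.tendsto a).comp ha
  have h3 := ((h1.add_const (deriv F a)).div h2 (F.deriv_pos a).ne').mul
    ((h.hasField x).mul_const (deriv F x))
  rw [zero_add, div_self (F.deriv_pos a).ne', one_mul] at h3
  rw [mul_comm]
  refine HasField.field_eq (h3.congr fun n => ?_)
  have h4 : deriv (g ^ n).toFun (F x) * deriv F x =
      deriv F ((g ^ n) x) * deriv (g ^ n).toFun x := by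
    rw [← deriv_mul, ← deriv_mul, hF.pow_right n]
  have h5 := sub_ne_zero.2 (pow_apply_ne hx n)
  have h6 := (F.deriv_pos x).ne'
  have h7 := ((g ^ n).deriv_pos x).ne'
  have h8 := ((g ^ n).deriv_pos (F x)).ne'
  have h9 := (F.deriv_pos ((g ^ n) x)).ne'
  simp only [Function.comp_apply, hc]
  change ((F ((g ^ (n + 1)) x) - F ((g ^ n) x) - ((g ^ (n + 1)) x - (g ^ n) x) • deriv F a) /
    ((g ^ (n + 1)) x - (g ^ n) x) + deriv F a) / deriv F ((g ^ n) x) *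
    (((g ^ (n + 1)) x - (g ^ n) x) / deriv (g ^ n).toFun x * deriv F x) = _
  rw [smul_eq_mul]
  field_simp
  linear_combination (F ((g ^ (n + 1)) x) - F ((g ^ n) x)) * h4

theorem field_pow_apply (h : Tame g) (n : ℕ) (x : ℝ) :
    field g ((g ^ n) x) = deriv (g ^ n).toFun x * field g x :=
  h.field_map ((Commute.refl g).pow_left n) x

theorem eventually_abs_field_sub_le (h : Tame g) (hx : g x ≠ x) {δ : ℝ} (hδ : 0 < δ) :
    ∀ᶠ n : ℕ in atTop, ∀ y ∈ uIcc ((g ^ n) x) ((g ^ (n + 1)) x),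
      |field g y - ((g ^ (n + 1)) x - (g ^ n) x)| ≤ δ * |(g ^ (n + 1)) x - (g ^ n) x| := by
  wlog hlt : g x < x generalizing g x
  · have h1 := this h.reflect (x := -x) (by simpa using hx)
      (by simpa using lt_of_le_of_ne (not_lt.1 hlt) hx.symm)
    filter_upwards [h1] with n hn y hy
    have h2 := hn (-y) (by
      rw [reflect_pow, reflect_pow, reflect_apply, reflect_apply, neg_neg]
      have : -y ∈ Neg.neg '' uIcc ((g ^ n) x) ((g ^ (n + 1)) x) := mem_image_of_mem _ hy
      rwa [image_neg_uIcc] at this)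
    rw [reflect_pow, reflect_pow, reflect_apply, reflect_apply, neg_neg, h.field_reflect, neg_neg,
      ← abs_neg] at h2
    rw [← abs_neg ((g ^ (n + 1)) x - (g ^ n) x)]
    convert h2 using 2 <;> ring_nf
  obtain ⟨a, ha, hxa⟩ := exists_tendsto_pow h.exists_fixed hlt
  obtain ⟨P, -, ε, X, hε, -, h1, -, h2⟩ := h.fieldGerm_of_tendsto hlt ha hxa 0
  set η := min (δ / 3) 1 with hη
  have hη0 : 0 < η := lt_min (by linarith) one_pos
  have hηδ : η ≤ δ / 3 := min_le_left _ _
  have hη1 : η ≤ 1 := min_le_right _ _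
  have h3 : Tendsto (fun y => y - a) (𝓝[>] a) (𝓝[>] 0) := by
    refine tendsto_nhdsWithin_iff.2 ⟨?_, ?_⟩
    · have : ContinuousAt (fun y => y - a) a := by fun_prop
      have h4 := this.tendsto
      rw [sub_self] at h4
      exact h4.mono_left nhdsWithin_le_nhds
    · filter_upwards [self_mem_nhdsWithin] with y hy using sub_pos.2 (show a < y from hy)
  have h4 : ∀ᶠ y in 𝓝[>] a, |field g y - (g y - y)| ≤ η * |g y - y| := by
    filter_upwards [(h2.comp h3).eventually (Metric.closedBall_mem_nhds 1 hη0),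
      h3.eventually (Ioo_mem_nhdsGT hε)] with y hy hy2
    obtain ⟨h5, h6, -⟩ := h1 _ hy2
    simp only [Function.comp_apply, add_sub_cancel] at hy h5 h6
    rw [← h6.field_eq, Real.dist_eq] at hy
    have h7 : g y - y ≠ 0 := by linarith
    have h8 : field g y - (g y - y) = (field g y / (g y - y) - 1) * (g y - y) := by
      field_simp
    rw [h8, abs_mul]
    exact mul_le_mul_of_nonneg_right hy (abs_nonneg _)
  have h5 : ∀ᶠ y in 𝓝[>] a, |deriv g y - 1| ≤ η := by
    have h6 := (g.contDiff_deriv.continuous.tendsto a).eventually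
      (Metric.closedBall_mem_nhds _ hη0)
    rw [h.deriv_eq_one ha] at h6
    exact h6.filter_mono nhdsWithin_le_nhds
  obtain ⟨b, hb, hab⟩ := mem_nhdsGT_iff_exists_Ioo_subset.1 (h4.and h5)
  filter_upwards [hxa.eventually (Ioo_mem_nhdsGT hb),
    ((tendsto_add_atTop_iff_nat 1).2 hxa).eventually (Ioo_mem_nhdsGT hb)] with n hn hn1 y hy
  have hle : (g ^ (n + 1)) x ≤ (g ^ n) x := pow_apply_antitone hlt.le n.le_succ
  rw [uIcc_of_ge hle] at hy
  have hsub : Icc ((g ^ (n + 1)) x) ((g ^ n) x) ⊆ Ioo a b := fun z hz =>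
    ⟨hn1.1.trans_le hz.1, hz.2.trans_lt hn.2⟩
  have h6 : ‖(g y - y) - (g ((g ^ n) x) - (g ^ n) x)‖ ≤ η * ‖y - (g ^ n) x‖ := by
    refine (convex_Icc ((g ^ (n + 1)) x) ((g ^ n) x)).norm_image_sub_le_of_norm_hasDerivWithin_le
      (f := fun z => g z - z) (f' := fun z => deriv g z - 1)
      (fun z _ => ((g.differentiable z).hasDerivAt.sub (hasDerivAt_id z)).hasDerivWithinAt)
      (fun z hz => (hab (hsub hz)).2) ⟨hle, le_rfl⟩ hy
  have h7 := (hab (hsub hy)).1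
  rw [← mul_apply, ← pow_succ', Real.norm_eq_abs, Real.norm_eq_abs] at h6
  have h8 : |y - (g ^ n) x| ≤ |(g ^ (n + 1)) x - (g ^ n) x| := by
    rw [abs_of_nonpos (by linarith [hy.2]), abs_of_nonpos (by linarith)]
    linarith [hy.1]
  set ψ := (g ^ (n + 1)) x - (g ^ n) x
  have h9 : |(g y - y) - ψ| ≤ η * |ψ| := h6.trans (by gcongr)
  have h10 : |g y - y| ≤ 2 * |ψ| := by
    have := abs_add_le ((g y - y) - ψ) ψ
    rw [sub_add_cancel] at this
    have h11 : η * |ψ| ≤ 1 * |ψ| := by gcongr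
    linarith
  have h11 := abs_add_le (field g y - (g y - y)) ((g y - y) - ψ)
  rw [sub_add_sub_cancel] at h11
  have h12 : η * |g y - y| ≤ η * (2 * |ψ|) := by gcongr
  have h13 : η * |ψ| ≤ δ / 3 * |ψ| := by gcongr
  linarith

theorem contDiffAt_field (h : Tame g) (hx : g x ≠ x) : ContDiffAt ℝ (⊤ : ℕ∞) (field g) x := by
  wlog hlt : g x < x generalizing g x
  · have h1 := this h.reflect (x := -x) (by simpa using hx)
      (by simpa using lt_of_le_of_ne (not_lt.1 hlt) hx.symm)
    have h2 : field g = fun y => -field g.reflect (-y) := funext fun y => by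
      rw [h.field_reflect, neg_neg, neg_neg]
    rw [h2]
    exact (h1.comp x contDiff_neg.contDiffAt).neg
  obtain ⟨a, ha, hxa⟩ := exists_tendsto_pow h.exists_fixed hlt
  obtain ⟨P, hP, ε, X, hε, -, h1, h2, -⟩ := h.fieldGerm_of_tendsto hlt ha hxa 0
  obtain ⟨n, hn⟩ := (hxa.eventually (Ioo_mem_nhdsGT (show a < a + ε by linarith))).exists
  have h3 : ContDiffAt ℝ (⊤ : ℕ∞) (field g) ((g ^ n) x) := by
    have h4 : ContDiffOn ℝ (⊤ : ℕ∞) (fun y => X y - P y) (Ioo 0 ε) :=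
      contDiffOn_infty.2 fun m => (h2 (m + 1)).contDiffOn isOpen_Ioo
    have h5 : ContDiffAt ℝ (⊤ : ℕ∞) X ((g ^ n) x - a) := by
      have h6 := (h4.contDiffAt (x := (g ^ n) x - a) (isOpen_Ioo.mem_nhds
        ⟨by linarith [hn.1], by linarith [hn.2]⟩)).add hP.contDiffAt
      simpa using h6
    have h6 : ContDiffAt ℝ (⊤ : ℕ∞) (fun y : ℝ => y - a) ((g ^ n) x) :=
      contDiffAt_id.sub contDiffAt_const
    refine (ContDiffAt.comp (g := X) (f := fun y => y - a) _ h5 h6).congr_of_eventuallyEq ?_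
    filter_upwards [isOpen_Ioo.mem_nhds hn] with y hy
    obtain ⟨-, h7, -⟩ := h1 (y - a) ⟨by linarith [hy.1], by linarith [hy.2]⟩
    rw [add_sub_cancel] at h7
    exact h7.field_eq
  have h4 : field g = fun y => field g ((g ^ n) y) / deriv (g ^ n).toFun y := funext fun y => by
    rw [h.field_pow_apply, mul_div_cancel_left₀ _ ((g ^ n).deriv_pos y).ne']
  rw [h4]
  exact (h3.comp x (g ^ n).smooth.contDiffAt).div (g ^ n).contDiff_deriv.contDiffAt
    ((g ^ n).deriv_pos x).ne'

theorem integral_inv_field_pow (h : Tame g) (hx : g x ≠ x) (n : ℕ) :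
    ∫ y in (g ^ n) x..(g ^ (n + 1)) x, (field g y)⁻¹ = ∫ y in x..g x, (field g y)⁻¹ := by
  have h1 := intervalIntegral.integral_comp_mul_deriv'' (f := (g ^ n).toFun)
    (f' := deriv (g ^ n).toFun) (a := x) (b := g x) (g := fun y => (field g y)⁻¹)
    (g ^ n).smooth.continuous.continuousOn
    (fun y _ => ((g ^ n).differentiable y).hasDerivAt.hasDerivWithinAt)
    (g ^ n).contDiff_deriv.continuous.continuousOn (by
      rintro _ ⟨y, hy, rfl⟩
      have hne : g ((g ^ n) y) ≠ (g ^ n) y := by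
        have := pow_apply_ne (apply_ne_of_mem_uIcc hx hy) n
        rwa [pow_succ', mul_apply] at this
      exact ((h.contDiffAt_field hne).continuousAt.inv₀ (h.field_ne_zero hne)).continuousWithinAt)
  rw [pow_succ, mul_apply, ← h1]
  refine intervalIntegral.integral_congr fun y _ => ?_
  simp only [Function.comp_apply]
  rw [h.field_pow_apply, mul_inv, mul_right_comm,
    inv_mul_cancel₀ ((g ^ n).deriv_pos y).ne', one_mul]

/-- The time needed to move from `x` to `g x` along the generating vector field is `1`. -/
theorem integral_inv_field (h : Tame g) (hx : g x ≠ x) :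
    ∫ y in x..g x, (field g y)⁻¹ = 1 := by
  suffices ∀ δ : ℝ, 0 < δ → δ ≤ 1 / 2 → |(∫ y in x..g x, (field g y)⁻¹) - 1| ≤ 2 * δ by
    rw [← sub_eq_zero, ← abs_nonpos_iff]
    refine le_of_forall_pos_le_add fun δ hδ => ?_
    have := this (min (δ / 2) (1 / 2)) (lt_min (by linarith) (by norm_num)) (min_le_right _ _)
    linarith [min_le_left (δ / 2) (1 / 2 : ℝ)]
  intro δ hδ hδ2
  obtain ⟨n, hn⟩ := (h.eventually_abs_field_sub_le hx hδ).exists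
  have hne : g ((g ^ n) x) ≠ (g ^ n) x := by
    have := pow_apply_ne hx n
    rwa [pow_succ', mul_apply] at this
  have hψ0 := sub_ne_zero.2 (pow_apply_ne hx n)
  have hInt : IntervalIntegrable (fun y => (field g y)⁻¹) MeasureTheory.volume
      ((g ^ n) x) ((g ^ (n + 1)) x) := by
    refine ContinuousOn.intervalIntegrable fun y hy => ?_
    rw [pow_succ', mul_apply] at hy
    have := apply_ne_of_mem_uIcc hne hy
    exact ((h.contDiffAt_field this).continuousAt.inv₀ (h.field_ne_zero this)).continuousWithinAt
  set ψ := (g ^ (n + 1)) x - (g ^ n) x with hψ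
  have h1 : ∫ _ in (g ^ n) x..(g ^ (n + 1)) x, ψ⁻¹ = 1 := by
    rw [intervalIntegral.integral_const, ← hψ, smul_eq_mul, mul_inv_cancel₀ hψ0]
  rw [← h.integral_inv_field_pow hx n, ← h1, ← intervalIntegral.integral_sub hInt (by simp)]
  have h2 : ∀ y ∈ uIoc ((g ^ n) x) ((g ^ (n + 1)) x), ‖(field g y)⁻¹ - ψ⁻¹‖ ≤ 2 * δ * |ψ|⁻¹ := by
    intro y hy
    have h3 := hn y (uIoc_subset_uIcc hy)
    have hpos : 0 < |ψ| := abs_pos.2 hψ0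
    have h4 : |ψ| / 2 ≤ |field g y| := by
      have h5 := abs_sub_abs_le_abs_sub ψ (field g y)
      rw [abs_sub_comm ψ (field g y)] at h5
      have : δ * |ψ| ≤ 1 / 2 * |ψ| := by gcongr
      linarith
    have h5 : field g y ≠ 0 := abs_pos.1 (by linarith)
    have h6 : (field g y)⁻¹ - ψ⁻¹ = -((field g y - ψ) * (field g y)⁻¹ * ψ⁻¹) := by
      field_simp
      ring
    rw [h6, norm_neg, Real.norm_eq_abs, abs_mul, abs_mul, abs_inv, abs_inv]
    refine mul_le_mul_of_nonneg_right ?_ (by positivity)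
    rw [← div_eq_mul_inv, div_le_iff₀ (by linarith)]
    nlinarith
  refine (intervalIntegral.norm_integral_le_of_norm_le_const h2).trans ?_
  rw [← hψ, mul_assoc, inv_mul_cancel₀ (abs_pos.2 hψ0).ne', mul_one]

end Tame

end FieldProperties

end CircleLift

theorem sum_edist_le_eVariationOn (f : ℝ → ℝ) {u v : ℕ → ℝ}
    (h : ∀ m, u m ≤ v m ∧ v m ≤ u (m + 1)) (n : ℕ) :
    ∑ m ∈ Finset.range n, edist (f (v m)) (f (u m)) ≤ eVariationOn f (Icc (u 0) (u n)) := by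
  have hu : Monotone u := monotone_nat_of_le_succ fun m => (h m).1.trans (h m).2
  induction n with
  | zero => simp
  | succ n ih =>
    have h1 := eVariationOn.Icc_add_Icc f (s := univ) (hu n.zero_le) (hu n.le_succ) (mem_univ _)
    simp only [univ_inter] at h1
    rw [Finset.sum_range_succ, ← h1]
    exact add_le_add ih (eVariationOn.edist_le f ⟨(h n).1, (h n).2⟩ ⟨le_rfl, hu n.le_succ⟩)

namespace CircleLift

open Topology

theorem log_deriv_pow_inv_pow (g : CircleLift) {m N : ℕ} (hm : m ≤ N) (x : ℝ) :
    Real.log (deriv (g ^ N).toFun ((g⁻¹ ^ m) x)) =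
      Real.log (deriv (g ^ (N - m)).toFun x) - Real.log (deriv (g⁻¹ ^ m).toFun x) := by
  have h1 : g ^ (N - m) = g ^ N * g⁻¹ ^ m := by
    rw [inv_pow, pow_sub g hm]
  rw [h1, deriv_mul, Real.log_mul (deriv_pos _ _).ne' (deriv_pos _ _).ne', add_sub_cancel_right]

theorem eLogVar_inv (F : CircleLift) : (F⁻¹).eLogVar = F.eLogVar := by
  have h1 : ∀ x, Real.log (deriv (F⁻¹).toFun x) =
      -((fun x => Real.log (deriv F x)) ∘ (F⁻¹).toFun) x := fun x => by
    rw [deriv_inv, Real.log_inv, Function.comp_apply]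
  have h2 := F⁻¹.lift 0
  rw [zero_add] at h2
  rw [← F.eVariationOn_log_deriv ((F⁻¹).toFun 0), ← h2,
    ← eVariationOn_comp_Icc _ F⁻¹.mono.monotone F⁻¹.smooth.continuous zero_le_one]
  simp only [eLogVar, eVariationOn, h1, edist_neg_neg]

theorem _root_.AsympVarVanishesC.inv {F : CircleLift} (hF : AsympVarVanishesC F) :
    AsympVarVanishesC F⁻¹ :=
  hF.of_le ENNReal.zero_ne_top fun n => by
    rw [inv_pow, eLogVar_inv, add_zero]

namespace Tame

variable {g F : CircleLift} {x : ℝ}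

theorem tendsto_field_div (h : Tame g) (hx : g x ≠ x) {y : ℝ} (hy : y ∈ uIcc x (g x)) :
    Tendsto (fun n : ℕ => field g ((g ^ n) y) / ((g ^ (n + 1)) x - (g ^ n) x)) atTop (𝓝 1) := by
  refine Metric.tendsto_nhds.2 fun δ hδ => ?_
  filter_upwards [h.eventually_abs_field_sub_le hx (half_pos hδ)] with n hn
  have h1 := sub_ne_zero.2 (pow_apply_ne hx n)
  have h2 := hn _ (pow_apply_mem_uIcc hy n)
  rw [Real.dist_eq, div_sub_one h1, abs_div]
  exact ((div_le_iff₀ (abs_pos.2 h1)).2 h2).trans_lt (half_lt_self hδ)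

theorem tendsto_log_deriv_sub (h : Tame g) (hx : g x ≠ x) {y z : ℝ} (hy : y ∈ uIcc x (g x))
    (hz : z ∈ uIcc x (g x)) :
    Tendsto (fun n : ℕ => Real.log (deriv (g ^ n).toFun y) - Real.log (deriv (g ^ n).toFun z))
      atTop (𝓝 (Real.log (field g z) - Real.log (field g y))) := by
  have h1 := ((h.tendsto_field_div hx hy).log one_ne_zero).sub
    ((h.tendsto_field_div hx hz).log one_ne_zero)
  have h2 := h1.add_const (Real.log (field g z) - Real.log (field g y))
  rw [sub_self, zero_add] at h2
  refine h2.congr fun n => ?_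
  have h3 := sub_ne_zero.2 (pow_apply_ne hx n)
  have hd := fun t => ((g ^ n).deriv_pos t).ne'
  have hy' := h.field_ne_zero (apply_ne_of_mem_uIcc hx hy)
  have hz' := h.field_ne_zero (apply_ne_of_mem_uIcc hx hz)
  rw [h.field_pow_apply, h.field_pow_apply, Real.log_div (mul_ne_zero (hd y) hy') h3,
    Real.log_div (mul_ne_zero (hd z) hz') h3, Real.log_mul (hd y) hy', Real.log_mul (hd z) hz']
  ring

theorem log_field_sub_log_field_inv (h : Tame g) (hv : AsympVarVanishesC g) (hx : g x < x) {y : ℝ}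
    (hy : y ∈ Icc (g x) x) :
    Real.log (field g y) - Real.log (field g x) =
      Real.log (field g⁻¹ y) - Real.log (field g⁻¹ x) := by
  set A := fun n : ℕ => Real.log (deriv (g ^ n).toFun x) - Real.log (deriv (g ^ n).toFun y)
  set B := fun n : ℕ => Real.log (deriv (g⁻¹ ^ n).toFun x) - Real.log (deriv (g⁻¹ ^ n).toFun y)
  have hA : Tendsto A atTop (𝓝 (Real.log (field g y) - Real.log (field g x))) :=
    h.tendsto_log_deriv_sub hx.ne left_mem_uIcc (by rwa [uIcc_of_ge hx.le])
  have hB : Tendsto B atTop (𝓝 (Real.log (field g⁻¹ y) - Real.log (field g⁻¹ x))) := by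
    refine h.inv.tendsto_log_deriv_sub (x := g x) ?_ ?_ ?_
    · rw [inv_apply_self]
      exact hx.ne'
    · rw [inv_apply_self]
      exact right_mem_uIcc
    · rwa [inv_apply_self, uIcc_of_le hx.le]
  have hle : ∀ N : ℕ, |∑ m ∈ Finset.range N, (A (m + 1) - B m)| ≤ (g ^ N).eLogVar.toReal := by
    intro N
    obtain ⟨a, ha, hax, hxa⟩ := exists_fixed_le h.exists_fixed x
    have hai : g⁻¹ a = a := inv_apply_eq_self.2 ha
    have hay : a ≤ y := by
      have := g.mono.monotone hax
      rw [ha] at this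
      exact this.trans hy.1
    have hm := fun n => (g⁻¹ ^ n).mono.monotone
    have h1 := sum_edist_le_eVariationOn (fun x => Real.log (deriv (g ^ N).toFun x))
      (u := fun m => (g⁻¹ ^ m) y) (v := fun m => (g⁻¹ ^ m) x) (fun m => ⟨hm m hy.2, by
        rw [pow_succ, mul_apply]
        refine hm m ?_
        have := g⁻¹.mono.monotone hy.1
        rwa [inv_apply_self] at this⟩) N
    have h2 : Icc ((g⁻¹ ^ 0) y) ((g⁻¹ ^ N) y) ⊆ Icc a (a + 1) := by
      refine Icc_subset_Icc (by simpa using hay) ?_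
      have h3 := hm N (hy.2.trans hxa.le)
      rwa [lift, pow_apply_eq_self hai] at h3
    replace h1 := h1.trans (eVariationOn.mono _ h2)
    rw [eVariationOn_log_deriv, ← ENNReal.ofReal_toReal (eLogVar_ne_top _)] at h1
    simp only [edist_dist, Real.dist_eq] at h1
    rw [← ENNReal.ofReal_sum_of_nonneg fun _ _ => abs_nonneg _,
      ENNReal.ofReal_le_ofReal_iff ENNReal.toReal_nonneg] at h1
    refine le_trans ?_ h1
    rw [Finset.sum_sub_distrib, ← Finset.sum_range_reflect (fun m => A (m + 1)),
      ← Finset.sum_sub_distrib]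
    refine (Finset.abs_sum_le_sum_abs _ _).trans (Finset.sum_le_sum fun m hm => ?_)
    have hmN := Finset.mem_range.1 hm
    rw [log_deriv_pow_inv_pow g hmN.le, log_deriv_pow_inv_pow g hmN.le,
      show N - 1 - m + 1 = N - m by omega]
    refine le_of_eq (congrArg _ ?_)
    simp only [A, B]
    ring
  have h3 := (((tendsto_add_atTop_iff_nat 1).2 hA).sub hB).cesaro.abs
  have h4 : |Real.log (field g y) - Real.log (field g x) -
      (Real.log (field g⁻¹ y) - Real.log (field g⁻¹ x))| ≤ 0 := by
    refine le_of_tendsto_of_tendsto' h3 ((asympVarVanishesC_iff g).1 hv) fun N => ?_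
    rw [abs_mul, abs_of_nonneg (by positivity : (0 : ℝ) ≤ (N : ℝ)⁻¹), mul_comm, ← div_eq_mul_inv]
    exact div_le_div_of_nonneg_right (hle N) (by positivity)
  exact sub_eq_zero.1 (abs_nonpos_iff.1 h4)

theorem field_inv_of_lt (h : Tame g) (hv : AsympVarVanishesC g) (hx : g x < x) :
    field g⁻¹ x = -field g x := by
  have hgx : g⁻¹ (g x) ≠ g x := by
    rw [inv_apply_self]
    exact hx.ne'
  have hi1 := h.integral_inv_field hx.ne
  have hi2 := h.inv.integral_inv_field hgx
  rw [inv_apply_self] at hi2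
  have hneg : ∀ y ∈ Icc (g x) x, field g y < 0 ∧ 0 < field g⁻¹ y := by
    intro y hy
    have h1 : g y < y := by
      have h2 := apply_ne_of_mem_uIcc hx.ne (by rwa [uIcc_of_ge hx.le])
      exact lt_of_le_of_ne ((g.mono.monotone hy.2).trans hy.1) h2
    refine ⟨h.field_neg h1, h.inv.field_pos ?_⟩
    have := g⁻¹.mono h1
    rwa [inv_apply_self] at this
  have hxI : x ∈ Icc (g x) x := ⟨hx.le, le_rfl⟩
  obtain ⟨hx1, hx2⟩ := hneg x hxI
  have hκ : ∀ y ∈ Icc (g x) x, (field g⁻¹ y)⁻¹ =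
      (field g x / field g⁻¹ x) * (field g y)⁻¹ := by
    intro y hy
    obtain ⟨hy1, hy2⟩ := hneg y hy
    have h1 := h.log_field_sub_log_field_inv hv hx hy
    rw [← Real.log_div hy1.ne hx1.ne, ← Real.log_div hy2.ne' hx2.ne'] at h1
    have h2 := Real.log_injOn_pos (div_pos_of_neg_of_neg hy1 hx1) (div_pos hy2 hx2) h1
    have := hx1.ne
    have := hx2.ne'
    have := hy1.ne
    have := hy2.ne'
    field_simp at h2 ⊢
    linarith
  rw [intervalIntegral.integral_congr (g := fun y => (field g x / field g⁻¹ x) * (field g y)⁻¹)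
    (fun y hy => hκ y (by rwa [uIcc_of_le hx.le] at hy)), intervalIntegral.integral_const_mul,
    intervalIntegral.integral_symm, hi1, mul_neg, mul_one] at hi2
  have := hx2.ne'
  field_simp at hi2
  linarith

/-- If the asymptotic variation vanishes then the two generating vector fields agree. -/
theorem field_inv (h : Tame g) (hv : AsympVarVanishesC g) (x : ℝ) :
    field g⁻¹ x = -field g x := by
  rcases lt_trichotomy (g x) x with hx | hx | hx
  · exact h.field_inv_of_lt hv hx
  · rw [field_eq_zero hx, field_eq_zero (inv_apply_eq_self.2 hx), neg_zero]
  · have h1 := h.inv.field_inv_of_lt hv.inv (x := x) (by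
      simpa using g⁻¹.mono hx)
    rw [inv_inv] at h1
    rw [h1, neg_neg]

end Tame

end CircleLift

namespace CircleLift

variable {g F : CircleLift} {x x₀ : ℝ} {P : ℝ → ℝ} {M : ℕ}

theorem FieldGerm.symbolOn (h : FieldGerm g x₀ P M) :
    ∃ ε : ℝ, 0 < ε ∧ ε ≤ 1 ∧ ∀ m, SymbolOn (Ioo 0 ε) m M fun x => field g (x₀ + x) - P x := by
  obtain ⟨ε, X, h0, h1, h2, h3, -⟩ := h
  exact ⟨ε, h0, h1, fun m => (h3 m).congr (symbolDomain_Ioo h1) fun x hx => by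
    simp only [(h2 x hx).2.1.field_eq]⟩

namespace Tame

theorem contDiff_field (h : Tame g) (hv : AsympVarVanishesC g) :
    ContDiff ℝ (⊤ : ℕ∞) (field g) := by
  refine contDiff_infty.2 fun m => contDiff_iff_contDiffAt.2 fun x₀ => ?_
  by_cases hx : g x₀ ≠ x₀
  · exact (h.contDiffAt_field hx).of_le (by exact_mod_cast le_top)
  rw [not_not] at hx
  obtain ⟨c, k, hc, hk, ho⟩ := h.exists_order x₀ hx
  obtain ⟨P, hP, hP0, hr, hl⟩ := ho.exists_fieldGerm hc hk (m + 2)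
  have hr' : ∃ ε : ℝ, 0 < ε ∧ ε ≤ 1 ∧ ∀ j,
      SymbolOn (Ioo 0 ε) j (m + 2 : ℕ) fun x => field g (x₀ + x) - P x := by
    rcases hr with hr | hr
    · exact hr.symbolOn
    · obtain ⟨ε, h0, h1, h2⟩ := hr.symbolOn
      have hD := symbolDomain_Ioo h1
      exact ⟨ε, h0, h1, fun j => ((h2 j).neg hD).congr hD fun x _ => by
        simp only [h.field_inv hv]
        ring⟩
  have hl' : ∃ ε : ℝ, 0 < ε ∧ ε ≤ 1 ∧ ∀ j,
      SymbolOn (-Ioo 0 ε) j (m + 2 : ℕ) fun x => field g (x₀ + x) - P x := by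
    rcases hl with hl | hl
    · obtain ⟨ε, h0, h1, h2⟩ := hl.symbolOn
      have hD := symbolDomain_Ioo h1
      refine ⟨ε, h0, h1, fun j => (((h2 j).comp_neg hD).neg hD.neg).congr hD.neg fun x _ => ?_⟩
      simp only [h.field_reflect, neg_neg, neg_add]
      ring
    · obtain ⟨ε, h0, h1, h2⟩ := hl.symbolOn
      have hD := symbolDomain_Ioo h1
      refine ⟨ε, h0, h1, fun j => ((h2 j).comp_neg hD).congr hD.neg fun x _ => ?_⟩
      simp only [h.inv.field_reflect, h.field_inv hv, neg_neg, neg_add]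
  obtain ⟨ε₁, h1, h1', hs1⟩ := hr'
  obtain ⟨ε₂, h2, h2', hs2⟩ := hl'
  have hε : 0 < min ε₁ ε₂ := lt_min h1 h2
  have h3 : ContDiffOn ℝ m (fun x => field g (x₀ + x) - P x) (Ioo (-min ε₁ ε₂) (min ε₁ ε₂)) := by
    refine SymbolOn.contDiffOn_of_punctured (N := (m + 2 : ℕ)) hε ?_ ?_ (by push_cast; rfl)
    · refine ((hs1 (m + 1)).union (hs2 (m + 1)) isOpen_Ioo isOpen_Ioo.neg).mono_set ?_
      rintro x ⟨hx1, hx2⟩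
      rcases lt_or_gt_of_ne (show x ≠ 0 from hx2) with hx3 | hx3
      · right
        rw [Set.mem_neg]
        exact ⟨by linarith, by linarith [hx1.1, min_le_right ε₁ ε₂]⟩
      · left
        exact ⟨hx3, hx1.2.trans_le (min_le_left _ _)⟩
    · simp [hP0, field_eq_zero hx]
  have h4 : ContDiffAt ℝ m (fun x => field g (x₀ + x)) 0 := by
    have h5 := (h3.contDiffAt (isOpen_Ioo.mem_nhds ⟨by linarith, hε⟩)).add
      ((contDiff_infty.1 hP m).contDiffAt)
    simpa using h5
  have h5 : ContDiffAt ℝ m (fun x => x - x₀) x₀ := contDiffAt_id.sub contDiffAt_const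
  have h6 := ContDiffAt.comp (g := fun x => field g (x₀ + x)) (f := fun x => x - x₀) x₀
    (by simpa using h4) h5
  refine h6.congr_of_eventuallyEq (.of_forall fun x => ?_)
  simp

end Tame

end CircleLift

/-! ### Flows of vector fields on the line -/

section Flow

open Topology NNReal

/-- Families `w x t` of functions of `x`, all of whose `x`-derivatives up to order `m` exist and
are jointly continuous. -/
def SmoothFamily : ℕ → (ℝ → ℝ → ℝ) → Prop
  | 0, w => Continuous (Function.uncurry w)
  | m + 1, w => Continuous (Function.uncurry w) ∧
      ∃ w', (∀ x t, HasDerivAt (fun x => w x t) (w' x t) x) ∧ SmoothFamily m w'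

namespace SmoothFamily

variable {m : ℕ} {w v : ℝ → ℝ → ℝ}

theorem continuous (h : SmoothFamily m w) : Continuous (Function.uncurry w) := by
  cases m with
  | zero => exact h
  | succ m => exact h.1

theorem of_succ (h : SmoothFamily (m + 1) w) : SmoothFamily m w := by
  induction m generalizing w with
  | zero => exact h.1
  | succ m ih =>
    obtain ⟨h1, w', h2, h3⟩ := h
    exact ⟨h1, w', h2, ih h3⟩

theorem add (hw : SmoothFamily m w) (hv : SmoothFamily m v) :
    SmoothFamily m fun x t => w x t + v x t := by
  induction m generalizing w v with
  | zero => exact Continuous.add hw hv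
  | succ m ih =>
    obtain ⟨h1, w', h2, h3⟩ := hw
    obtain ⟨h1', v', h2', h3'⟩ := hv
    exact ⟨h1.add h1', _, fun x t => (h2 x t).add (h2' x t), ih h3 h3'⟩

theorem mul (hw : SmoothFamily m w) (hv : SmoothFamily m v) :
    SmoothFamily m fun x t => w x t * v x t := by
  induction m generalizing w v with
  | zero => exact Continuous.mul hw hv
  | succ m ih =>
    have hw0 := hw.of_succ
    have hv0 := hv.of_succ
    obtain ⟨h1, w', h2, h3⟩ := hw
    obtain ⟨h1', v', h2', h3'⟩ := hv
    exact ⟨h1.mul h1', _, fun x t => (h2 x t).mul (h2' x t), (ih h3 hv0).add (ih hw0 h3')⟩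

theorem comp {f : ℝ → ℝ} (hf : ContDiff ℝ (⊤ : ℕ∞) f) (hw : SmoothFamily m w) :
    SmoothFamily m fun x t => f (w x t) := by
  induction m generalizing w f with
  | zero => exact hf.continuous.comp hw
  | succ m ih =>
    have hw0 := hw.of_succ
    obtain ⟨h1, w', h2, h3⟩ := hw
    refine ⟨hf.continuous.comp h1, _, fun x t =>
      ((hf.differentiable (by simp)) _).hasDerivAt.comp x (h2 x t), (ih ?_ hw0).mul h3⟩
    exact (contDiff_infty_iff_deriv.1 hf).2

theorem integral (hw : SmoothFamily m w) :
    SmoothFamily m fun x t => ∫ s in (0 : ℝ)..t, w x s := by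
  induction m generalizing w with
  | zero => exact intervalIntegral.continuous_parametric_primitive_of_continuous hw
  | succ m ih =>
    obtain ⟨h1, w', h2, h3⟩ := hw
    refine ⟨intervalIntegral.continuous_parametric_primitive_of_continuous h1, _, fun x t => ?_,
      ih h3⟩
    have hc := h3.continuous
    have hcx : ∀ {u : ℝ → ℝ → ℝ}, Continuous (Function.uncurry u) → ∀ x, Continuous (u x) :=
      fun hu x => hu.comp (Continuous.prodMk_right x)
    obtain ⟨C, hC⟩ := ((isCompact_closedBall x 1).prod (isCompact_uIcc (a := 0) (b := t)))
      |>.exists_bound_of_continuousOn hc.continuousOn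
    refine (intervalIntegral.hasDerivAt_integral_of_dominated_loc_of_deriv_le
      (F := w) (F' := w') (bound := fun _ => C)
      (Metric.closedBall_mem_nhds x one_pos)
      (.of_forall fun y => (hcx h1 y).aestronglyMeasurable)
      ((hcx h1 x).intervalIntegrable _ _) (hcx hc x).aestronglyMeasurable
      (.of_forall fun s hs y hy => hC (y, s) ⟨hy, uIoc_subset_uIcc hs⟩)
      (by simp) (.of_forall fun s _ y _ => h2 y s)).2

theorem contDiff (hw : ∀ m, SmoothFamily m w) (t : ℝ) :
    ContDiff ℝ (⊤ : ℕ∞) fun x => w x t := by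
  refine contDiff_infty.2 fun m => ?_
  have := hw m
  clear hw
  induction m generalizing w with
  | zero =>
    have h0 : Continuous (Function.uncurry w) := this
    exact contDiff_zero.2 (Continuous.comp h0 (Continuous.prodMk_left t))
  | succ m ih =>
    obtain ⟨h1, w', h2, h3⟩ := this
    rw [show ((m + 1 : ℕ) : WithTop ℕ∞) = m + 1 by simp, contDiff_succ_iff_deriv]
    refine ⟨fun x => (h2 x t).differentiableAt, by simp, ?_⟩
    rw [show deriv (fun x => w x t) = fun x => w' x t from funext fun x => (h2 x t).deriv]
    exact ih h3

end SmoothFamily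

/-- The orbits `φ x` of the flow of the vector field `X`. -/
structure IsFlow (X : ℝ → ℝ) (φ : ℝ → ℝ → ℝ) : Prop where
  zero : ∀ x, φ x 0 = x
  hasDerivAt : ∀ x t, HasDerivAt (φ x) (X (φ x t)) t
  continuous : Continuous (Function.uncurry φ)

theorem exists_isFlow {X : ℝ → ℝ} {L K : ℝ≥0} (hL : ∀ x, |X x| ≤ L) (hK : LipschitzWith K X) :
    ∃ φ, IsFlow X φ := by
  have h1 : ∀ n : ℕ, ∃ α : ℝ × ℝ → ℝ, (∀ x ∈ Metric.closedBall (0 : ℝ) n, α (x, 0) = x ∧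
      ∀ t ∈ Icc (-n : ℝ) n,
        HasDerivWithinAt (fun s => α (x, s)) (X (α (x, t))) (Icc (-n : ℝ) n) t) ∧
      ContinuousOn α (Metric.closedBall (0 : ℝ) n ×ˢ Icc (-n : ℝ) n) := by
    intro n
    have h2 : IsPicardLindelof (fun _ => X) (⟨0, by simp⟩ : Icc (-n : ℝ) n) (0 : ℝ)
        ((n : ℝ≥0) + L * n) n L K :=
      .of_time_independent (fun x _ => hL x) hK.lipschitzOnWith (by simp)
    simpa using h2.exists_forall_mem_closedBall_eq_hasDerivWithinAt_continuousOn
  choose α hα hαc using h1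
  have h2 : ∀ (n : ℕ) (x : ℝ), x ∈ Metric.closedBall (0 : ℝ) n → ∀ t ∈ Ioo (-n : ℝ) n,
      HasDerivAt (fun s => α n (x, s)) (X (α n (x, t))) t := fun n x hx t ht =>
    ((hα n x hx).2 t (Ioo_subset_Icc_self ht)).hasDerivAt (Icc_mem_nhds ht.1 ht.2)
  have h3 : ∀ n N : ℕ, n ≤ N → ∀ x : ℝ, x ∈ Metric.closedBall (0 : ℝ) n →
      ∀ t : ℝ, t ∈ Ioo (-n : ℝ) n → α n (x, t) = α N (x, t) := by
    intro n N hn x hx t ht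
    have hnN : (n : ℝ) ≤ N := by exact_mod_cast hn
    have hx' := Metric.closedBall_subset_closedBall hnN hx
    exact ODE_solution_unique_of_mem_Ioo (v := fun _ => X) (s := fun _ => univ) (t₀ := 0)
      (f := fun t => α n (x, t)) (g := fun t => α N (x, t))
      (fun _ _ => hK.lipschitzOnWith) ⟨by linarith [ht.1, ht.2], by linarith [ht.1, ht.2]⟩
      (fun t ht => ⟨h2 n x hx t ht, trivial⟩)
      (fun t ht => ⟨h2 N x hx' t ⟨by linarith [ht.1], by linarith [ht.2]⟩, trivial⟩)
      ((hα n x hx).1.trans (hα N x hx').1.symm) ht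
  set ν : ℝ → ℝ → ℕ := fun x t => ⌈|x|⌉₊ + ⌈|t|⌉₊ + 1
  have h4 : ∀ (x t : ℝ) (N : ℕ), |x| < N → |t| < N → α (ν x t) (x, t) = α N (x, t) := by
    intro x t N hx ht
    have h5 : x ∈ Metric.closedBall (0 : ℝ) (ν x t) ∧ t ∈ Ioo (-(ν x t) : ℝ) (ν x t) := by
      have h6 := Nat.le_ceil |x|
      have h7 := Nat.le_ceil |t|
      have h8 : (ν x t : ℝ) = ⌈|x|⌉₊ + ⌈|t|⌉₊ + 1 := by simp [ν]
      have h9 : (0 : ℝ) ≤ ⌈|x|⌉₊ := by positivity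
      have h10 : (0 : ℝ) ≤ ⌈|t|⌉₊ := by positivity
      rw [h8]
      refine ⟨?_, abs_lt.1 (by linarith)⟩
      rw [mem_closedBall_zero_iff, Real.norm_eq_abs]
      linarith
    rcases le_total (ν x t) N with h | h
    · exact h3 _ _ h x h5.1 t h5.2
    · exact (h3 _ _ h x (by simpa using hx.le) t (abs_lt.1 ht)).symm
  refine ⟨fun (x t : ℝ) => α (ν x t) (x, t), fun x => ?_, fun x t => ?_, ?_⟩
  · exact (hα _ x (by
      have h6 := Nat.le_ceil |x|
      rw [mem_closedBall_zero_iff, Real.norm_eq_abs]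
      simp only [ν]
      push_cast
      linarith [show (0 : ℝ) ≤ ⌈|(0 : ℝ)|⌉₊ by positivity])).1
  · obtain ⟨N, hN⟩ := exists_nat_gt (max |x| |t|)
    have hx := (le_max_left _ _).trans_lt hN
    have ht := (le_max_right _ _).trans_lt hN
    have h5 := h2 N x (by simpa using hx.le) t (abs_lt.1 ht)
    rw [← h4 x t N hx ht] at h5
    refine h5.congr_of_eventuallyEq ?_
    filter_upwards [(continuous_abs.tendsto t).eventually (gt_mem_nhds ht)] with s hs
    exact h4 x s N hx hs
  · rw [continuous_iff_continuousAt]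
    rintro ⟨x, t⟩
    obtain ⟨N, hN⟩ := exists_nat_gt (max |x| |t|)
    have hx := (le_max_left _ _).trans_lt hN
    have ht := (le_max_right _ _).trans_lt hN
    have h5 := (hαc N).continuousAt (x := (x, t)) (prod_mem_nhds
      (mem_of_superset (Metric.isOpen_ball.mem_nhds (by simpa using hx))
        Metric.ball_subset_closedBall)
      (Icc_mem_nhds (abs_lt.1 ht).1 (abs_lt.1 ht).2))
    refine h5.congr ?_
    filter_upwards [prod_mem_nhds ((continuous_abs.tendsto x).eventually (gt_mem_nhds hx))
      ((continuous_abs.tendsto t).eventually (gt_mem_nhds ht))] with p hp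
    exact (h4 p.1 p.2 N hp.1 hp.2).symm

namespace IsFlow

variable {X : ℝ → ℝ} {φ : ℝ → ℝ → ℝ} {K : ℝ≥0}

theorem eq_of_hasDerivAt (h : IsFlow X φ) (hK : LipschitzWith K X) {γ : ℝ → ℝ}
    (hγ : ∀ t, HasDerivAt γ (X (γ t)) t) (t : ℝ) : γ t = φ (γ 0) t :=
  congrFun (ODE_solution_unique_univ (v := fun _ => X) (s := fun _ => univ) (t₀ := 0)
    (fun _ => hK.lipschitzOnWith) (fun t => ⟨hγ t, trivial⟩)
    (fun t => ⟨h.hasDerivAt _ t, trivial⟩) (h.zero _).symm) t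

theorem add (h : IsFlow X φ) (hK : LipschitzWith K X) (x s t : ℝ) :
    φ x (s + t) = φ (φ x s) t := by
  have := h.eq_of_hasDerivAt hK (γ := fun t => φ x (s + t))
    (fun t => (h.hasDerivAt x (s + t)).comp_const_add s t) t
  simpa using this

/-- A diffeomorphism preserving the vector field commutes with the flow. -/
theorem map (h : IsFlow X φ) (hK : LipschitzWith K X) {f : ℝ → ℝ} (hf : Differentiable ℝ f)
    (hfX : ∀ x, X (f x) = deriv f x * X x) (x t : ℝ) : f (φ x t) = φ (f x) t := by
  have := h.eq_of_hasDerivAt hK (γ := fun t => f (φ x t)) (fun t => by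
    rw [hfX]
    exact (hf _).hasDerivAt.comp t (h.hasDerivAt x t)) t
  simpa [h.zero] using this

theorem hasDerivAt_initial (h : IsFlow X φ) (hX : ContDiff ℝ (⊤ : ℕ∞) X) (x t : ℝ) :
    HasDerivAt (fun x => φ x t) (Real.exp (∫ s in (0 : ℝ)..t, deriv X (φ x s))) x := by
  have hdX : Continuous (deriv X) := hX.continuous_deriv (by simp)
  have hφ : ∀ x, Continuous (φ x) := fun x => h.continuous.comp (Continuous.prodMk_right x)
  set D : ℝ → ℝ → ℝ := fun y s => ∫ θ in (0 : ℝ)..1, deriv X (φ x s + θ * (φ y s - φ x s))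
  have hc : Continuous (Function.uncurry D) := by
    refine intervalIntegral.continuous_parametric_intervalIntegral_of_continuous'
      (f := fun p : ℝ × ℝ => fun θ => deriv X (φ x p.2 + θ * (φ p.1 p.2 - φ x p.2))) ?_ 0 1
    refine hdX.comp ?_
    have h1 : Continuous fun q : (ℝ × ℝ) × ℝ => φ x q.1.2 := (hφ x).comp (by fun_prop)
    have h2 : Continuous fun q : (ℝ × ℝ) × ℝ => φ q.1.1 q.1.2 := h.continuous.comp (by fun_prop)
    exact h1.add (continuous_snd.mul (h2.sub h1))
  have hD : ∀ y s, X (φ y s) - X (φ x s) = D y s * (φ y s - φ x s) := by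
    intro y s
    have h1 := intervalIntegral.integral_eq_sub_of_hasDerivAt (a := 0) (b := 1)
      (f := fun θ => X (φ x s + θ * (φ y s - φ x s)))
      (f' := fun θ => deriv X (φ x s + θ * (φ y s - φ x s)) * (φ y s - φ x s))
      (fun θ _ => ((hX.differentiable (by simp)) _).hasDerivAt.comp θ
        (((hasDerivAt_mul_const _).const_add _)))
      ((hdX.comp (by fun_prop)).mul continuous_const |>.intervalIntegrable _ _)
    rw [intervalIntegral.integral_mul_const] at h1
    simp only [one_mul, zero_mul, add_zero, add_sub_cancel] at h1
    exact h1.symm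
  have hsol : ∀ y, φ y t - φ x t = (y - x) * Real.exp (∫ s in (0 : ℝ)..t, D y s) := by
    intro y
    have hcy : Continuous (D y) := hc.comp (Continuous.prodMk_right y)
    set u : ℝ → ℝ := fun t => (φ y t - φ x t) * Real.exp (-∫ s in (0 : ℝ)..t, D y s)
    have h1 : ∀ t, HasDerivAt u 0 t := by
      intro t
      have h2 : HasDerivAt (fun t => Real.exp (-∫ s in (0 : ℝ)..t, D y s))
          (Real.exp (-∫ s in (0 : ℝ)..t, D y s) * -D y t) t :=
        (intervalIntegral.integral_hasDerivAt_right (hcy.intervalIntegrable 0 t)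
        (hcy.stronglyMeasurableAtFilter _ _) hcy.continuousAt).neg.exp
      refine (((h.hasDerivAt y t).sub (h.hasDerivAt x t)).mul h2).congr_deriv ?_
      rw [hD, Pi.sub_apply]
      ring
    have h2 := is_const_of_deriv_eq_zero (fun t => (h1 t).differentiableAt)
      (fun t => (h1 t).deriv) t 0
    simp only [u, h.zero, intervalIntegral.integral_same, Real.exp_zero,
      Real.exp_neg, inv_one, mul_one] at h2
    rw [← h2, mul_assoc, inv_mul_cancel₀ (Real.exp_pos _).ne', mul_one]
  have hDx : ∀ s, D x s = deriv X (φ x s) := fun s => by simp [D]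
  rw [hasDerivAt_iff_tendsto_slope]
  have h1 : Tendsto (fun y => Real.exp (∫ s in (0 : ℝ)..t, D y s)) (𝓝 x)
      (𝓝 (Real.exp (∫ s in (0 : ℝ)..t, D x s))) :=
    (Real.continuous_exp.comp
      (intervalIntegral.continuous_parametric_intervalIntegral_of_continuous' hc 0 t)).tendsto x
  simp only [hDx] at h1
  refine (h1.mono_left nhdsWithin_le_nhds).congr' ?_
  filter_upwards [self_mem_nhdsWithin] with y hy
  rw [slope_def_field, hsol, mul_div_cancel_left₀ _ (sub_ne_zero.2 hy)]

theorem smoothFamily (h : IsFlow X φ) (hX : ContDiff ℝ (⊤ : ℕ∞) X) (m : ℕ) :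
    SmoothFamily m φ := by
  induction m with
  | zero => exact h.continuous
  | succ m ih =>
    exact ⟨h.continuous, _, h.hasDerivAt_initial hX,
      ((ih.comp (contDiff_infty_iff_deriv.1 hX).2).integral).comp Real.contDiff_exp⟩

end IsFlow

end Flow

/-! ### Roots inside the flow -/

namespace IsFlow

variable {X : ℝ → ℝ} {φ : ℝ → ℝ → ℝ} {K : NNReal}

theorem apply_of_eq_zero (h : IsFlow X φ) (hK : LipschitzWith K X) {x : ℝ} (hx : X x = 0)
    (t : ℝ) : φ x t = x :=
  (h.eq_of_hasDerivAt hK (γ := fun _ => x) (fun t => by simpa [hx] using hasDerivAt_const t x)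
    t).symm

theorem vectorField_ne_zero (h : IsFlow X φ) (hK : LipschitzWith K X) {x : ℝ} (hx : X x ≠ 0)
    (t : ℝ) : X (φ x t) ≠ 0 := by
  intro h0
  have h1 := h.apply_of_eq_zero hK h0 (-t)
  rw [← h.add hK, add_neg_cancel, h.zero] at h1
  exact hx (h1 ▸ h0)

/-- The time needed to flow from `x` to `y` is `∫ 1 / X`. -/
theorem apply_eq_of_integral_inv_eq (h : IsFlow X φ) (hK : LipschitzWith K X) {x y t : ℝ}
    (hX : ∀ z ∈ uIcc x y, X z ≠ 0) (ht : ∫ z in x..y, (X z)⁻¹ = t) : φ x t = y := by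
  have hXc := hK.continuous
  have hc : Continuous (φ x) := h.continuous.comp (Continuous.prodMk_right x)
  have hne : ∀ s, X (φ x s) ≠ 0 := h.vectorField_ne_zero hK (hX x left_mem_uIcc)
  have h1 : ∫ z in x..φ x t, (X z)⁻¹ = t := by
    have h2 := intervalIntegral.integral_comp_mul_deriv' (a := 0) (b := t) (f := φ x)
      (f' := fun s => X (φ x s)) (g := fun z => (X z)⁻¹) (fun s _ => h.hasDerivAt x s)
      (hXc.comp hc).continuousOn (hXc.continuousOn.inv₀ (by
        rintro _ ⟨s, -, rfl⟩
        exact hne s))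
    rw [h.zero] at h2
    rw [← h2]
    simp [hne]
  have hX' : ∀ z ∈ uIcc x (φ x t), X z ≠ 0 := by
    intro z hz
    have h3 := intermediate_value_uIcc (a := 0) (b := t) hc.continuousOn
    rw [h.zero] at h3
    obtain ⟨s, -, rfl⟩ := h3 hz
    exact hne s
  have hInt : ∀ {a b : ℝ}, (∀ z ∈ uIcc a b, X z ≠ 0) →
      IntervalIntegrable (fun z => (X z)⁻¹) MeasureTheory.volume a b := fun hab =>
    (hXc.continuousOn.inv₀ hab).intervalIntegrable
  by_contra hyt
  have hX2 : ∀ z ∈ uIcc (φ x t) y, X z ≠ 0 := by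
    intro z hz
    rcases uIcc_subset_uIcc_union_uIcc (b := x) hz with h4 | h4
    · exact hX' z (by rwa [uIcc_comm])
    · exact hX z h4
  have h0 : ∫ z in φ x t..y, (X z)⁻¹ = 0 := by
    rw [← intervalIntegral.integral_interval_sub_left (hInt hX) (hInt hX'), ht, h1, sub_self]
  have hrolle : ∀ {a b : ℝ}, a < b → (∀ z ∈ Icc a b, X z ≠ 0) → ∫ z in a..b, (X z)⁻¹ ≠ 0 := by
    intro a b hab hne' h5
    obtain ⟨z, hz, hz'⟩ := exists_hasDerivAt_eq_zero (f := fun u => ∫ z in a..u, (X z)⁻¹)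
      (f' := fun u => (X u)⁻¹) hab
      (intervalIntegral.continuousOn_primitive_interval
        ((hXc.continuousOn.inv₀ (by rwa [uIcc_of_le hab.le])).integrableOn_compact isCompact_uIcc)
        |>.mono (by rw [uIcc_of_le hab.le])) (by simp [h5]) fun u hu => by
        have hu' := Ioo_subset_Icc_self hu
        refine intervalIntegral.integral_hasDerivAt_right (hInt fun z hz => hne' z ?_)
          (hXc.measurable.inv.stronglyMeasurable.stronglyMeasurableAtFilter)
          (hXc.continuousAt.inv₀ (hne' u hu'))
        rw [uIcc_of_le hu'.1] at hz
        exact Icc_subset_Icc_right hu'.2 hz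
    exact inv_ne_zero (hne' z (Ioo_subset_Icc_self hz)) hz'
  rcases lt_or_gt_of_ne hyt with hlt | hlt
  · exact hrolle hlt (by rwa [uIcc_of_le hlt.le] at hX2) h0
  · exact hrolle hlt (by rwa [uIcc_of_ge hlt.le] at hX2) (by
      rw [intervalIntegral.integral_symm, h0, neg_zero])

end IsFlow

namespace CircleLift

variable {g F : CircleLift}

theorem deriv_pow_of_fixed {x : ℝ} (hx : g x = x) (n : ℕ) :
    deriv (g ^ n).toFun x = deriv g.toFun x ^ n := by
  induction n with
  | zero => rw [pow_zero, pow_zero]; exact deriv_id x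
  | succ n ih => rw [pow_succ, deriv_mul, hx, ih, pow_succ]

theorem _root_.AsympVarVanishesC.deriv_eq_one (hv : AsympVarVanishesC g) {x : ℝ} (hx : g x = x) :
    deriv g.toFun x = 1 := by
  have h1 : ∀ n : ℕ, 1 ≤ n → |Real.log (deriv g.toFun x)| ≤ (g ^ n).eLogVar.toReal / n := by
    intro n hn
    have hn0 : (0 : ℝ) < n := by exact_mod_cast hn
    obtain ⟨y, hy, hy'⟩ := exists_deriv_eq_slope (g ^ n).toFun (lt_add_one x)
      (g ^ n).smooth.continuous.continuousOn (g ^ n).differentiable.differentiableOn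
    rw [(g ^ n).lift, add_sub_cancel_left, add_sub_cancel_left, div_one] at hy'
    have h2 := eVariationOn.edist_le (fun x => Real.log (deriv (g ^ n).toFun x))
      (left_mem_Icc.2 (le_add_of_nonneg_right zero_le_one)) (Ioo_subset_Icc_self hy)
    rw [eVariationOn_log_deriv, hy', Real.log_one, deriv_pow_of_fixed hx, Real.log_pow,
      edist_dist, ENNReal.ofReal_le_iff_le_toReal (eLogVar_ne_top _), Real.dist_eq, sub_zero,
      abs_mul, abs_of_pos hn0] at h2
    rwa [le_div_iff₀ hn0, mul_comm]
  have h2 := ge_of_tendsto ((asympVarVanishesC_iff g).1 hv)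
    ((eventually_ge_atTop 1).mono h1)
  have h3 := abs_nonpos_iff.1 h2
  have h4 := g.deriv_pos x
  rw [← Real.exp_log h4, h3, Real.exp_zero]

theorem _root_.AsympVarVanishesC.tame (hv : AsympVarVanishesC g) (hfix : ∃ x, g x = x)
    (hiti : ∀ x, ¬ ITIFixedPoint g.toFun x) : Tame g := by
  classical
  refine ⟨hfix, fun x hx => ?_⟩
  set u : ℝ → ℝ := fun y => g y - y - (0 : ℝ)
  have hu := g.contDiff_sub_id 0
  have h1 : ∃ k, iteratedDeriv k u x ≠ 0 := by
    by_contra! h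
    exact hiti x ((itiFixedPoint_iff g x).2 ⟨0, fun k => by simpa [u] using h k⟩)
  obtain ⟨N, hN, hmin⟩ : ∃ N, iteratedDeriv N u x ≠ 0 ∧ ∀ k < N, iteratedDeriv k u x = 0 :=
    ⟨Nat.find h1, Nat.find_spec h1, fun k hk => not_not.1 (Nat.find_min h1 hk)⟩
  have h2 := hu.sub_monomial_isBigO hmin
  have hN2 : 2 ≤ N := by
    rcases N with _ | _ | N
    · simp [u, hx] at hN
    · refine absurd ?_ hN
      have := (((g.differentiable x).hasDerivAt.sub (hasDerivAt_id x)).sub_const 0).deriv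
      rw [hv.deriv_eq_one hx, sub_self] at this
      rw [zero_add, iteratedDeriv_one]
      exact this
    · omega
  refine ⟨iteratedDeriv N u x / N.factorial, N - 1, div_ne_zero hN (by positivity), by omega, ?_⟩
  unfold HasOrder
  rw [show N - 1 + 1 = N by omega, show N - 1 + 2 = N + 1 by omega]
  simpa [u] using h2

/-- A diffeomorphism without flat fixed point has roots of all orders, commuting with everything
that commutes with it. -/
theorem Tame.exists_root (h : Tame g) (hv : AsympVarVanishesC g) {q : ℕ} (hq : 1 ≤ q) :
    ∃ r : CircleLift, r ^ q = g ∧ (∀ F, Commute F g → Commute r F) ∧ ∀ x, g x = x → r x = x := by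
  have hX := h.contDiff_field hv
  have hper : Function.Periodic (field g) 1 := fun x => by
    have h1 := h.field_map (commute_translation_one g).symm x
    rwa [deriv_translation, one_mul, translation_apply] at h1
  have hdper : Function.Periodic (deriv (field g)) 1 := fun x => by
    rw [← deriv_comp_add_const, show (fun x => field g (x + 1)) = field g from funext hper]
  have hbdd : ∀ {f : ℝ → ℝ}, Continuous f → Function.Periodic f 1 →
      ∃ C : NNReal, ∀ x, ‖f x‖ ≤ C := by
    intro f hf hp
    obtain ⟨C, hC⟩ := (hp.isBounded_of_continuous one_ne_zero hf).exists_norm_le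
    exact ⟨C.toNNReal, fun x => (hC _ (mem_range_self x)).trans (Real.le_coe_toNNReal C)⟩
  obtain ⟨L, hL⟩ := hbdd hX.continuous hper
  obtain ⟨K, hK'⟩ := hbdd (hX.continuous_deriv (by simp)) hdper
  have hK : LipschitzWith K (field g) :=
    lipschitzWith_of_nnnorm_deriv_le (hX.differentiable (by simp)) fun x => hK' x
  obtain ⟨φ, hφ⟩ := exists_isFlow hL hK
  have hcomm : ∀ F, Commute F g → ∀ x t, F (φ x t) = φ (F x) t := fun F hF x t =>
    hφ.map hK F.differentiable (h.field_map hF) x t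
  have hfixed : ∀ x, g x = x → ∀ t, φ x t = x := fun x hx t =>
    hφ.apply_of_eq_zero hK (field_eq_zero hx) t
  have hone : ∀ x, φ x 1 = g x := by
    intro x
    by_cases hx : g x = x
    · rw [hfixed x hx, hx]
    · exact hφ.apply_eq_of_integral_inv_eq hK
        (fun z hz => h.field_ne_zero (apply_ne_of_mem_uIcc hx hz)) (h.integral_inv_field hx)
  set r : CircleLift := ofDerivPos (fun x => φ x (1 / q))
    (SmoothFamily.contDiff (hφ.smoothFamily hX) _)
    (fun x => by
      rw [(hφ.hasDerivAt_initial hX x _).deriv]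
      exact Real.exp_pos _)
    (fun x => by
      simpa [translation_apply] using (hcomm _ (commute_translation_one g).symm x (1 / q)).symm)
  have hr : ∀ x, r x = φ x (1 / q) := fun x => ofDerivPos_apply ..
  refine ⟨r, ?_, fun F hF => ?_, fun x hx => by rw [hr, hfixed x hx]⟩
  · have hpow : ∀ (n : ℕ) (x : ℝ), (r ^ n) x = φ x (n / q) := by
      intro n
      induction n with
      | zero => simp [hφ.zero]
      | succ n ih =>
        intro x
        rw [pow_succ, mul_apply, hr, ih, ← hφ.add hK]
        congr 1
        push_cast
        ring
    have hq0 : (q : ℝ) ≠ 0 := by positivity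
    ext x
    rw [hpow, div_self hq0, hone]
  · ext x
    rw [mul_apply, mul_apply, hr, hr, hcomm F hF]

end CircleLift

namespace CircleLift

theorem not_itiFixedPoint_of_conj {F Φ : CircleLift} (h : ∀ x, ¬ ITIFixedPoint F.toFun x) (x : ℝ) :
    ¬ ITIFixedPoint (Φ * F * Φ⁻¹).toFun x := fun hx => h _ <| by
  have := hx.conj Φ⁻¹
  rwa [show Φ⁻¹ * (Φ * F * Φ⁻¹) * Φ⁻¹⁻¹ = F by group] at this

theorem not_itiFixedPoint_mul_translation {F : CircleLift}
    (h : ∀ x, ¬ ITIFixedPoint F.toFun x) (m : ℤ) (x : ℝ) :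
    ¬ ITIFixedPoint (F * translation m).toFun x := fun hx => h x <| by
  have h1 : F = F * translation m * translation (-m : ℤ) := by
    rw [mul_assoc, translation_mul]
    ext y
    simp
  have h2 : F = translation (-m : ℤ) * (F * translation m) := by
    rw [(commute_translation_int _ _).symm.eq]
    exact h1
  rw [h2]
  exact (itiFixedPoint_translation _ _).mul hx

/-- The normal form when `F ^ q` has no point of infinite tangency to a translation. -/
theorem exists_normal_form_of_not_iti (F : CircleLift) {p m : ℤ} {q : ℕ} (hq : 1 ≤ q)
    (hvar : AsympVarVanishesC F) (hfix : ∃ x, (F ^ q) x = x + (p + q * m : ℤ))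
    (hiti : ∀ x, ¬ ITIFixedPoint (F ^ q).toFun x) :
    ∃ Φ G : CircleLift, Φ * F * Φ⁻¹ = G * translation (p / q) ∧ G 0 = m ∧
      (∀ x, ¬ ITIFixedPoint G.toFun x) ∧ Commute G (translation (p / q)) ∧
      AsympVarVanishesC G := by
  have hq0 : (q : ℝ) ≠ 0 := by positivity
  set P : ℤ := p + q * m
  have htr : ∀ n : ℤ, (translation (n : ℝ))⁻¹ = translation ((-n : ℤ) : ℝ) := fun n => by
    rw [inv_translation]
    push_cast
    rfl
  set g := F ^ q * translation ((-P : ℤ) : ℝ)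
  have hvg : AsympVarVanishesC g := (hvar.pow hq).mul_translation _
  have hFg : Commute F g := ((Commute.refl F).pow_right q).mul_right (commute_translation_int _ _)
  have hg : ∀ x, g x = x ↔ (F ^ q) x = x + P := fun x => by
    simp only [g]
    rw [(commute_translation_int _ _).eq, mul_apply, translation_apply]
    push_cast
    constructor <;> intro h <;> linarith
  obtain ⟨x₀, hx₀⟩ := hfix
  have hx₀g := (hg x₀).2 hx₀
  have hitig : ∀ x, ¬ ITIFixedPoint g.toFun x := not_itiFixedPoint_mul_translation hiti _
  obtain ⟨r, hrg, hr, hrfix⟩ := (hvg.tame ⟨x₀, hx₀g⟩ hitig).exists_root hvg hq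
  have hrF : Commute r F := hr F hFg
  set σ := r⁻¹ * F
  have hrσ : Commute r σ := (Commute.refl r).inv_right.mul_right hrF
  have hFσ : r * σ = F := mul_inv_cancel_left r F
  have hσ : σ ^ q = translation (P : ℝ) := by
    rw [hrF.inv_left.mul_pow, inv_pow, hrg]
    simp only [g]
    rw [mul_inv_rev, htr, neg_neg, inv_mul_cancel_right]
  obtain ⟨Φ, hΦ, hΦ0⟩ := exists_conj_translation σ hq hσ x₀ 0
  have hP : translation ((P : ℝ) / q) = translation (m : ℝ) * translation (p / q) := by
    rw [translation_mul]
    congr 1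
    simp only [P]
    push_cast
    field_simp
    ring
  set s := Φ * r * Φ⁻¹
  have hsq : s ^ q = Φ * g * Φ⁻¹ := by rw [conj_pow, hrg]
  have hsT : Commute s (translation ((P : ℝ) / q)) := by
    rw [← hΦ]
    exact (Commute.conj_iff Φ).2 hrσ
  have hsm := commute_translation_int s m
  have hsp : Commute s (translation (p / q)) := by
    have h1 : translation ((p : ℝ) / q) = (translation (m : ℝ))⁻¹ * translation ((P : ℝ) / q) := by
      rw [hP, inv_mul_cancel_left]
    rw [h1]
    exact hsm.inv_right.mul_right hsT
  have hvs : AsympVarVanishesC s := by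
    refine AsympVarVanishesC.of_pow hq ?_
    rw [hsq]
    exact hvg.conj Φ
  refine ⟨Φ, s * translation m, ?_, ?_, ?_, ?_, hvs.mul_translation m⟩
  · rw [mul_assoc s, ← hP, ← hΦ, ← hFσ]
    simp only [s]
    group
  · have h1 : s 0 = 0 := by
      simp only [s]
      rw [mul_apply, mul_apply, ← hΦ0, inv_apply_self, hrfix x₀ hx₀g]
    rw [hsm.eq, mul_apply, h1, translation_apply, zero_add]
  · refine not_itiFixedPoint_mul_translation (fun x hx => ?_) m
    have h1 := hx.pow q
    rw [hsq] at h1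
    exact not_itiFixedPoint_of_conj hitig x h1
  · exact hsp.mul_left ((commute_translation_int _ _).symm)

end CircleLift

/-- Normal forms for smooth circle diffeomorphisms with rotation number `p/q` and
vanishing asymptotic variation: up to smooth conjugacy, `f = g∘R_{p/q}` with `g` fixing
`0`, commuting with `R_{p/q}` and without ITI fixed point (if `f^q` has no ITI fixed
point), or `f = h∘R_{p/q}` with `h` supported in the arc `R_{-p/q}([0,1/q])` (if `f^q`
has an ITI fixed point); in both cases the factor has vanishing asymptotic variation. -/
theorem normal_form_rational_rotation_number
    (F : CircleLift) (p : ℤ) (q : ℕ) (hq : 1 ≤ q) (hcop : Nat.Coprime p.natAbs q)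
    (hrot : ∃ ρ : ℝ, Tendsto (fun n : ℕ => F.toFun^[n] 0 / n) atTop (nhds ρ) ∧
      ∃ m : ℤ, ρ = (p : ℝ) / (q : ℝ) + m)
    (hvar : AsympVarVanishesC F) :
    ((¬ ∃ x : ℝ, ITIFixedPoint (F.toFun^[q]) x) →
      ∃ Φ G : CircleLift,
        (∀ x : ℝ, Φ.toFun (F.toFun (Φ.invFun x)) = G.toFun (x + (p : ℝ) / (q : ℝ))) ∧
        (∃ m : ℤ, G.toFun 0 = (m : ℝ)) ∧
        (¬ ∃ x : ℝ, ITIFixedPoint G.toFun x) ∧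
        (∀ x : ℝ, G.toFun (x + (p : ℝ) / (q : ℝ)) = G.toFun x + (p : ℝ) / (q : ℝ)) ∧
        AsympVarVanishesC G) ∧
    ((∃ x : ℝ, ITIFixedPoint (F.toFun^[q]) x) →
      ∃ Φ H : CircleLift, ∃ m : ℤ,
        (∀ x : ℝ, Φ.toFun (F.toFun (Φ.invFun x)) = H.toFun (x + (p : ℝ) / (q : ℝ))) ∧
        (∀ x : ℝ, (∀ k : ℤ, x + (k : ℝ) ∉
            Set.Icc (-((p : ℝ) / (q : ℝ))) (-((p : ℝ) / (q : ℝ)) + 1 / (q : ℝ))) →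
          H.toFun x = x + (m : ℝ)) ∧
        AsympVarVanishesC H) := by
  obtain ⟨ρ, hρ, m, rfl⟩ := hrot
  have hq0 : (q : ℝ) ≠ 0 := by positivity
  have hP : (p : ℝ) / q + m = ((p + q * m : ℤ) : ℝ) / q := by
    push_cast
    field_simp
  rw [hP] at hρ
  have hpt : ∀ {Φ H : CircleLift}, Φ * F * Φ⁻¹ = H * CircleLift.translation (p / q) →
      ∀ x : ℝ, Φ.toFun (F.toFun (Φ.invFun x)) = H.toFun (x + (p : ℝ) / (q : ℝ)) :=
    fun h x => congrArg (fun G : CircleLift => G x) h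
  simp only [← CircleLift.coe_pow]
  constructor
  · intro hiti
    obtain ⟨Φ, G, h1, h2, h3, h4, h5⟩ := F.exists_normal_form_of_not_iti hq hvar
      (F.exists_periodic_point hq hρ) (not_exists.1 hiti)
    exact ⟨Φ, G, hpt h1, ⟨m, h2⟩, not_exists.2 h3,
      fun x => congrArg (fun G : CircleLift => G x) h4.eq, h5⟩
  · rintro ⟨a, ha⟩
    have hcop' : IsCoprime (p + q * m) (q : ℤ) := by
      rw [add_comm, IsCoprime.mul_add_left_left_iff]
      exact Int.isCoprime_iff_gcd_eq_one.2 (by simpa [Int.gcd] using hcop)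
    obtain ⟨n, hn⟩ := ha.1
    have hnP : n = p + q * m := F.eq_of_pow_apply_eq hq hρ hn
    obtain ⟨Φ, H, h1, h2, h3⟩ := F.exists_normal_form_of_iti hq hcop' hvar
      (ha.flatAt (hnP ▸ hn))
    exact ⟨Φ, H, m, hpt h1, h2, h3⟩
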